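/- There is an absolute constant C > 0 such that for every finite set P ⊆ ℝ² with |P| = N ≥ 2, the number of quadruples (p,q,s,t) ∈ P × P × P × P satisfying R(p,q) = R(s,t) ≠ 0 is at most C·N³·log N. -/

import Mathlib

/-- The rectangular area determined by two points of the plane. -/
noncomputable def rectArea (p q : ℝ × ℝ) : ℝ := (q.1 - p.1) * (q.2 - p.2)

namespace RectQuad

/-! ### Lines parametrised by pairs of points -/

section Lines

open MvPolynomial

variable {K : Type*}

/-- A line of the family is given by a pair of points of the plane. -/
abbrev Ln (K : Type*) := (K × K) × (K × K)

/-- A pair of lines is good if neither coordinate of the first parameters agrees. -/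
def Good (ℓ m : Ln K) : Prop := ℓ.1.1 ≠ m.1.1 ∧ ℓ.1.2 ≠ m.1.2

lemma Good.symm {ℓ m : Ln K} (h : Good ℓ m) : Good m ℓ := ⟨h.1.symm, h.2.symm⟩

lemma Good.ne {ℓ m : Ln K} (h : Good ℓ m) : ℓ ≠ m := fun e => h.1 (by rw [e])

/-- A line has the key `κ` if it lies on the special plane `keyPoly κ` below. -/
def HasKey (ℓ : Ln K) : (K × K) ⊕ (K × K) → Prop
  | .inl a => (ℓ.1.1, ℓ.2.1) = a
  | .inr a => (ℓ.1.2, ℓ.2.2) = a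

lemma not_good_of_hasKey {ℓ m : Ln K} {κ : (K × K) ⊕ (K × K)} (h1 : HasKey ℓ κ)
    (h2 : HasKey m κ) : ¬ Good ℓ m := by
  rintro ⟨g1, g2⟩
  rcases κ with ⟨a, b⟩ | ⟨a, b⟩
  · exact g1 ((Prod.ext_iff.1 h1).1.trans (Prod.ext_iff.1 h2).1.symm)
  · exact g2 ((Prod.ext_iff.1 h1).1.trans (Prod.ext_iff.1 h2).1.symm)

variable [Field K]

/-- The point with parameter `t` on the line `ℓ`. -/
def pt (ℓ : Ln K) (t : K) : Fin 3 → K :=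
  ![t, ℓ.2.1 - t * ℓ.1.1, t * ℓ.2.2 - ℓ.1.2]

/-- Incidence of a point with a line. -/
def OnL (ℓ : Ln K) (x : Fin 3 → K) : Prop :=
  x 1 = ℓ.2.1 - x 0 * ℓ.1.1 ∧ x 2 = x 0 * ℓ.2.2 - ℓ.1.2

/-- Restriction of a polynomial in three variables to a line. -/
noncomputable def res (ℓ : Ln K) : MvPolynomial (Fin 3) K →ₐ[K] Polynomial K :=
  aeval ![Polynomial.X, Polynomial.C ℓ.2.1 - Polynomial.X * Polynomial.C ℓ.1.1,
    Polynomial.X * Polynomial.C ℓ.2.2 - Polynomial.C ℓ.1.2]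

@[simp] lemma res_X0 (ℓ : Ln K) : res ℓ (X 0) = Polynomial.X := by simp [res]

@[simp] lemma res_X1 (ℓ : Ln K) :
    res ℓ (X 1) = Polynomial.C ℓ.2.1 - Polynomial.X * Polynomial.C ℓ.1.1 := by simp [res]

@[simp] lemma res_X2 (ℓ : Ln K) :
    res ℓ (X 2) = Polynomial.X * Polynomial.C ℓ.2.2 - Polynomial.C ℓ.1.2 := by simp [res]

@[simp] lemma res_C (ℓ : Ln K) (c : K) : res ℓ (C c) = Polynomial.C c := by
  simp [res]

lemma pt_onL (ℓ : Ln K) (t : K) : OnL ℓ (pt ℓ t) := by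
  simp [OnL, pt]

lemma OnL.eq_pt {ℓ : Ln K} {x : Fin 3 → K} (h : OnL ℓ x) : x = pt ℓ (x 0) := by
  funext i
  fin_cases i
  · simp [pt]
  · simpa [pt] using h.1
  · simpa [pt] using h.2

lemma eval_res (ℓ : Ln K) (f : MvPolynomial (Fin 3) K) (t : K) :
    (res ℓ f).eval t = eval (pt ℓ t) f := by
  induction f using MvPolynomial.induction_on with
  | C a => simp
  | add p q hp hq => simp [hp, hq]
  | mul_X p i hp =>
    rw [map_mul, Polynomial.eval_mul, hp, map_mul]
    fin_cases i
    · simp [pt]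
    · simp [pt, mul_comm t]
    · simp [pt, mul_comm t]

lemma OnL.eval_eq {ℓ : Ln K} {x : Fin 3 → K} (h : OnL ℓ x) (f : MvPolynomial (Fin 3) K) :
    eval x f = (res ℓ f).eval (x 0) := by
  rw [eval_res, ← h.eq_pt]

lemma OnL.eval_eq_zero {ℓ : Ln K} {x : Fin 3 → K} (h : OnL ℓ x) {f : MvPolynomial (Fin 3) K}
    (hf : res ℓ f = 0) : eval x f = 0 := by
  rw [h.eval_eq, hf, Polynomial.eval_zero]

lemma natDegree_res_le (ℓ : Ln K) (f : MvPolynomial (Fin 3) K) :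
    (res ℓ f).natDegree ≤ f.totalDegree := by
  have h : res ℓ f = ∑ m ∈ f.support, res ℓ (monomial m (f.coeff m)) := by
    conv_lhs => rw [f.as_sum, map_sum]
  rw [h]
  refine Polynomial.natDegree_sum_le_of_forall_le _ _ fun m hm => ?_
  refine le_trans ?_ (le_totalDegree hm)
  rw [res, aeval_monomial]
  refine (Polynomial.natDegree_mul_le).trans ?_
  rw [Polynomial.algebraMap_eq, Polynomial.natDegree_C, zero_add, Finsupp.prod, Finsupp.sum]
  refine (Polynomial.natDegree_prod_le _ _).trans (Finset.sum_le_sum fun i _ => ?_)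
  refine (Polynomial.natDegree_pow_le).trans ?_
  have : (![Polynomial.X, Polynomial.C ℓ.2.1 - Polynomial.X * Polynomial.C ℓ.1.1,
    Polynomial.X * Polynomial.C ℓ.2.2 - Polynomial.C ℓ.1.2] i : Polynomial K).natDegree ≤ 1 := by
    fin_cases i
    · simp
    · simp only [Fin.mk_one, Fin.isValue, Matrix.cons_val_one]
      refine (Polynomial.natDegree_sub_le _ _).trans (max_le (by simp) ?_)
      exact Polynomial.natDegree_mul_le.trans (by simp)
    · simp only [Fin.reduceFinMk, Matrix.cons_val]
      rw [mul_comm]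
      compute_degree
  nlinarith

/-- A polynomial with more zeros on a line than its degree vanishes on the line. -/
lemma res_eq_zero_of_card {ℓ : Ln K} {f : MvPolynomial (Fin 3) K} (s : Finset (Fin 3 → K))
    (hs : ∀ x ∈ s, OnL ℓ x ∧ eval x f = 0) (hc : f.totalDegree < s.card) : res ℓ f = 0 := by
  classical
  by_contra hne
  have hinj : Set.InjOn (fun x : Fin 3 → K => x 0) s := by
    intro x hx y hy hxy
    rw [(hs x hx).1.eq_pt, (hs y hy).1.eq_pt]
    simp only at hxy
    rw [hxy]
  have h2 : (s.image fun x => x 0) ⊆ (res ℓ f).roots.toFinset := by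
    intro t ht
    obtain ⟨x, hx, rfl⟩ := Finset.mem_image.1 ht
    rw [Multiset.mem_toFinset, Polynomial.mem_roots hne, Polynomial.IsRoot, ← (hs x hx).1.eval_eq]
    exact (hs x hx).2
  have h3 := Finset.card_le_card h2
  rw [Finset.card_image_of_injOn hinj] at h3
  have h4 := Multiset.toFinset_card_le (res ℓ f).roots
  have h5 := Polynomial.card_roots' (res ℓ f)
  have h6 := natDegree_res_le ℓ f
  omega

/-- The number of zeros on a line of a polynomial not vanishing on the line. -/
lemma card_zeros_le {ℓ : Ln K} {f : MvPolynomial (Fin 3) K} (hf : res ℓ f ≠ 0)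
    (s : Finset (Fin 3 → K)) (hs : ∀ x ∈ s, OnL ℓ x ∧ eval x f = 0) :
    s.card ≤ f.totalDegree := by
  by_contra h
  exact hf (res_eq_zero_of_card s hs (not_le.1 h))

lemma eq_of_two_points {ℓ m : Ln K} {x y : Fin 3 → K} (hxy : x ≠ y) (h1 : OnL ℓ x) (h2 : OnL ℓ y)
    (h3 : OnL m x) (h4 : OnL m y) : ℓ = m := by
  have h0 : x 0 - y 0 ≠ 0 := by
    intro h
    apply hxy
    rw [h1.eq_pt, h2.eq_pt, sub_eq_zero.1 h]
  obtain ⟨⟨p1, p2⟩, ⟨s1, s2⟩⟩ := ℓ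
  obtain ⟨⟨q1, q2⟩, ⟨t1, t2⟩⟩ := m
  simp only [OnL] at h1 h2 h3 h4
  have e1 : p1 = q1 := by
    apply mul_left_cancel₀ h0
    linear_combination h1.1 - h2.1 - h3.1 + h4.1
  have e2 : s2 = t2 := by
    apply mul_left_cancel₀ h0
    linear_combination -h1.2 + h2.2 + h3.2 - h4.2
  subst e1 e2
  have e3 : s1 = t1 := by linear_combination -h1.1 + h3.1
  have e4 : p2 = q2 := by linear_combination h1.2 - h3.2
  rw [e3, e4]

/-- Through a point with `x 0 ≠ 0` there is at most one line with given first parameter. -/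
lemma OnL.snd_eq {ℓ m : Ln K} {x : Fin 3 → K} (h0 : x 0 ≠ 0) (h1 : OnL ℓ x) (h2 : OnL m x)
    (h : ℓ.1 = m.1) : ℓ = m := by
  obtain ⟨⟨p1, p2⟩, ⟨s1, s2⟩⟩ := ℓ
  obtain ⟨⟨q1, q2⟩, ⟨t1, t2⟩⟩ := m
  simp only [OnL, Prod.mk.injEq] at h1 h2 h
  obtain ⟨rfl, rfl⟩ := h
  have e1 : s1 = t1 := by linear_combination -h1.1 + h2.1
  have e2 : s2 = t2 := by
    apply mul_left_cancel₀ h0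
    linear_combination -h1.2 + h2.2
  rw [e1, e2]

lemma Good.x0_ne {ℓ m : Ln K} (h : Good ℓ m) {x : Fin 3 → K} (h1 : OnL ℓ x) (h2 : OnL m x) :
    x 0 ≠ 0 := by
  intro h0
  apply h.2
  linear_combination h1.2 - h2.2 + h0 * (ℓ.2.2 - m.2.2)

/-- The special planes: `x₁ + x₀ p₁ = s₁` and `x₂ - x₀ s₂ + p₂ = 0`. -/
noncomputable def keyPoly : (K × K) ⊕ (K × K) → MvPolynomial (Fin 3) K
  | .inl a => X 1 + X 0 * C a.1 - C a.2
  | .inr a => X 2 - X 0 * C a.2 + C a.1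

lemma res_keyPoly_eq_zero_iff (ℓ : Ln K) (κ : (K × K) ⊕ (K × K)) :
    res ℓ (keyPoly κ) = 0 ↔ HasKey ℓ κ := by
  obtain ⟨⟨p1, p2⟩, ⟨s1, s2⟩⟩ := ℓ
  rcases κ with ⟨a, b⟩ | ⟨a, b⟩
  · simp only [keyPoly, HasKey, map_sub, map_add, map_mul, res_X1, res_X0, res_C, Prod.mk.injEq]
    constructor
    · intro h
      have h0 := congrArg (Polynomial.eval 0) h
      have h1 := congrArg (Polynomial.eval 1) h
      simp at h0 h1
      constructor <;> [linear_combination h0 - h1; linear_combination h0]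
    · rintro ⟨rfl, rfl⟩
      ring
  · simp only [keyPoly, HasKey, map_sub, map_add, map_mul, res_X2, res_X0, res_C, Prod.mk.injEq]
    constructor
    · intro h
      have h0 := congrArg (Polynomial.eval 0) h
      have h1 := congrArg (Polynomial.eval 1) h
      simp at h0 h1
      constructor <;> [linear_combination -h0; linear_combination h1 - h0]
    · rintro ⟨rfl, rfl⟩
      ring

lemma totalDegree_keyPoly_le (κ : (K × K) ⊕ (K × K)) :
    (keyPoly κ : MvPolynomial (Fin 3) K).totalDegree ≤ 1 := by
  have h1 : ∀ (i : Fin 3) (a : K), (X i * C a : MvPolynomial (Fin 3) K).totalDegree ≤ 1 := by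
    intro i a
    refine (totalDegree_mul _ _).trans ?_
    simp
  rcases κ with ⟨a, b⟩ | ⟨a, b⟩
  · refine (totalDegree_sub _ _).trans (max_le ((totalDegree_add _ _).trans (max_le ?_ ?_)) ?_)
    · simp
    · exact h1 _ _
    · simp
  · refine (totalDegree_add _ _).trans (max_le ((totalDegree_sub _ _).trans (max_le ?_ ?_)) ?_)
    · simp
    · exact h1 _ _
    · simp

end Lines

/-! ### A Bézout-type bound for lines -/

section Bezout

open MvPolynomial

variable {K : Type*}

/-- For two distinct lines there is a special plane through the second and not the first. -/
lemma exists_key_sep {ℓ m : Ln K} (h : ℓ ≠ m) : ∃ κ, HasKey m κ ∧ ¬ HasKey ℓ κ := by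
  by_contra! hc
  have h1 := hc (.inl (m.1.1, m.2.1)) rfl
  have h2 := hc (.inr (m.1.2, m.2.2)) rfl
  apply h
  simp only [HasKey, Prod.mk.injEq] at h1 h2
  exact Prod.ext (Prod.ext h1.1 h2.1) (Prod.ext h1.2 h2.2)

variable [Field K]

/-- The space of polynomials in three variables of total degree at most `m`. -/
noncomputable abbrev V (K : Type*) [Field K] (m : ℕ) : Submodule K (MvPolynomial (Fin 3) K) :=
  restrictTotalDegree (Fin 3) K m

lemma finrank_V (m : ℕ) : 6 * Module.finrank K (V K m) = (m + 1) * (m + 2) * (m + 3) := by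
  classical
  have e : {n : Fin 3 →₀ ℕ | (n.sum fun _ e => e) ≤ m} =
      ((Finset.range (m + 1)).biUnion fun j => (Finset.univ : Finset (Fin 3)).finsuppAntidiag j :
        Finset (Fin 3 →₀ ℕ)) := by
    ext n
    simp only [Set.mem_ofPred_eq, Finset.coe_biUnion, Finset.coe_range, Set.mem_Iio, Set.mem_iUnion,
      Finset.mem_coe, Finset.mem_finsuppAntidiag, Finset.subset_univ, and_true, exists_prop]
    rw [Finsupp.sum_fintype _ _ (fun _ => rfl)]
    constructor
    · intro h
      exact ⟨_, Nat.lt_succ_of_le h, rfl⟩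
    · rintro ⟨i, h, rfl⟩
      exact Nat.le_of_lt_succ h
  have h1 : Module.finrank K (V K m) = ∑ j ∈ Finset.range (m + 1), (j + 2).choose 2 := by
    rw [V, restrictTotalDegree, Module.finrank_eq_nat_card_basis (basisRestrictSupport K _), e]
    rw [Nat.card_coe_set_eq, Set.ncard_coe_finset, Finset.card_biUnion]
    · refine Finset.sum_congr rfl fun j _ => ?_
      rw [Finset.card_finsuppAntidiag_nat_eq_choose]
      simp only [Finset.card_univ, Fintype.card_fin]
      rw [show 3 + j - 1 = j + 2 by omega, Nat.choose_symm_add]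
    · intro i _ j _ hij
      rw [Function.onFun, Finset.disjoint_left]
      intro n hn hn'
      rw [Finset.mem_finsuppAntidiag] at hn hn'
      exact hij (hn.1.symm.trans hn'.1)
  rw [h1]
  clear h1 e
  induction m with
  | zero => simp
  | succ m ih =>
    rw [Finset.sum_range_succ, mul_add, ih]
    have : 2 * (m + 1 + 2).choose 2 = (m + 3) * (m + 2) := by
      rw [Nat.choose_two_right, show m + 1 + 2 - 1 = m + 2 by omega]
      refine Nat.mul_div_cancel' ?_
      have := Nat.even_mul_succ_self (m + 2)
      rw [mul_comm]
      exact this.two_dvd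
    nlinarith

/-- A product of special planes vanishing on all lines of `B` except `ℓ`. -/
lemma exists_separating (B : Finset (Ln K)) (ℓ : Ln K) (hℓ : ℓ ∈ B) :
    ∃ A : MvPolynomial (Fin 3) K, A.totalDegree + 1 ≤ B.card ∧ res ℓ A ≠ 0 ∧
      ∀ m ∈ B, m ≠ ℓ → res m A = 0 := by
  classical
  have hk : ∀ m : Ln K, ∃ κ, m ≠ ℓ → HasKey m κ ∧ ¬ HasKey ℓ κ := by
    intro m
    by_cases h : m = ℓ
    · exact ⟨.inl (0, 0), fun h' => absurd h h'⟩
    · obtain ⟨κ, hκ⟩ := exists_key_sep (Ne.symm h)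
      exact ⟨κ, fun _ => hκ⟩
  choose κ hκ using hk
  refine ⟨∏ m ∈ B.erase ℓ, keyPoly (κ m), ?_, ?_, ?_⟩
  · have h1 : (∏ m ∈ B.erase ℓ, keyPoly (κ m)).totalDegree ≤ ∑ m ∈ B.erase ℓ, 1 :=
      (totalDegree_finsetProd _ _).trans (Finset.sum_le_sum fun m _ => totalDegree_keyPoly_le _)
    rw [Finset.sum_const, smul_eq_mul, mul_one] at h1
    have := Finset.card_erase_add_one hℓ
    omega
  · rw [map_prod, Finset.prod_ne_zero_iff]
    intro m hm
    rw [Ne, res_keyPoly_eq_zero_iff]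
    exact (hκ m (Finset.ne_of_mem_erase hm)).2
  · intro m hm hne
    rw [map_prod]
    exact Finset.prod_eq_zero (Finset.mem_erase.2 ⟨hne, hm⟩)
      ((res_keyPoly_eq_zero_iff _ _).2 (hκ m hne).1)

/-- A univariate polynomial in the variable `X 0`. -/
noncomputable def up : Polynomial K →ₐ[K] MvPolynomial (Fin 3) K := Polynomial.aeval (X 0)

lemma res_up (ℓ : Ln K) (c : Polynomial K) : res ℓ (up c) = c := by
  rw [up, ← Polynomial.aeval_algHom_apply, res_X0, Polynomial.aeval_X_left_apply]

lemma totalDegree_up_le (c : Polynomial K) : (up c : MvPolynomial (Fin 3) K).totalDegree ≤ c.natDegree := by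
  rw [up, Polynomial.aeval_eq_sum_range]
  refine totalDegree_finsetSum_le fun i hi => ?_
  refine (totalDegree_smul_le _ _).trans ?_
  rw [totalDegree_X_pow]
  rw [Finset.mem_range] at hi
  omega

lemma bezout_aux {f G : MvPolynomial (Fin 3) K} (hf : Irreducible f) (hfG : ¬ f ∣ G)
    (B : Finset (Ln K)) (hB : ∀ ℓ ∈ B, res ℓ f = 0 ∧ res ℓ G = 0) (k : ℕ) :
    let m := f.totalDegree + G.totalDegree + B.card + k
    B.card * k + Module.finrank K (V K (m - f.totalDegree)) +
        Module.finrank K (V K (m - G.totalDegree)) ≤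
      Module.finrank K (V K m) +
        Module.finrank K (V K (m - f.totalDegree - G.totalDegree)) := by
  classical
  intro m
  set d := f.totalDegree with hd
  set e := G.totalDegree with he
  have hG0 : G ≠ 0 := fun h => hfG (h ▸ dvd_zero f)
  choose! A hA1 hA2 hA3 using exists_separating B
  let W := (Fin B.card → K)
  let Dm := (V K (m - d) × V K (m - e)) × (B → Polynomial.degreeLT K k)
  let T0 : Dm →ₗ[K] MvPolynomial (Fin 3) K :=
    ((LinearMap.mulLeft K f ∘ₗ (V K (m - d)).subtype) ∘ₗ LinearMap.fst K _ _ +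
      (LinearMap.mulLeft K G ∘ₗ (V K (m - e)).subtype) ∘ₗ LinearMap.snd K _ _) ∘ₗ
        LinearMap.fst K _ _ +
      (∑ ℓ : B, LinearMap.mulLeft K (A ℓ) ∘ₗ up.toLinearMap ∘ₗ
        (Polynomial.degreeLT K k).subtype ∘ₗ LinearMap.proj ℓ) ∘ₗ LinearMap.snd K _ _
  have T0_apply : ∀ x : Dm, T0 x = f * x.1.1.1 + G * x.1.2.1 +
      ∑ ℓ : B, A ℓ * up (x.2 ℓ).1 := by
    intro x
    change f * x.1.1.1 + G * x.1.2.1 + (∑ ℓ : B, LinearMap.mulLeft K (A ℓ) ∘ₗ up.toLinearMap ∘ₗ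
        (Polynomial.degreeLT K k).subtype ∘ₗ LinearMap.proj ℓ) x.2 = _
    rw [LinearMap.sum_apply]
    rfl
  have hmem : ∀ x, T0 x ∈ V K m := by
    intro x
    rw [T0_apply]
    refine Submodule.add_mem _ (Submodule.add_mem _ ?_ ?_) (Submodule.sum_mem _ fun ℓ _ => ?_)
    · have := (mem_restrictTotalDegree _ _ _).1 x.1.1.2
      rw [mem_restrictTotalDegree]
      refine (totalDegree_mul _ _).trans ?_
      omega
    · have := (mem_restrictTotalDegree _ _ _).1 x.1.2.2
      rw [mem_restrictTotalDegree]
      refine (totalDegree_mul _ _).trans ?_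
      omega
    · rw [mem_restrictTotalDegree]
      refine (totalDegree_mul _ _).trans ?_
      have h1 := hA1 ℓ ℓ.2
      have h2 : (up (x.2 ℓ).1 : MvPolynomial (Fin 3) K).totalDegree ≤ k := by
        refine (totalDegree_up_le _).trans ?_
        have := Polynomial.mem_degreeLT.1 (x.2 ℓ).2
        exact Polynomial.natDegree_le_of_degree_le this.le
      omega
  let T : Dm →ₗ[K] V K m := T0.codRestrict _ hmem
  let S0 : V K (m - d - e) →ₗ[K] V K (m - d) :=
    (LinearMap.mulLeft K G ∘ₗ (V K (m - d - e)).subtype).codRestrict _ (by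
      intro x
      have := (mem_restrictTotalDegree _ _ _).1 x.2
      rw [mem_restrictTotalDegree]
      refine (totalDegree_mul _ _).trans ?_
      change G.totalDegree + x.1.totalDegree ≤ _
      omega)
  let S1 : V K (m - d - e) →ₗ[K] V K (m - e) :=
    (-LinearMap.mulLeft K f ∘ₗ (V K (m - d - e)).subtype).codRestrict _ (by
      intro x
      have := (mem_restrictTotalDegree _ _ _).1 x.2
      rw [mem_restrictTotalDegree]
      change (-(f * x.1)).totalDegree ≤ _
      rw [totalDegree_neg]
      refine (totalDegree_mul _ _).trans ?_
      omega)
  let S : V K (m - d - e) →ₗ[K] Dm := (S0.prod S1).prod 0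
  have hker : LinearMap.ker T ≤ LinearMap.range S := by
    intro x hx
    have hx0 : T0 x = 0 := by
      have := congrArg Subtype.val (LinearMap.mem_ker.1 hx)
      exact this
    rw [T0_apply] at hx0
    have hx2 : ∀ ℓ : B, x.2 ℓ = 0 := by
      intro ℓ
      have h1 := congrArg (res ℓ.1) hx0
      rw [map_add, map_add, map_mul, map_mul, (hB ℓ ℓ.2).1, (hB ℓ ℓ.2).2, map_sum,
        Finset.sum_eq_single ℓ] at h1
      · rw [map_mul, res_up, zero_mul, zero_mul, zero_add, zero_add, map_zero] at h1
        exact Subtype.ext ((mul_eq_zero.1 h1).resolve_left (hA2 ℓ ℓ.2))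
      · intro b _ hb
        rw [map_mul, hA3 b b.2 ℓ ℓ.2 (fun h => hb (Subtype.ext h.symm)), zero_mul]
      · simp
    have h3 : f * x.1.1.1 + G * x.1.2.1 = 0 := by
      have : ∑ ℓ : B, A ℓ * up (x.2 ℓ).1 = 0 :=
        Finset.sum_eq_zero fun ℓ _ => by rw [hx2 ℓ]; simp
      rwa [this, add_zero] at hx0
    have h4 : f ∣ x.1.2.1 := by
      have : f ∣ G * x.1.2.1 := ⟨-x.1.1.1, by linear_combination h3⟩
      exact (hf.prime.dvd_or_dvd this).resolve_left hfG
    obtain ⟨c, hc⟩ := h4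
    have h5 : x.1.1.1 = G * (-c) := by
      apply mul_left_cancel₀ hf.ne_zero
      rw [hc] at h3
      linear_combination h3
    have h6 : (-c).totalDegree ≤ m - d - e := by
      by_cases hc0 : c = 0
      · simp [hc0]
      · have h7 := (mem_restrictTotalDegree _ _ _).1 x.1.1.2
        rw [h5, totalDegree_mul_of_isDomain hG0 (neg_ne_zero.2 hc0)] at h7
        omega
    refine ⟨⟨-c, (mem_restrictTotalDegree _ _ _).2 h6⟩, ?_⟩
    refine Prod.ext (Prod.ext ?_ ?_) ?_
    · exact Subtype.ext h5.symm
    · refine Subtype.ext ?_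
      change -(f * -c) = x.1.2.1
      rw [hc]
      ring
    · funext ℓ
      exact (hx2 ℓ).symm
  have r1 := LinearMap.finrank_range_add_finrank_ker T
  have r2 : Module.finrank K (LinearMap.range T) ≤ Module.finrank K (V K m) :=
    Submodule.finrank_le _
  have r3 : Module.finrank K (LinearMap.ker T) ≤ Module.finrank K (LinearMap.range S) :=
    Submodule.finrank_mono hker
  have r4 : Module.finrank K (LinearMap.range S) ≤ Module.finrank K (V K (m - d - e)) :=
    LinearMap.finrank_range_le S
  have r5 : Module.finrank K Dm = Module.finrank K (V K (m - d)) +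
      Module.finrank K (V K (m - e)) + B.card * k := by
    have hdeg : Module.finrank K (Polynomial.degreeLT K k) = k := by
      rw [(Polynomial.degreeLTEquiv K k).finrank_eq, Module.finrank_fin_fun]
    have : Module.Finite K (Polynomial.degreeLT K k) :=
      Module.Finite.equiv (Polynomial.degreeLTEquiv K k).symm
    rw [Module.finrank_prod, Module.finrank_prod, Module.finrank_pi_fintype]
    simp [hdeg]
  omega

/-- Distinct lines in the common zero set of an irreducible polynomial and a polynomial not
divisible by it: their number is at most the product of the degrees. -/
theorem bezout_lines {f G : MvPolynomial (Fin 3) K} (hf : Irreducible f) (hfG : ¬ f ∣ G)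
    (B : Finset (Ln K)) (hB : ∀ ℓ ∈ B, res ℓ f = 0 ∧ res ℓ G = 0) :
    B.card ≤ f.totalDegree * G.totalDegree := by
  have hall := bezout_aux hf hfG B hB
  simp only at hall
  set d := f.totalDegree
  set e := G.totalDegree
  set n := B.card
  by_contra! hlt
  have key := hall (n * (d + e + n + 2))
  set k := n * (d + e + n + 2) with hk
  rw [show d + e + n + k - d = e + n + k by omega, show d + e + n + k - e = d + n + k by omega,
    show e + n + k - e = n + k by omega] at key
  have f1 := finrank_V (K := K) (d + e + n + k)
  have f2 := finrank_V (K := K) (e + n + k)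
  have f3 := finrank_V (K := K) (d + n + k)
  have f4 := finrank_V (K := K) (n + k)
  have h6 : 6 * (n * k) + (e + n + k + 1) * (e + n + k + 2) * (e + n + k + 3) +
      (d + n + k + 1) * (d + n + k + 2) * (d + n + k + 3) ≤
      (d + e + n + k + 1) * (d + e + n + k + 2) * (d + e + n + k + 3) +
      (n + k + 1) * (n + k + 2) * (n + k + 3) := by
    rw [← f1, ← f2, ← f3, ← f4]
    omega
  have h7 : 6 * (n * k) ≤ d * e * (3 * (d + e) + 6 * (n + k) + 12) := by nlinarith
  have h8 : d * e + 1 ≤ n := hlt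
  have h9 : d * e * (3 * (d + e) + 6 * (n + k) + 12) + 6 * k ≤
      6 * (n * k) + d * e * (3 * (d + e) + 6 * n + 12) := by nlinarith
  have h10 : d * e * (3 * (d + e) + 6 * n + 12) < 6 * k := by
    rw [hk]
    nlinarith [Nat.zero_le (d * e), Nat.zero_le d, Nat.zero_le e,
      Nat.mul_le_mul_right (3 * (d + e) + 6 * n + 12) hlt.le]
  omega

end Bezout

/-! ### A weak ham sandwich theorem -/

section HamSandwich

open Filter Topology

/-- Averaging over transversals: an alternating function splits the classes on average. -/
lemma exists_transversal_split {X : Type*} {M : ℕ} (A : Fin M → Finset X)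
    (hA : ∀ i, (A i).Nonempty) (D : X → (Fin M → X) → ℝ)
    (hD : ∀ (i : Fin M) (u : X) (y : Fin M → X), D (y i) (Function.update y i u) = -D u y) :
    ∃ y : Fin M → X, (∀ i, y i ∈ A i) ∧
      3 * ∑ i, ((A i ×ˢ A i).filter fun p => 0 < D p.1 y * D p.2 y).card ≤
        2 * ∑ i, (A i).card ^ 2 := by
  classical
  set Y := Fintype.piFinset A with hY
  have hYne : Y.Nonempty := Fintype.piFinset_nonempty.2 hA
  have main : ∀ i, ∑ y ∈ Y, 3 * ((A i ×ˢ A i).filter fun p => 0 < D p.1 y * D p.2 y).card ≤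
      ∑ _y ∈ Y, 2 * (A i).card ^ 2 := by
    intro i
    let χ : (Fin M → X) × X × X → ℕ := fun z => if 0 < D z.2.1 z.1 * D z.2.2 z.1 then 1 else 0
    let ρ : (Fin M → X) × X × X → (Fin M → X) × X × X :=
      fun z => (Function.update z.1 i z.2.1, z.2.2, z.1 i)
    have hρ3 : ∀ z, ρ (ρ (ρ z)) = z := by
      rintro ⟨y, u, w⟩
      simp [ρ]
    have hρ : ∀ z ∈ Y ×ˢ (A i ×ˢ A i), ρ z ∈ Y ×ˢ (A i ×ˢ A i) := by
      rintro ⟨y, u, w⟩ hz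
      simp only [Finset.mem_product, hY, Fintype.mem_piFinset] at hz ⊢
      refine ⟨fun j => ?_, hz.2.2, hz.1 i⟩
      by_cases h : j = i
      · subst h
        simpa [ρ] using hz.2.1
      · simpa [ρ, h] using hz.1 j
    have hsum : ∀ g : (Fin M → X) × X × X → ℕ,
        ∑ z ∈ Y ×ˢ (A i ×ˢ A i), g (ρ z) = ∑ z ∈ Y ×ˢ (A i ×ˢ A i), g z := by
      intro g
      refine Finset.sum_bij' (fun z _ => ρ z) (fun z _ => ρ (ρ z)) hρ
        (fun z hz => hρ _ (hρ _ hz)) (fun z _ => hρ3 z) (fun z _ => hρ3 z) (fun z _ => rfl)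
    have h3 : ∀ z, χ z + χ (ρ z) + χ (ρ (ρ z)) ≤ 2 := by
      rintro ⟨y, u, w⟩
      by_contra! hc
      have hχ : ∀ z, χ z ≤ 1 := fun z => by simp only [χ]; split_ifs <;> omega
      have hpos : ∀ z, χ z = 1 → 0 < D z.2.1 z.1 * D z.2.2 z.1 := by
        intro z hz
        by_contra hcon
        simp [χ, hcon] at hz
      have e1 := hpos (y, u, w) (by have := hχ (y, u, w); have := hχ (ρ (y, u, w));
                                    have := hχ (ρ (ρ (y, u, w))); omega)
      have e2 := hpos (ρ (y, u, w)) (by have := hχ (y, u, w); have := hχ (ρ (y, u, w));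
                                        have := hχ (ρ (ρ (y, u, w))); omega)
      have e3 := hpos (ρ (ρ (y, u, w))) (by have := hχ (y, u, w); have := hχ (ρ (y, u, w));
                                            have := hχ (ρ (ρ (y, u, w))); omega)
      have k1 := hD i u y
      have k2 := hD i w y
      have k3 := hD i w (Function.update y i u)
      simp only [ρ, Function.update_self, Function.update_idem] at e1 e2 e3 k3
      rw [k1] at e2
      rw [k2, k3] at e3
      nlinarith [mul_pos e1 (mul_pos e2 e3), sq_nonneg (D u y * D w y * D w (Function.update y i u))]
    have h4 : ∑ z ∈ Y ×ˢ (A i ×ˢ A i), (χ z + χ (ρ z) + χ (ρ (ρ z))) ≤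
        ∑ z ∈ Y ×ˢ (A i ×ˢ A i), 2 := Finset.sum_le_sum fun z _ => h3 z
    rw [Finset.sum_add_distrib, Finset.sum_add_distrib, hsum (fun z => χ (ρ z)), hsum χ,
      Finset.sum_const, Finset.card_product, Finset.card_product, Finset.sum_product] at h4
    have h5 : ∀ y, ∑ p ∈ A i ×ˢ A i, χ (y, p) =
        ((A i ×ˢ A i).filter fun p => 0 < D p.1 y * D p.2 y).card := by
      intro y
      rw [Finset.card_filter]
    simp only [h5] at h4
    rw [← Finset.mul_sum, Finset.sum_const, smul_eq_mul]
    rw [smul_eq_mul] at h4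
    nlinarith
  have hex : ∑ y ∈ Y, ∑ i, 3 * ((A i ×ˢ A i).filter fun p => 0 < D p.1 y * D p.2 y).card ≤
      ∑ _y ∈ Y, ∑ i, 2 * (A i).card ^ 2 := by
    rw [Finset.sum_comm, Finset.sum_comm (s := Y)]
    exact Finset.sum_le_sum fun i _ => main i
  obtain ⟨y, hy, hle⟩ := Finset.exists_le_of_sum_le hYne hex
  refine ⟨y, Fintype.mem_piFinset.1 hy, ?_⟩
  rwa [Finset.mul_sum, Finset.mul_sum]

/-- For an invertible `B`, the matrix `A + t B` is invertible for all small `t ≠ 0`. -/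
lemma eventually_det_ne_zero {n : ℕ} (A B : Matrix (Fin n) (Fin n) ℝ) (hB : B.det ≠ 0) :
    ∀ᶠ t in 𝓝[≠] (0 : ℝ), (A + t • B).det ≠ 0 := by
  have hu : IsUnit B.det := isUnit_iff_ne_zero.2 hB
  set p := (-(A * B⁻¹)).charpoly with hp
  have hp0 : p ≠ 0 := (Matrix.charpoly_monic _).ne_zero
  have hev : ∀ t, (A + t • B).det = p.eval t * B.det := by
    intro t
    rw [hp, Matrix.eval_charpoly, ← Matrix.det_mul]
    congr 1
    rw [sub_neg_eq_add, add_mul, Matrix.mul_assoc, Matrix.nonsing_inv_mul _ hu, mul_one,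
      Matrix.scalar_apply, ← Matrix.smul_eq_diagonal_mul, add_comm]
  have hfin : {t : ℝ | p.IsRoot t}.Finite := Polynomial.finite_setOfPred_isRoot hp0
  have : ∀ᶠ t in 𝓝[≠] (0 : ℝ), t ∉ {t : ℝ | p.IsRoot t} \ {0} := by
    apply eventually_nhdsWithin_of_eventually_nhds
    exact (hfin.subset Set.sdiff_subset).isClosed.isOpen_compl.mem_nhds (by simp)
  filter_upwards [this, self_mem_nhdsWithin] with t ht ht0
  rw [hev]
  refine mul_ne_zero (fun h => ht ⟨h, ht0⟩) hB

/-- Weak ham sandwich: some nonzero functional splits the classes simultaneously. -/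
theorem exists_splitting_functional {X : Type*} {M : ℕ} (v : X → Fin (M + 1) → ℝ)
    (A : Fin M → Finset X) (hA : ∀ i, (A i).Nonempty)
    (hd : ∀ i j, i ≠ j → Disjoint (A i) (A j)) :
    ∃ c : Fin (M + 1) → ℝ, c ≠ 0 ∧
      3 * ∑ i, ((A i ×ˢ A i).filter fun p => 0 < (c ⬝ᵥ v p.1) * (c ⬝ᵥ v p.2)).card ≤
        2 * ∑ i, (A i).card ^ 2 := by
  classical
  obtain ⟨s, hs⟩ : ∃ s : X → ℕ, Set.InjOn s ((Finset.univ.biUnion A : Finset X) : Set X) :=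
    Set.countable_iff_exists_injOn.1 (Finset.countable_toSet _)
  -- the perturbed vectors
  let mom : ℝ → Fin (M + 1) → ℝ := fun a j => a ^ (j : ℕ)
  let vt : ℝ → X → Fin (M + 1) → ℝ := fun t x => v x + t • mom (s x)
  let Y := Fintype.piFinset A
  have hgen : ∀ᶠ t in 𝓝[≠] (0 : ℝ), ∀ y ∈ Y, ∃ w,
      Matrix.detRowAlternating (Fin.cons w (fun i => vt t (y i)) :
        Fin (M + 1) → Fin (M + 1) → ℝ) ≠ 0 := by
    rw [Filter.eventually_all_finset]
    intro y hy
    rw [Fintype.mem_piFinset] at hy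
    let nodes : Fin (M + 1) → ℝ := Fin.cons (-1) (fun i => (s (y i) : ℝ))
    have hinj : Function.Injective nodes := by
      refine Fin.cons_injective_iff.2 ⟨?_, ?_⟩
      · rintro ⟨i, hi⟩
        have : (0 : ℝ) ≤ s (y i) := Nat.cast_nonneg _
        simp only at hi
        linarith
      · intro i j hij
        have h1 : s (y i) = s (y j) := Nat.cast_injective (R := ℝ) hij
        have h2 : y i = y j := hs (by simpa using ⟨i, hy i⟩) (by simpa using ⟨j, hy j⟩) h1
        by_contra hne
        exact Finset.disjoint_left.1 (hd i j hne) (hy i) (h2 ▸ hy j)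
    have hdet : (Matrix.vandermonde nodes).det ≠ 0 := Matrix.det_vandermonde_ne_zero_iff.2 hinj
    filter_upwards [eventually_det_ne_zero
      (Matrix.of (Fin.cons 0 (fun i => v (y i)) : Fin (M + 1) → Fin (M + 1) → ℝ)) _ hdet] with t ht
    refine ⟨t • mom (-1), ?_⟩
    convert ht using 1
    change Matrix.det _ = _
    congr 1
    ext i j
    refine Fin.cases ?_ (fun i => ?_) i
    · simp [mom, nodes, Matrix.vandermonde]
    · simp [mom, nodes, vt, Matrix.vandermonde]
  have hstep : ∀ᶠ t in 𝓝[≠] (0 : ℝ), ∃ c : Fin (M + 1) → ℝ, ‖c‖ = 1 ∧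
      3 * ∑ i, ((A i ×ˢ A i).filter fun p => 0 < (c ⬝ᵥ vt t p.1) * (c ⬝ᵥ vt t p.2)).card ≤
        2 * ∑ i, (A i).card ^ 2 := by
    filter_upwards [hgen] with t ht
    let D : X → (Fin M → X) → ℝ := fun u y =>
      Matrix.detRowAlternating (Fin.cons (vt t u) (fun i => vt t (y i)) :
        Fin (M + 1) → Fin (M + 1) → ℝ)
    have hD : ∀ (i : Fin M) (u : X) (y : Fin M → X),
        D (y i) (Function.update y i u) = -D u y := by
      intro i u y
      have := (Matrix.detRowAlternating (R := ℝ) (n := Fin (M + 1))).map_swap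
        (Fin.cons (vt t u) (fun i => vt t (y i)) : Fin (M + 1) → Fin (M + 1) → ℝ)
        (Fin.succ_ne_zero i).symm
      rw [← this]
      simp only [D]
      congr 1
      funext k
      refine Fin.cases ?_ (fun k => ?_) k
      · simp
      · by_cases hk : k = i
        · subst hk
          simp
        · rw [Function.comp, Equiv.swap_apply_of_ne_of_ne (Fin.succ_ne_zero k)
            (fun h => hk (Fin.succ_injective _ h))]
          simp [hk]
    obtain ⟨y, hy, hle⟩ := exists_transversal_split A hA D hD
    obtain ⟨w, hw⟩ := ht y (Fintype.mem_piFinset.2 hy)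
    let Lf : (Fin (M + 1) → ℝ) →ₗ[ℝ] ℝ :=
      (Matrix.detRowAlternating (R := ℝ) (n := Fin (M + 1))).toMultilinearMap.toLinearMap
        (Fin.cons 0 (fun i => vt t (y i))) 0
    have hLf : ∀ w, Lf w = Matrix.detRowAlternating (Fin.cons w (fun i => vt t (y i)) :
        Fin (M + 1) → Fin (M + 1) → ℝ) := by
      intro w
      simp [Lf, Fin.update_cons_zero]
    let c : Fin (M + 1) → ℝ := fun j => Lf (fun k => if j = k then 1 else 0)
    have hc : ∀ w, Lf w = c ⬝ᵥ w := by
      intro w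
      rw [LinearMap.pi_apply_eq_sum_univ Lf w, dotProduct]
      refine Finset.sum_congr rfl fun j _ => ?_
      rw [smul_eq_mul, mul_comm]
    have hc0 : c ≠ 0 := by
      intro h
      apply hw
      rw [← hLf, hc, h, zero_dotProduct]
    have hn : 0 < ‖c‖ := norm_pos_iff.2 hc0
    refine ⟨‖c‖⁻¹ • c, ?_, ?_⟩
    · rw [norm_smul, norm_inv, norm_norm, inv_mul_cancel₀ hn.ne']
    · refine le_trans (Nat.mul_le_mul_left 3 (Finset.sum_le_sum fun i _ => ?_)) hle
      refine Finset.card_le_card fun p hp => ?_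
      rw [Finset.mem_filter] at hp ⊢
      refine ⟨hp.1, ?_⟩
      have h1 := hp.2
      rw [smul_dotProduct, smul_dotProduct, smul_eq_mul, smul_eq_mul] at h1
      have h2 : ∀ u, D u y = c ⬝ᵥ vt t u := fun u => by rw [← hc, hLf]
      rw [h2, h2]
      have h3 : ‖c‖⁻¹ * c ⬝ᵥ vt t p.1 * (‖c‖⁻¹ * c ⬝ᵥ vt t p.2) =
        (‖c‖⁻¹) ^ 2 * (c ⬝ᵥ vt t p.1 * c ⬝ᵥ vt t p.2) := by ring
      rw [h3] at h1
      exact pos_of_mul_pos_right h1 (sq_nonneg _)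
  obtain ⟨τ, hτ0, hτ⟩ := Filter.exists_seq_forall_of_frequently hstep.frequently
  choose c hc1 hc2 using hτ
  have hτ0' : Tendsto τ atTop (𝓝 0) := tendsto_nhds_of_tendsto_nhdsWithin hτ0
  obtain ⟨c0, hc0, φ, hφ, hlim⟩ := (isCompact_sphere (0 : Fin (M + 1) → ℝ) 1).tendsto_subseq
    (x := c) (fun n => by simpa using hc1 n)
  refine ⟨c0, ?_, ?_⟩
  · rintro rfl
    simp at hc0
  · have hval : ∀ x, Tendsto (fun n => c (φ n) ⬝ᵥ vt (τ (φ n)) x) atTop (𝓝 (c0 ⬝ᵥ v x)) := by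
      intro x
      have h1 : Tendsto (fun n => vt (τ (φ n)) x) atTop (𝓝 (v x)) := by
        have := ((hτ0'.comp hφ.tendsto_atTop).smul_const (mom (s x))).const_add (v x)
        simpa [vt] using this
      simp only [dotProduct]
      refine tendsto_finsetSum _ fun j _ => ?_
      exact ((tendsto_pi_nhds.1 hlim) j).mul ((tendsto_pi_nhds.1 h1) j)
    have hev : ∀ᶠ n in atTop, ∀ p ∈ (Finset.univ.biUnion fun i => A i ×ˢ A i),
        0 < (c0 ⬝ᵥ v p.1) * (c0 ⬝ᵥ v p.2) →
        0 < (c (φ n) ⬝ᵥ vt (τ (φ n)) p.1) * (c (φ n) ⬝ᵥ vt (τ (φ n)) p.2) := by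
      rw [Filter.eventually_all_finset]
      intro p _
      by_cases h : 0 < (c0 ⬝ᵥ v p.1) * (c0 ⬝ᵥ v p.2)
      · filter_upwards [((hval p.1).mul (hval p.2)).eventually_const_lt h] with n hn _
        exact hn
      · exact Eventually.of_forall fun n h' => absurd h' h
    obtain ⟨n, hn⟩ := hev.exists
    refine le_trans (Nat.mul_le_mul_left 3 (Finset.sum_le_sum fun i _ => ?_)) (hc2 (φ n))
    refine Finset.card_le_card fun p hp => ?_
    rw [Finset.mem_filter] at hp ⊢
    exact ⟨hp.1, hn p (Finset.mem_biUnion.2 ⟨i, Finset.mem_univ _, hp.1⟩) hp.2⟩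

end HamSandwich

/-! ### Polynomial partitioning -/

section Partition

open MvPolynomial

/-- Two points lie in the same open cell of the arrangement given by the polynomials `Fs`. -/
def SameCell (Fs : List (MvPolynomial (Fin 3) ℝ)) (x y : Fin 3 → ℝ) : Prop :=
  ∀ f ∈ Fs, 0 < eval x f * eval y f

lemma SameCell.symm {Fs : List (MvPolynomial (Fin 3) ℝ)} {x y : Fin 3 → ℝ}
    (h : SameCell Fs x y) : SameCell Fs y x := fun f hf => by
  rw [mul_comm]
  exact h f hf

lemma SameCell.trans {Fs : List (MvPolynomial (Fin 3) ℝ)} {x y z : Fin 3 → ℝ}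
    (h : SameCell Fs x y) (h' : SameCell Fs y z) : SameCell Fs x z := fun f hf => by
  have h1 := h f hf
  have h2 := h' f hf
  have h3 : 0 < (eval x f * eval z f) * (eval y f) ^ 2 := by nlinarith [mul_pos h1 h2]
  exact pos_of_mul_pos_left h3 (sq_nonneg _)

open Classical in
/-- The number of ordered pairs of points in a common cell. -/
noncomputable def cellPairs (S : Finset (Fin 3 → ℝ)) (Fs : List (MvPolynomial (Fin 3) ℝ)) : ℕ :=
  ((S ×ˢ S).filter fun p => SameCell Fs p.1 p.2).card

lemma exists_poly_splitting {M e : ℕ} (hM : M + 1 ≤ (e + 1) ^ 3)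
    (A : Fin M → Finset (Fin 3 → ℝ)) (hA : ∀ i, (A i).Nonempty)
    (hd : ∀ i j, i ≠ j → Disjoint (A i) (A j)) :
    ∃ f : MvPolynomial (Fin 3) ℝ, f ≠ 0 ∧ f.totalDegree ≤ 3 * e ∧
      3 * ∑ i, ((A i ×ˢ A i).filter fun p => 0 < eval p.1 f * eval p.2 f).card ≤
        2 * ∑ i, (A i).card ^ 2 := by
  obtain ⟨emb⟩ : Nonempty (Fin (M + 1) ↪ (Fin 3 → Fin (e + 1))) := by
    apply Function.Embedding.nonempty_of_card_le
    simpa using hM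
  let mon : Fin (M + 1) → (Fin 3 →₀ ℕ) := fun j =>
    Finsupp.equivFunOnFinite.symm fun i => (emb j i : ℕ)
  have hmon : Function.Injective mon := by
    intro i j hij
    apply emb.injective
    funext k
    have := DFunLike.congr_fun hij k
    exact Fin.ext this
  obtain ⟨c, hc0, hc⟩ := exists_splitting_functional
    (fun (x : Fin 3 → ℝ) j => eval x (monomial (mon j) (1 : ℝ))) A hA hd
  refine ⟨∑ j, monomial (mon j) (c j), ?_, ?_, ?_⟩
  · intro h
    apply hc0
    funext j
    have := congrArg (coeff (mon j)) h
    rw [coeff_sum, Finset.sum_eq_single j] at this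
    · simpa using this
    · intro b _ hb
      rw [coeff_monomial, if_neg (fun h => hb (hmon h))]
    · simp
  · refine totalDegree_finsetSum_le fun j _ => (totalDegree_monomial_le _ _).trans ?_
    rw [Finsupp.sum_fintype _ _ (fun _ => rfl), Fin.sum_univ_three]
    have h : ∀ i, mon j i ≤ e := fun i => Nat.le_of_lt_succ (emb j i).2
    have := h 0
    have := h 1
    have := h 2
    simp only [id]
    omega
  · have : ∀ x, eval x (∑ j, monomial (mon j) (c j)) =
        c ⬝ᵥ fun j => eval x (monomial (mon j) (1 : ℝ)) := by
      intro x
      rw [map_sum, dotProduct]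
      refine Finset.sum_congr rfl fun j _ => ?_
      simp [eval_monomial]
    simpa only [this] using hc

/-- One refinement step. -/
lemma exists_refine (S : Finset (Fin 3 → ℝ)) (Fs : List (MvPolynomial (Fin 3) ℝ)) (j : ℕ) :
    ∃ f : MvPolynomial (Fin 3) ℝ, f ≠ 0 ∧ f.totalDegree ≤ 3 * 2 ^ j ∧
      3 * 8 ^ j * cellPairs S (f :: Fs) ≤ 2 * 8 ^ j * cellPairs S Fs + S.card ^ 2 := by
  classical
  let cell : (Fin 3 → ℝ) → Finset (Fin 3 → ℝ) := fun x => S.filter fun y => SameCell Fs x y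
  let Big : Finset (Fin 3 → ℝ) := S.filter fun x => S.card < 8 ^ j * (cell x).card
  let 𝒜 : Finset (Finset (Fin 3 → ℝ)) := Big.image cell
  have hcell : ∀ A ∈ 𝒜, ∃ x ∈ S, S.card < 8 ^ j * (cell x).card ∧ cell x = A := by
    intro A hA
    obtain ⟨x, hx, rfl⟩ := Finset.mem_image.1 hA
    exact ⟨x, (Finset.mem_filter.1 hx).1, (Finset.mem_filter.1 hx).2, rfl⟩
  have hcelleq : ∀ x y, SameCell Fs x y → cell x = cell y := by
    intro x y h
    ext z
    simp only [cell, Finset.mem_filter]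
    exact and_congr_right fun _ => ⟨fun h' => h.symm.trans h', fun h' => h.trans h'⟩
  have hdisj : ∀ A ∈ 𝒜, ∀ B ∈ 𝒜, A ≠ B → Disjoint A B := by
    intro A hA B hB hne
    obtain ⟨x, _, _, rfl⟩ := hcell A hA
    obtain ⟨y, _, _, rfl⟩ := hcell B hB
    rw [Finset.disjoint_left]
    intro z hz hz'
    apply hne
    rw [hcelleq x z (Finset.mem_filter.1 hz).2, hcelleq y z (Finset.mem_filter.1 hz').2]
  have hpd : (𝒜 : Set (Finset (Fin 3 → ℝ))).PairwiseDisjoint id := fun A hA B hB h =>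
    hdisj A hA B hB h
  have hsub : 𝒜.biUnion id ⊆ S := by
    intro z hz
    obtain ⟨A, hA, hz⟩ := Finset.mem_biUnion.1 hz
    obtain ⟨x, _, _, rfl⟩ := hcell A hA
    exact (Finset.mem_filter.1 hz).1
  have hsumcard : ∑ A ∈ 𝒜, A.card ≤ S.card := by
    have := Finset.card_le_card hsub
    rwa [Finset.card_biUnion hpd] at this
  have hM : 𝒜.card + 1 ≤ 8 ^ j := by
    rcases 𝒜.eq_empty_or_nonempty with h | h
    · rw [h, Finset.card_empty]
      exact Nat.one_le_pow _ _ (by norm_num)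
    · have h1 : ∑ A ∈ 𝒜, S.card < ∑ A ∈ 𝒜, 8 ^ j * A.card := by
        refine Finset.sum_lt_sum_of_nonempty h fun A hA => ?_
        obtain ⟨x, _, hx, rfl⟩ := hcell A hA
        exact hx
      rw [Finset.sum_const, smul_eq_mul, ← Finset.mul_sum] at h1
      have h2 : 8 ^ j * ∑ A ∈ 𝒜, A.card ≤ 8 ^ j * S.card := Nat.mul_le_mul_left _ hsumcard
      exact lt_of_mul_lt_mul_right (h1.trans_le h2) (Nat.zero_le _)
  let A : Fin 𝒜.card → Finset (Fin 3 → ℝ) := fun i => (𝒜.equivFin.symm i).1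
  have hAmem : ∀ i, A i ∈ 𝒜 := fun i => (𝒜.equivFin.symm i).2
  have hsumA : ∀ g : Finset (Fin 3 → ℝ) → ℕ, ∑ i, g (A i) = ∑ B ∈ 𝒜, g B := by
    intro g
    rw [← Finset.sum_coe_sort 𝒜]
    exact Equiv.sum_comp 𝒜.equivFin.symm fun B => g B.1
  obtain ⟨f, hf0, hfd, hf⟩ := exists_poly_splitting (M := 𝒜.card) (e := 2 ^ j - 1) (by
      rw [Nat.sub_add_cancel Nat.one_le_two_pow, ← pow_mul, mul_comm, pow_mul]
      exact hM) A (by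
      intro i
      obtain ⟨x, _, hx, hxA⟩ := hcell _ (hAmem i)
      rw [← hxA, ← Finset.card_pos]
      by_contra hcon
      rw [Nat.eq_zero_of_not_pos hcon] at hx
      omega) (by
      intro i k hik
      refine hdisj _ (hAmem i) _ (hAmem k) fun h => hik ?_
      exact 𝒜.equivFin.symm.injective (Subtype.ext h))
  rw [hsumA (fun B => ((B ×ˢ B).filter fun p => 0 < eval p.1 f * eval p.2 f).card),
    hsumA (fun B => B.card ^ 2)] at hf
  refine ⟨f, hf0, hfd.trans (by omega), ?_⟩
  -- decompose the pairs according to large and small cells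
  have hpairs : ∀ Q : (Fin 3 → ℝ) × (Fin 3 → ℝ) → Prop,
      ((S ×ˢ S).filter fun p => SameCell Fs p.1 p.2 ∧ Q p).card =
        (∑ B ∈ 𝒜, ((B ×ˢ B).filter Q).card) +
        ((S ×ˢ S).filter fun p => (SameCell Fs p.1 p.2 ∧ Q p) ∧ p.1 ∉ Big).card := by
    intro Q
    rw [← Finset.card_filter_add_card_filter_not (s := (S ×ˢ S).filter fun p =>
      SameCell Fs p.1 p.2 ∧ Q p) (fun p => p.1 ∈ Big), Finset.filter_filter, Finset.filter_filter]
    congr 1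
    rw [← Finset.card_biUnion]
    · congr 1
      ext ⟨x, y⟩
      simp only [Finset.mem_filter, Finset.mem_product, Finset.mem_biUnion]
      constructor
      · rintro ⟨⟨hx, hy⟩, ⟨hxy, hQ⟩, hb⟩
        refine ⟨cell x, Finset.mem_image_of_mem _ hb, ⟨?_, ?_⟩, hQ⟩
        · exact Finset.mem_filter.2 ⟨hx, hxy.trans hxy.symm⟩
        · exact Finset.mem_filter.2 ⟨hy, hxy⟩
      · rintro ⟨B, hB, ⟨hxB, hyB⟩, hQ⟩
        obtain ⟨z, hz, hzb, rfl⟩ := hcell B hB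
        have h1 := (Finset.mem_filter.1 hxB)
        have h2 := (Finset.mem_filter.1 hyB)
        refine ⟨⟨h1.1, h2.1⟩, ⟨h1.2.symm.trans h2.2, hQ⟩, Finset.mem_filter.2 ⟨h1.1, ?_⟩⟩
        rwa [← hcelleq _ _ h1.2]
    · intro B hB B' hB' hne
      rw [Function.onFun, Finset.disjoint_left]
      rintro ⟨x, y⟩ h h'
      simp only [Finset.mem_filter, Finset.mem_product] at h h'
      exact Finset.disjoint_left.1 (hdisj B hB B' hB' hne) h.1.1 h'.1.1
  have e1 : cellPairs S (f :: Fs) =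
      ((S ×ˢ S).filter fun p => SameCell Fs p.1 p.2 ∧ 0 < eval p.1 f * eval p.2 f).card := by
    rw [cellPairs]
    congr 1
    ext p
    simp [SameCell, and_comm]
  have e2 : cellPairs S Fs = ((S ×ˢ S).filter fun p => SameCell Fs p.1 p.2 ∧ True).card := by
    rw [cellPairs]
    congr 1
    ext p
    simp
  have h1 := hpairs (fun p => 0 < eval p.1 f * eval p.2 f)
  rw [← e1] at h1
  have h2 : cellPairs S Fs = ∑ B ∈ 𝒜, B.card ^ 2 +
      ((S ×ˢ S).filter fun p => (SameCell Fs p.1 p.2 ∧ True) ∧ p.1 ∉ Big).card := by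
    have h3 : ∀ B ∈ 𝒜, B.card ^ 2 = ((B ×ˢ B).filter fun _ => True).card := by
      intro B _
      simp [sq]
    rw [e2, Finset.sum_congr rfl h3]
    convert hpairs fun _ => True
  have h4 : ((S ×ˢ S).filter fun p => (SameCell Fs p.1 p.2 ∧ 0 < eval p.1 f * eval p.2 f) ∧
      p.1 ∉ Big).card ≤ ((S ×ˢ S).filter fun p => (SameCell Fs p.1 p.2 ∧ True) ∧
      p.1 ∉ Big).card := by
    refine Finset.card_le_card fun p hp => ?_
    rw [Finset.mem_filter] at hp ⊢
    exact ⟨hp.1, ⟨hp.2.1.1, trivial⟩, hp.2.2⟩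
  have h5 : 8 ^ j * ((S ×ˢ S).filter fun p => (SameCell Fs p.1 p.2 ∧ True) ∧
      p.1 ∉ Big).card ≤ S.card ^ 2 := by
    have : ((S ×ˢ S).filter fun p => (SameCell Fs p.1 p.2 ∧ True) ∧ p.1 ∉ Big).card =
        ∑ x ∈ S.filter (fun x => x ∉ Big), (cell x).card := by
      rw [← Finset.card_sigma]
      refine Finset.card_bij' (fun p _ => ⟨p.1, p.2⟩) (fun p _ => (p.1, p.2)) ?_ ?_ ?_ ?_
      · rintro ⟨x, y⟩ h
        simp only [Finset.mem_filter, Finset.mem_product, Finset.mem_sigma, cell] at h ⊢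
        tauto
      · rintro ⟨x, y⟩ h
        simp only [Finset.mem_filter, Finset.mem_product, Finset.mem_sigma, cell] at h ⊢
        tauto
      · intros; rfl
      · intros; rfl
    rw [this, Finset.mul_sum, sq]
    refine (Finset.sum_le_card_nsmul _ _ S.card fun x hx => ?_).trans ?_
    · rw [Finset.mem_filter] at hx
      by_contra hcon
      exact hx.2 (Finset.mem_filter.2 ⟨hx.1, not_le.1 hcon⟩)
    · rw [smul_eq_mul]
      exact Nat.mul_le_mul_right _ (Finset.card_filter_le _ _)
  set a := ∑ B ∈ 𝒜, B.card ^ 2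
  set b := ((S ×ˢ S).filter fun p => (SameCell Fs p.1 p.2 ∧ True) ∧ p.1 ∉ Big).card
  set a' := ∑ B ∈ 𝒜, ((B ×ˢ B).filter fun p => 0 < eval p.1 f * eval p.2 f).card
  rw [h2]
  have h6 : 3 * cellPairs S (f :: Fs) ≤ 2 * a + 3 * b := by omega
  nlinarith [Nat.mul_le_mul_left (8 ^ j) h6]

/-- Several refinement steps at the same scale. -/
lemma exists_refine_iterate (S : Finset (Fin 3 → ℝ)) (Fs : List (MvPolynomial (Fin 3) ℝ)) (j : ℕ)
    (n : ℕ) : ∃ Gs : List (MvPolynomial (Fin 3) ℝ), (∀ f ∈ Gs, f ≠ 0) ∧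
      (Gs.map totalDegree).sum ≤ n * (3 * 2 ^ j) ∧
      (8 ^ j * cellPairs S (Gs ++ Fs) : ℝ) ≤
        (2 / 3) ^ n * (8 ^ j * cellPairs S Fs) + (S.card : ℝ) ^ 2 := by
  induction n with
  | zero => exact ⟨[], by simp, by simp, by simp⟩
  | succ n ih =>
    obtain ⟨Gs, h1, h2, h3⟩ := ih
    obtain ⟨f, hf0, hfd, hf⟩ := exists_refine S (Gs ++ Fs) j
    refine ⟨f :: Gs, ?_, ?_, ?_⟩
    · intro g hg
      rcases List.mem_cons.1 hg with rfl | hg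
      · exact hf0
      · exact h1 g hg
    · rw [List.map_cons, List.sum_cons]
      linarith
    · have hf' : (3 * 8 ^ j * cellPairs S (f :: (Gs ++ Fs)) : ℝ) ≤
        2 * 8 ^ j * cellPairs S (Gs ++ Fs) + (S.card : ℝ) ^ 2 := by exact_mod_cast hf
      rw [List.cons_append, pow_succ]
      linarith

/-- Iterated partitioning with `8 ^ J` as the effective number of cells. -/
lemma exists_partition (S : Finset (Fin 3 → ℝ)) (J : ℕ) :
    ∃ Fs : List (MvPolynomial (Fin 3) ℝ), (∀ f ∈ Fs, f ≠ 0) ∧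
      (Fs.map totalDegree).sum ≤ 42 * 2 ^ J ∧
      (8 ^ J * cellPairs S Fs : ℝ) ≤ 2 * (S.card : ℝ) ^ 2 := by
  classical
  induction J with
  | zero =>
    refine ⟨[], by simp, by simp, ?_⟩
    have h : cellPairs S [] ≤ S.card ^ 2 := by
      rw [cellPairs, sq, ← Finset.card_product]
      exact Finset.card_filter_le _ _
    have h' : (cellPairs S [] : ℝ) ≤ (S.card : ℝ) ^ 2 := by exact_mod_cast h
    rw [pow_zero, one_mul]
    nlinarith [sq_nonneg (S.card : ℝ)]
  | succ J ih =>
    obtain ⟨Fs, h1, h2, h3⟩ := ih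
    obtain ⟨Gs, g1, g2, g3⟩ := exists_refine_iterate S Fs (J + 1) 7
    refine ⟨Gs ++ Fs, ?_, ?_, ?_⟩
    · intro f hf
      rcases List.mem_append.1 hf with hf | hf
      · exact g1 f hf
      · exact h1 f hf
    · rw [List.map_append, List.sum_append]
      rw [pow_succ] at g2 ⊢
      linarith
    · refine g3.trans ?_
      rw [pow_succ 8 J]
      norm_num
      nlinarith [sq_nonneg (S.card : ℝ)]

lemma mul_pos_of_no_zero {p : Polynomial ℝ} {a b : ℝ} (hab : a ≤ b)
    (h : ∀ t ∈ Set.Icc a b, p.eval t ≠ 0) : 0 < p.eval a * p.eval b := by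
  by_contra hcon
  have hcont : ContinuousOn (fun t => p.eval t) (Set.Icc a b) := p.continuous.continuousOn
  have ha := h a (Set.left_mem_Icc.2 hab)
  have hb := h b (Set.right_mem_Icc.2 hab)
  have hneg : p.eval a * p.eval b < 0 := lt_of_le_of_ne (not_lt.1 hcon) (mul_ne_zero ha hb)
  rcases mul_neg_iff.1 hneg with ⟨h1, h2⟩ | ⟨h1, h2⟩
  · obtain ⟨t, ht, ht0⟩ := intermediate_value_Icc' hab hcont ⟨h2.le, h1.le⟩
    exact h t ht ht0
  · obtain ⟨t, ht, ht0⟩ := intermediate_value_Icc hab hcont ⟨h1.le, h2.le⟩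
    exact h t ht ht0

/-- Collisions of a map to a set with few elements. -/
lemma card_le_add_collisions {α : Type*} [DecidableEq α] (A : Finset α) (h : α → ℕ) (n : ℕ)
    (hn : ∀ x ∈ A, h x < n) :
    A.card ≤ n + ((A ×ˢ A).filter fun p => p.1 ≠ p.2 ∧ h p.1 = h p.2).card := by
  classical
  have h1 : A.card = ∑ b ∈ Finset.range n, (A.filter fun x => h x = b).card :=
    Finset.card_eq_sum_card_fiberwise fun x hx => Finset.mem_coe.2 (Finset.mem_range.2 (hn x hx))
  have h2 : ((A ×ˢ A).filter fun p => p.1 ≠ p.2 ∧ h p.1 = h p.2).card =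
      ∑ b ∈ Finset.range n, ((A.filter fun x => h x = b).offDiag).card := by
    rw [← Finset.card_biUnion]
    · congr 1
      ext ⟨x, y⟩
      simp only [Finset.mem_filter, Finset.mem_product, Finset.mem_biUnion, Finset.mem_range,
        Finset.mem_offDiag]
      constructor
      · rintro ⟨⟨hx, hy⟩, hne, he⟩
        exact ⟨h x, hn x hx, ⟨hx, rfl⟩, ⟨hy, he.symm⟩, hne⟩
      · rintro ⟨b, _, ⟨hx, rfl⟩, ⟨hy, he⟩, hne⟩
        exact ⟨⟨hx, hy⟩, hne, he.symm⟩
    · intro b _ b' _ hne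
      rw [Function.onFun, Finset.disjoint_left]
      rintro ⟨x, y⟩ hx hx'
      simp only [Finset.mem_offDiag, Finset.mem_filter] at hx hx'
      exact hne (hx.1.2.symm.trans hx'.1.2)
  have h3 : n = ∑ b ∈ Finset.range n, 1 := by simp
  rw [h1, h2]
  conv_rhs => rw [h3]
  simp only [Finset.sum_const, smul_eq_mul, mul_one, Finset.card_range]
  nth_rewrite 2 [h3]
  rw [← Finset.sum_add_distrib]
  refine Finset.sum_le_sum fun b _ => ?_
  rw [Finset.offDiag_card]
  set a := (A.filter fun x => h x = b).card
  rcases Nat.lt_or_ge a 2 with h | h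
  · omega
  · have : 2 * a ≤ a * a := Nat.mul_le_mul_right a h
    omega

open Classical in
/-- The polynomial partitioning theorem, in the form of an incidence bound off the zero set. -/
theorem exists_partition_incidences (S : Finset (Fin 3 → ℝ)) (J : ℕ) :
    ∃ F : MvPolynomial (Fin 3) ℝ, F ≠ 0 ∧ F.totalDegree ≤ 42 * 2 ^ J ∧
      ∀ L : Finset (Ln ℝ),
        (8 ^ J * ∑ ℓ ∈ L, (S.filter fun x => OnL ℓ x ∧ eval x F ≠ 0).card : ℝ) ≤
          8 ^ J * (L.card * (42 * 2 ^ J + 1)) + 2 * (S.card : ℝ) ^ 2 := by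
  obtain ⟨Fs, h0, hdeg, hpairs⟩ := exists_partition S J
  have hF0 : Fs.prod ≠ 0 := List.prod_ne_zero fun h => h0 0 h rfl
  have hFd : Fs.prod.totalDegree ≤ 42 * 2 ^ J := (totalDegree_list_prod Fs).trans hdeg
  refine ⟨Fs.prod, hF0, hFd, fun L => ?_⟩
  set D := 42 * 2 ^ J with hD
  let Pl : Ln ℝ → Finset ((Fin 3 → ℝ) × (Fin 3 → ℝ)) := fun ℓ =>
    (S ×ˢ S).filter fun p => SameCell Fs p.1 p.2 ∧ p.1 ≠ p.2 ∧ OnL ℓ p.1 ∧ OnL ℓ p.2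
  have hline : ∀ ℓ ∈ L, (S.filter fun x => OnL ℓ x ∧ eval x Fs.prod ≠ 0).card ≤
      (D + 1) + (Pl ℓ).card := by
    intro ℓ _
    set q := res ℓ Fs.prod with hq
    by_cases hq0 : q = 0
    · have : (S.filter fun x => OnL ℓ x ∧ eval x Fs.prod ≠ 0) = ∅ := by
        refine Finset.filter_eq_empty_iff.2 fun x _ h => h.2 (h.1.eval_eq_zero hq0)
      rw [this, Finset.card_empty]
      exact Nat.zero_le _
    let hmap : (Fin 3 → ℝ) → ℕ := fun x => (q.roots.toFinset.filter fun t => t < x 0).card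
    have hroots : q.roots.toFinset.card ≤ D :=
      (Multiset.toFinset_card_le _).trans ((Polynomial.card_roots' q).trans
        ((natDegree_res_le _ _).trans hFd))
    refine (card_le_add_collisions _ hmap (D + 1) ?_).trans
      (Nat.add_le_add_left (Finset.card_le_card ?_) _)
    · intro x _
      exact Nat.lt_succ_of_le ((Finset.card_filter_le _ _).trans hroots)
    · -- points with the same number of roots before them lie in the same cell
      have key : ∀ x y : Fin 3 → ℝ, OnL ℓ x → OnL ℓ y → eval y Fs.prod ≠ 0 → hmap x = hmap y →
          eval x Fs.prod ≠ 0 → x 0 ≤ y 0 → SameCell Fs x y := by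
        intro x y hx hy hyF hxy hxF hle f hf
        rw [hx.eval_eq, hy.eval_eq]
        refine mul_pos_of_no_zero hle fun t ht h0 => ?_
        have htq : q.eval t = 0 := by
          obtain ⟨g, hg⟩ := List.dvd_prod hf
          rw [hq, hg, map_mul, Polynomial.eval_mul, h0, zero_mul]
        have htlt : t < y 0 := lt_of_le_of_ne ht.2 fun h => hyF (by rw [hy.eval_eq, ← h]; exact htq)
        have hss : (q.roots.toFinset.filter fun t => t < x 0) ⊂
            (q.roots.toFinset.filter fun t => t < y 0) := by
          refine Finset.ssubset_iff_of_subset (fun u hu => ?_) |>.2 ⟨t, ?_, ?_⟩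
          · rw [Finset.mem_filter] at hu ⊢
            exact ⟨hu.1, hu.2.trans_le hle⟩
          · rw [Finset.mem_filter, Multiset.mem_toFinset, Polynomial.mem_roots hq0]
            exact ⟨htq, htlt⟩
          · rw [Finset.mem_filter]
            exact fun h => absurd h.2 (not_lt.2 ht.1)
        exact absurd hxy (Finset.card_lt_card hss).ne
      rintro ⟨x, y⟩ hp
      simp only [Finset.mem_filter, Finset.mem_product, Pl] at hp ⊢
      obtain ⟨⟨⟨hxS, hxl, hxF⟩, hyS, hyl, hyF⟩, hne, hh⟩ := hp
      refine ⟨⟨hxS, hyS⟩, ?_, hne, hxl, hyl⟩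
      rcases le_total (x 0) (y 0) with h | h
      · exact key x y hxl hyl hyF hh hxF h
      · exact (key y x hyl hxl hxF hh.symm hyF h).symm
  have hsum : ∑ ℓ ∈ L, (Pl ℓ).card ≤ cellPairs S Fs := by
    rw [cellPairs, ← Finset.card_biUnion]
    · refine Finset.card_le_card fun p hp => ?_
      obtain ⟨ℓ, _, hp⟩ := Finset.mem_biUnion.1 hp
      rw [Finset.mem_filter] at hp ⊢
      exact ⟨hp.1, hp.2.1⟩
    · intro ℓ _ m _ hne
      rw [Function.onFun, Finset.disjoint_left]
      intro p h1 h2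
      have h1 := (Finset.mem_filter.1 h1).2
      have h2 := (Finset.mem_filter.1 h2).2
      exact hne (eq_of_two_points h1.2.1 h1.2.2.1 h1.2.2.2 h2.2.2.1 h2.2.2.2)
  have htot : ∑ ℓ ∈ L, (S.filter fun x => OnL ℓ x ∧ eval x Fs.prod ≠ 0).card ≤
      L.card * (D + 1) + cellPairs S Fs := by
    refine (Finset.sum_le_sum hline).trans ?_
    rw [Finset.sum_add_distrib, Finset.sum_const, smul_eq_mul]
    exact Nat.add_le_add_left hsum _
  have htot' : ((∑ ℓ ∈ L, (S.filter fun x => OnL ℓ x ∧ eval x Fs.prod ≠ 0).card : ℕ) : ℝ) ≤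
      L.card * (42 * 2 ^ J + 1) + cellPairs S Fs := by exact_mod_cast htot
  have h8 : (0 : ℝ) ≤ 8 ^ J := by positivity
  nlinarith [mul_le_mul_of_nonneg_left htot' h8]

end Partition

/-! ### Lines on irreducible surfaces: the derivation argument -/

section Derivations

open MvPolynomial

variable {K : Type*} [Field K]

lemma totalDegree_pderiv_add_one_le {i : Fin 3} {f : MvPolynomial (Fin 3) K}
    (h : pderiv i f ≠ 0) : (pderiv i f).totalDegree + 1 ≤ f.totalDegree := by
  obtain ⟨m, hm, hdeg⟩ : ∃ m ∈ (pderiv i f).support,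
      (pderiv i f).totalDegree = m.sum fun _ e => e := by
    have hne : (pderiv i f).support.Nonempty := by
      rwa [Finset.nonempty_iff_ne_empty, Ne, support_eq_empty]
    exact Finset.exists_mem_eq_sup _ hne _
  rw [mem_support_iff, coeff_pderiv] at hm
  have h1 : m + Finsupp.single i 1 ∈ f.support := mem_support_iff.2 (left_ne_zero_of_mul hm)
  have h2 := le_totalDegree h1
  rw [Finsupp.sum_add_index' (fun _ => rfl) (fun _ _ _ => rfl),
    Finsupp.sum_single_index rfl] at h2
  omega

lemma totalDegree_pderiv_le (i : Fin 3) (f : MvPolynomial (Fin 3) K) :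
    (pderiv i f).totalDegree ≤ f.totalDegree - 1 := by
  by_cases h : pderiv i f = 0
  · simp [h]
  · have := totalDegree_pderiv_add_one_le h
    omega

lemma eq_zero_of_dvd_of_totalDegree_lt {f g : MvPolynomial (Fin 3) K} (h : f ∣ g)
    (hd : g.totalDegree < f.totalDegree) : g = 0 := by
  by_contra hg
  exact absurd (totalDegree_le_of_dvd_of_isDomain h hg) (not_le.2 hd)

lemma not_dvd_pderiv {i : Fin 3} {f : MvPolynomial (Fin 3) K} (h : pderiv i f ≠ 0) :
    ¬ f ∣ pderiv i f := fun hd =>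
  h (eq_zero_of_dvd_of_totalDegree_lt hd (totalDegree_pderiv_add_one_le h))

lemma eq_C_mul_of_dvd {f g : MvPolynomial (Fin 3) K} (h : f ∣ g)
    (hd : g.totalDegree ≤ f.totalDegree) : ∃ c, g = C c * f := by
  obtain ⟨q, rfl⟩ := h
  by_cases hf : f = 0
  · exact ⟨0, by simp [hf]⟩
  by_cases hq : q = 0
  · exact ⟨0, by simp [hq]⟩
  rw [totalDegree_mul_of_isDomain hf hq] at hd
  have : q.totalDegree = 0 := by omega
  rw [totalDegree_eq_zero_iff_eq_C] at this
  exact ⟨_, by rw [mul_comm, ← this]⟩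

lemma notMem_vars_of_pderiv_eq_zero [CharZero K] {i : Fin 3} {f : MvPolynomial (Fin 3) K}
    (h : pderiv i f = 0) : i ∉ f.vars := by
  classical
  intro hi
  obtain ⟨m, hm, him⟩ := (mem_vars_iff_mem_support i).1 hi
  have h1 : m = (m - Finsupp.single i 1) + Finsupp.single i 1 := by
    ext j
    by_cases hj : j = i
    · subst hj
      have := Finsupp.mem_support_iff.1 him
      simp only [Finsupp.coe_add, Finsupp.coe_tsub, Pi.add_apply, Pi.sub_apply,
        Finsupp.single_eq_same]
      omega
    · simp [Ne.symm hj]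
  have h2 := congrArg (coeff (m - Finsupp.single i 1)) h
  rw [coeff_pderiv, ← h1, coeff_zero] at h2
  rcases mul_eq_zero.1 h2 with h3 | h3
  · exact (mem_support_iff.1 hm) h3
  · exact Nat.cast_add_one_ne_zero _ h3

lemma res_congr_of_notMem_vars {ℓ m : Ln K} {f : MvPolynomial (Fin 3) K}
    (h : ∀ i ∈ f.vars, res ℓ (X i) = res m (X i)) : res ℓ f = res m f := by
  refine hom_congr_vars (f₁ := (res ℓ).toRingHom) (f₂ := (res m).toRingHom) ?_ ?_ rfl
  · ext a
    simp
  · intro i hi _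
    exact h i hi

/-- A polynomial is special if it does not involve one of the last two variables. -/
def Special (f : MvPolynomial (Fin 3) K) : Prop := pderiv 1 f = 0 ∨ pderiv 2 f = 0

/-- An irreducible special polynomial vanishing on a line is a special plane. -/
lemma Special.exists_key [CharZero K] {f : MvPolynomial (Fin 3) K} (hf : Irreducible f)
    (hs : Special f) {ℓ : Ln K} (hℓ : res ℓ f = 0) :
    ∃ κ, f ∣ keyPoly κ ∧ ∀ m, res m f = 0 → HasKey m κ := by
  classical
  have main : ∀ κ (g : K → Ln K), Function.Injective g → (∀ a, HasKey (g a) κ) →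
      (∀ a, res (g a) f = 0) → f ∣ keyPoly κ ∧ ∀ m, res m f = 0 → HasKey m κ := by
    intro κ g hg hk hz
    have hdvd : f ∣ keyPoly κ := by
      by_contra hnd
      obtain ⟨B, hB⟩ := Infinite.exists_subset_card_eq K (f.totalDegree * (keyPoly κ).totalDegree + 1)
      have := bezout_lines hf hnd (B.image g) (by
        intro m hm
        obtain ⟨a, _, rfl⟩ := Finset.mem_image.1 hm
        exact ⟨hz a, (res_keyPoly_eq_zero_iff _ _).2 (hk a)⟩)
      rw [Finset.card_image_of_injective _ hg] at this
      omega
    refine ⟨hdvd, fun m hm => ?_⟩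
    rw [← res_keyPoly_eq_zero_iff]
    obtain ⟨q, hq⟩ := hdvd
    rw [hq, map_mul, hm, zero_mul]
  rcases hs with h | h
  · have hv := notMem_vars_of_pderiv_eq_zero h
    refine ⟨.inr (ℓ.1.2, ℓ.2.2), main _ (fun a => ((a, ℓ.1.2), (0, ℓ.2.2))) ?_ ?_ ?_⟩
    · intro a b hab
      simpa using hab
    · intro a
      rfl
    · intro a
      rw [← hℓ]
      refine res_congr_of_notMem_vars fun i hi => ?_
      fin_cases i
      · simp
      · exact absurd hi hv
      · simp
  · have hv := notMem_vars_of_pderiv_eq_zero h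
    refine ⟨.inl (ℓ.1.1, ℓ.2.1), main _ (fun a => ((ℓ.1.1, a), (ℓ.2.1, 0))) ?_ ?_ ?_⟩
    · intro a b hab
      simpa using hab
    · intro a
      rfl
    · intro a
      rw [← hℓ]
      refine res_congr_of_notMem_vars fun i hi => ?_
      fin_cases i
      · simp
      · simp
      · exact absurd hi hv

/-- The vector field tangent to all lines with first parameter `p`. -/
noncomputable def vf (p : K × K) : Derivation K (MvPolynomial (Fin 3) K) (MvPolynomial (Fin 3) K) :=
  (X 0 : MvPolynomial (Fin 3) K) • pderiv 0 - (C p.1 * X 0 : MvPolynomial (Fin 3) K) • pderiv 1 +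
    (X 2 + C p.2 : MvPolynomial (Fin 3) K) • pderiv 2

lemma vf_apply (p : K × K) (f : MvPolynomial (Fin 3) K) :
    vf p f = X 0 * pderiv 0 f - C p.1 * X 0 * pderiv 1 f + (X 2 + C p.2) * pderiv 2 f := by
  simp [vf]

lemma res_vf (ℓ : Ln K) (f : MvPolynomial (Fin 3) K) :
    res ℓ (vf ℓ.1 f) = Polynomial.X * Polynomial.derivative (res ℓ f) := by
  induction f using MvPolynomial.induction_on with
  | C a => simp
  | add p q hp hq => simp only [map_add, hp, hq, mul_add]
  | mul_X p i hp =>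
    rw [Derivation.leibniz, map_add, smul_eq_mul, smul_eq_mul, map_mul, map_mul, map_mul, hp,
      Polynomial.derivative_mul]
    have : res ℓ (vf ℓ.1 (X i)) = Polynomial.X * Polynomial.derivative (res ℓ (X i)) := by
      fin_cases i
      · simp [vf_apply, pderiv_X]
      · simp [vf_apply, pderiv_X]
      · simp [vf_apply, pderiv_X]
    rw [this]
    ring

lemma totalDegree_vf_le (p : K × K) (f : MvPolynomial (Fin 3) K) :
    (vf p f).totalDegree ≤ f.totalDegree := by
  have key : ∀ (q : MvPolynomial (Fin 3) K) (i : Fin 3), q.totalDegree ≤ 1 →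
      (q * pderiv i f).totalDegree ≤ f.totalDegree := by
    intro q i hq
    by_cases h : pderiv i f = 0
    · simp [h]
    · have := totalDegree_pderiv_add_one_le h
      refine (totalDegree_mul _ _).trans ?_
      omega
  rw [vf_apply]
  refine (totalDegree_add _ _).trans (max_le ((totalDegree_sub _ _).trans (max_le ?_ ?_)) ?_)
  · exact key _ _ (by simp)
  · refine key _ _ ((totalDegree_mul _ _).trans ?_)
    simp
  · refine key _ _ ((totalDegree_add _ _).trans ?_)
    simp

lemma pderiv_comm (i j : Fin 3) (f : MvPolynomial (Fin 3) K) :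
    pderiv i (pderiv j f) = pderiv j (pderiv i f) := by
  let D := fun i => (pderiv i : Derivation K (MvPolynomial (Fin 3) K) (MvPolynomial (Fin 3) K))
  have h : ⁅D i, D j⁆ = 0 := by
    apply derivation_ext
    intro k
    simp only [Derivation.commutator_apply, D, pderiv_X]
    simp only [Derivation.coe_zero, Pi.zero_apply, Pi.single_apply]
    split_ifs <;> simp
  have h' := Derivation.congr_fun h f
  rw [Derivation.commutator_apply] at h'
  exact sub_eq_zero.1 h'

lemma eq_of_vf_eigen [CharZero K] {f : MvPolynomial (Fin 3) K} (hs : ¬ Special f)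
    {p q : K × K} {a b : K} (hp : vf p f = C a * f) (hq : vf q f = C b * f) :
    p = q := by
  rw [Special, not_or] at hs
  have h1 : vf p (vf q f) - vf q (vf p f) = 0 := by
    rw [hp, hq, ← smul_eq_C_mul, ← smul_eq_C_mul, Derivation.map_smul, Derivation.map_smul, hp, hq]
    simp only [smul_eq_C_mul]
    ring
  have hcomm := fun i j => pderiv_comm i j f
  have h2 : C (p.1 - q.1) * X 0 * pderiv 1 f + C (p.2 - q.2) * pderiv 2 f = 0 := by
    rw [← h1]
    simp only [vf_apply, map_add, map_sub, Derivation.leibniz, smul_eq_mul, pderiv_X, pderiv_C,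
      hcomm 1 0, hcomm 2 0, hcomm 2 1]
    simp
    ring
  have h3 : -(C (p.1 - q.1) * X 0 * pderiv 1 f) + C (p.2 - q.2) * pderiv 2 f = C (a - b) * f := by
    have hp' := hp
    have hq' := hq
    rw [vf_apply] at hp' hq'
    simp only [C_sub]
    linear_combination hp' - hq'
  have h4 : C (2 * (p.2 - q.2)) * pderiv 2 f = C (a - b) * f := by
    rw [C_mul, show (C (2 : K) : MvPolynomial (Fin 3) K) = 2 from map_ofNat C 2]
    linear_combination h2 + h3
  have hv : p.2 - q.2 = 0 := by
    by_contra hv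
    apply not_dvd_pderiv hs.2
    refine ⟨C ((2 * (p.2 - q.2))⁻¹ * (a - b)), ?_⟩
    rw [C_mul, mul_left_comm, mul_comm f, ← h4, ← mul_assoc, ← C_mul, inv_mul_cancel₀, C_1, one_mul]
    exact mul_ne_zero two_ne_zero hv
  rw [hv, C_0, zero_mul, add_zero] at h2
  have hu : p.1 - q.1 = 0 := by
    by_contra hu
    rcases mul_eq_zero.1 h2 with h5 | h5
    · rcases mul_eq_zero.1 h5 with h6 | h6
      · exact hu (C_eq_zero.1 h6)
      · exact X_ne_zero _ h6
    · exact hs.1 h5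
  exact Prod.ext (sub_eq_zero.1 hu) (sub_eq_zero.1 hv)

/-- A nonspecial irreducible surface of degree `d` contains at most `(d² + 1) N` lines of a
family with `N` points. -/
theorem card_lines_le [CharZero K] [DecidableEq K] {f : MvPolynomial (Fin 3) K} (hf : Irreducible f)
    (hs : ¬ Special f) (P : Finset (K × K)) (B : Finset (Ln K)) (hBP : B ⊆ P ×ˢ P)
    (hB : ∀ ℓ ∈ B, res ℓ f = 0) : B.card ≤ (f.totalDegree ^ 2 + 1) * P.card := by
  classical
  set d := f.totalDegree
  let fib : K × K → Finset (Ln K) := fun p => B.filter fun ℓ => ℓ.1 = p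
  have hcard : B.card = ∑ p ∈ P, (fib p).card :=
    Finset.card_eq_sum_card_fiberwise fun ℓ hℓ => (Finset.mem_product.1 (hBP hℓ)).1
  have hfibP : ∀ p, (fib p).card ≤ P.card := by
    intro p
    refine Finset.card_le_card_of_injOn (fun ℓ => ℓ.2) ?_ ?_
    · intro ℓ hℓ
      exact (Finset.mem_product.1 (hBP (Finset.mem_filter.1 hℓ).1)).2
    · intro ℓ hℓ m hm h
      exact Prod.ext ((Finset.mem_filter.1 hℓ).2.trans (Finset.mem_filter.1 hm).2.symm) h
  have heig : ∀ p, d ^ 2 < (fib p).card → ∃ a, vf p f = C a * f := by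
    intro p hp
    refine eq_C_mul_of_dvd ?_ (totalDegree_vf_le p f)
    by_contra hnd
    have h1 := bezout_lines hf hnd (fib p) (by
      intro ℓ hℓ
      obtain ⟨h1, rfl⟩ := Finset.mem_filter.1 hℓ
      refine ⟨hB ℓ h1, ?_⟩
      rw [res_vf, hB ℓ h1]
      simp)
    have h2 := Nat.mul_le_mul_left d (totalDegree_vf_le p f)
    have : d * d = d ^ 2 := (sq d).symm
    have h3 : d * f.totalDegree = d * d := rfl
    have h4 : f.totalDegree * (vf p f).totalDegree = d * (vf p f).totalDegree := rfl
    omega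
  by_cases hbad : ∃ p ∈ P, d ^ 2 < (fib p).card
  · obtain ⟨p, hpP, hp⟩ := hbad
    obtain ⟨a, ha⟩ := heig p hp
    rw [hcard, ← Finset.add_sum_erase _ _ hpP]
    have h1 : ∑ q ∈ P.erase p, (fib q).card ≤ ∑ q ∈ P.erase p, d ^ 2 := by
      refine Finset.sum_le_sum fun q hq => ?_
      by_contra! hcon
      obtain ⟨b, hb⟩ := heig q hcon
      exact (Finset.ne_of_mem_erase hq) (eq_of_vf_eigen hs hb ha)
    rw [Finset.sum_const, smul_eq_mul] at h1
    have h2 := hfibP p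
    have h3 := Nat.mul_le_mul_right (d ^ 2) (Finset.card_erase_le (s := P) (a := p))
    nlinarith
  · push Not at hbad
    rw [hcard]
    refine (Finset.sum_le_card_nsmul _ _ _ hbad).trans ?_
    rw [smul_eq_mul]
    nlinarith

end Derivations

/-! ### Functions of two variables whose cubic form is divisible by the second fundamental form -/

section Monge

open MvPolynomial

variable {k K : Type*} [Field k] [Field K] [Algebra k K] {D₁ D₂ : Derivation k K K} {x y : K}

/-- The data of two commuting derivations dual to `x` and `y` with constant field `k`. -/
structure Frame (D₁ D₂ : Derivation k K K) (x y : K) : Prop where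
  comm : ∀ u, D₁ (D₂ u) = D₂ (D₁ u)
  const : ∀ u, D₁ u = 0 → D₂ u = 0 → ∃ a : k, algebraMap k K a = u
  xx : D₁ x = 1
  xy : D₂ x = 0
  yx : D₁ y = 0
  yy : D₂ y = 1

lemma Frame.swap (h : Frame D₁ D₂ x y) : Frame D₂ D₁ y x :=
  ⟨fun u => (h.comm u).symm, fun u h1 h2 => h.const u h2 h1, h.yy, h.yx, h.xy, h.xx⟩

lemma Frame.affine (h : Frame D₁ D₂ x y) {u : K} {a b : k} (h1 : D₁ u = algebraMap k K a)
    (h2 : D₂ u = algebraMap k K b) :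
    ∃ c : k, u = algebraMap k K c + algebraMap k K a * x + algebraMap k K b * y := by
  obtain ⟨c, hc⟩ := h.const (u - algebraMap k K a * x - algebraMap k K b * y)
    (by simp [h.xx, h.yx, h1]) (by simp [h.xy, h.yy, h2])
  exact ⟨c, by rw [hc]; ring⟩

lemma Frame.quadratic [CharZero k] (h : Frame D₁ D₂ x y) {u : K} {a b c : k}
    (h11 : D₁ (D₁ u) = algebraMap k K a) (h12 : D₁ (D₂ u) = algebraMap k K b)
    (h22 : D₂ (D₂ u) = algebraMap k K c) (z : K) :
    ∃ q : MvPolynomial (Fin 3) k, q.totalDegree ≤ 2 ∧ pderiv 2 q = 0 ∧ aeval ![x, y, z] q = u := by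
  obtain ⟨e, he⟩ := h.affine h11 (by rw [← h.comm]; exact h12)
  obtain ⟨g, hg⟩ := h.affine h12 h22
  have h2 : algebraMap k K (2 : k) ≠ 0 := by
    rw [Ne, map_eq_zero]
    exact two_ne_zero
  have hh : algebraMap k K (1 / 2) * 2 = 1 := by
    rw [← map_ofNat (algebraMap k K) 2, ← map_mul]
    simp
  obtain ⟨m, hm⟩ := h.affine (a := e) (b := g)
    (u := u - algebraMap k K (1 / 2) * algebraMap k K a * x ^ 2 - algebraMap k K b * x * y -
      algebraMap k K (1 / 2) * algebraMap k K c * y ^ 2)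
    (by
      simp only [map_sub, Derivation.leibniz, Derivation.leibniz_pow, smul_eq_mul, h.xx, h.yx,
        Derivation.map_algebraMap, he]
      simp only [nsmul_eq_mul, Nat.cast_ofNat]
      linear_combination (-algebraMap k K a * x) * hh)
    (by
      simp only [map_sub, Derivation.leibniz, Derivation.leibniz_pow, smul_eq_mul, h.xy, h.yy,
        Derivation.map_algebraMap, hg]
      simp only [nsmul_eq_mul, Nat.cast_ofNat]
      linear_combination (-algebraMap k K c * y) * hh)
  have deg2 : ∀ (a : k) (i j : Fin 3), (C a * X i * X j : MvPolynomial (Fin 3) k).totalDegree ≤ 2 := by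
    intro a i j
    refine (totalDegree_mul _ _).trans ?_
    have := totalDegree_mul (C a) (X i : MvPolynomial (Fin 3) k)
    rw [totalDegree_C, totalDegree_X] at this
    rw [totalDegree_X]
    omega
  have deg1 : ∀ (a : k) (i : Fin 3), (C a * X i : MvPolynomial (Fin 3) k).totalDegree ≤ 2 := by
    intro a i
    have := totalDegree_mul (C a) (X i : MvPolynomial (Fin 3) k)
    rw [totalDegree_C, totalDegree_X] at this
    omega
  refine ⟨C (1 / 2 * a) * X 0 * X 0 + C b * X 0 * X 1 + C (1 / 2 * c) * X 1 * X 1 + C e * X 0 +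
    C g * X 1 + C m, ?_, ?_, ?_⟩
  · refine (totalDegree_add _ _).trans (max_le ?_ (by simp))
    refine (totalDegree_add _ _).trans (max_le ?_ (deg1 _ _))
    refine (totalDegree_add _ _).trans (max_le ?_ (deg1 _ _))
    refine (totalDegree_add _ _).trans (max_le ?_ (deg2 _ _ _))
    exact (totalDegree_add _ _).trans (max_le (deg2 _ _ _) (deg2 _ _ _))
  · simp
  · simp only [map_add, map_mul, aeval_C, aeval_X, Matrix.cons_val]
    linear_combination -hm

lemma deriv_two (D : Derivation k K K) : D 2 = 0 := by
  rw [← Nat.cast_ofNat]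
  exact D.map_natCast 2

lemma deriv_three (D : Derivation k K K) : D 3 = 0 := by
  rw [← Nat.cast_ofNat]
  exact D.map_natCast 3

/-- The condition that the third derivatives of `u` are the symmetrised product of a linear form
with the second derivatives. -/
structure Cubic (D₁ D₂ : Derivation k K K) (u α β : K) : Prop where
  c111 : D₁ (D₁ (D₁ u)) = 3 * α * D₁ (D₁ u)
  c112 : D₂ (D₁ (D₁ u)) = 2 * α * D₁ (D₂ u) + β * D₁ (D₁ u)
  c122 : D₁ (D₂ (D₂ u)) = 2 * β * D₁ (D₂ u) + α * D₂ (D₂ u)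
  c222 : D₂ (D₂ (D₂ u)) = 3 * β * D₂ (D₂ u)

lemma Frame.quadric_of_const [CharZero k] (h : Frame D₁ D₂ x y) {u : K}
    (h11 : D₁ (D₁ (D₁ u)) = 0) (h12 : D₂ (D₁ (D₁ u)) = 0) (h21 : D₁ (D₂ (D₂ u)) = 0)
    (h22 : D₂ (D₂ (D₂ u)) = 0) :
    ∃ Q : MvPolynomial (Fin 3) k, Q ≠ 0 ∧ Q.totalDegree ≤ 2 ∧ aeval ![x, y, u] Q = 0 := by
  obtain ⟨a, ha⟩ := h.const _ h11 h12
  obtain ⟨b, hb⟩ := h.const (D₁ (D₂ u)) (by rw [h.comm, h.comm, h12]) (by rw [← h.comm, h21])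
  obtain ⟨c, hc⟩ := h.const _ h21 h22
  obtain ⟨q, hq, hq2, hqu⟩ := h.quadratic ha.symm hb.symm hc.symm u
  refine ⟨X 2 - q, ?_, ?_, ?_⟩
  · intro h0
    have := congrArg (pderiv 2) h0
    simp [hq2] at this
  · exact (totalDegree_sub _ _).trans (max_le (by simp) hq)
  · rw [map_sub, hqu]
    simp

lemma Frame.quadric_of_alpha [CharZero k] (h : Frame D₁ D₂ x y) {u α β : K} (hc : Cubic D₁ D₂ u α β)
    (h11 : D₁ α = α ^ 2) (h12 : D₂ α = α * β) (h21 : D₁ β = α * β) (h22 : D₂ β = β ^ 2)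
    (hα : α ≠ 0) :
    ∃ Q : MvPolynomial (Fin 3) k, Q ≠ 0 ∧ Q.totalDegree ≤ 2 ∧ aeval ![x, y, u] Q = 0 := by
  obtain ⟨c, hcc⟩ := h.const (-β * α⁻¹)
    (by simp [h11, h21, Derivation.leibniz, Derivation.leibniz_inv]; field_simp; ring)
    (by simp [h12, h22, Derivation.leibniz, Derivation.leibniz_inv]; field_simp; ring)
  have e1 : D₁ α⁻¹ = -1 := by
    rw [Derivation.leibniz_inv, h11, smul_eq_mul]
    field_simp
  have e2 : D₂ α⁻¹ = algebraMap k K c := by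
    rw [Derivation.leibniz_inv, h12, smul_eq_mul, hcc]
    field_simp
  obtain ⟨c0, hc0⟩ := h.affine (u := α⁻¹) (a := -1) (b := c) (by rw [e1]; simp) e2
  have f1 : D₁ (α⁻¹ * u) = α⁻¹ * D₁ u - u := by
    rw [Derivation.leibniz, e1, smul_eq_mul, smul_eq_mul]
    ring
  have f2 : D₂ (α⁻¹ * u) = α⁻¹ * D₂ u + algebraMap k K c * u := by
    rw [Derivation.leibniz, e2, smul_eq_mul, smul_eq_mul]
    ring
  have f11 : D₁ (D₁ (α⁻¹ * u)) = α⁻¹ * D₁ (D₁ u) - 2 * D₁ u := by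
    rw [f1, map_sub, Derivation.leibniz, e1, smul_eq_mul, smul_eq_mul]
    ring
  have f12 : D₁ (D₂ (α⁻¹ * u)) = α⁻¹ * D₁ (D₂ u) - D₂ u + algebraMap k K c * D₁ u := by
    rw [f2, map_add, Derivation.leibniz, Derivation.leibniz, e1, Derivation.map_algebraMap]
    simp only [smul_eq_mul]
    ring
  have f22 : D₂ (D₂ (α⁻¹ * u)) = α⁻¹ * D₂ (D₂ u) + 2 * algebraMap k K c * D₂ u := by
    rw [f2, map_add, Derivation.leibniz, Derivation.leibniz, e2, Derivation.map_algebraMap]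
    simp only [smul_eq_mul]
    ring
  have hcm : algebraMap k K c * α = -β := by
    rw [hcc]; field_simp
  have hi : α⁻¹ * α = 1 := inv_mul_cancel₀ hα
  have hcb : α⁻¹ * β = -algebraMap k K c := by
    rw [hcc]; ring
  obtain ⟨a11, h11'⟩ := h.const (D₁ (D₁ (α⁻¹ * u)))
    (by
      rw [f11]
      simp only [map_sub, Derivation.leibniz, e1, hc.c111, smul_eq_mul, deriv_two]
      linear_combination 3 * D₁ (D₁ u) * hi)
    (by
      rw [f11]
      simp only [map_sub, Derivation.leibniz, e2, hc.c112, smul_eq_mul, deriv_two,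
        ← h.comm u]
      linear_combination 2 * D₁ (D₂ u) * hi + D₁ (D₁ u) * hcb)
  obtain ⟨a12, h12'⟩ := h.const (D₁ (D₂ (α⁻¹ * u)))
    (by
      rw [f12]
      simp only [map_sub, map_add, Derivation.leibniz, e1, smul_eq_mul,
        Derivation.map_algebraMap, h.comm u]
      rw [h.comm (D₁ u), hc.c112, h.comm u]
      linear_combination 2 * D₂ (D₁ u) * hi + D₁ (D₁ u) * hcb)
    (by
      rw [f12]
      simp only [map_sub, map_add, Derivation.leibniz, e2, smul_eq_mul,
        Derivation.map_algebraMap, ← h.comm u]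
      rw [← h.comm (D₂ u), hc.c122]
      linear_combination D₂ (D₂ u) * hi + 2 * D₁ (D₂ u) * hcb)
  obtain ⟨a22, h22'⟩ := h.const (D₂ (D₂ (α⁻¹ * u)))
    (by
      rw [f22]
      simp only [map_add, Derivation.leibniz, e1, hc.c122, smul_eq_mul, deriv_two,
        Derivation.map_algebraMap]
      linear_combination D₂ (D₂ u) * hi + 2 * D₁ (D₂ u) * hcb)
    (by
      rw [f22]
      simp only [map_add, Derivation.leibniz, e2, hc.c222, smul_eq_mul, deriv_two,
        Derivation.map_algebraMap]
      linear_combination 3 * D₂ (D₂ u) * hcb)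
  obtain ⟨q, hq, hq2, hqu⟩ := h.quadratic h11'.symm h12'.symm h22'.symm u
  refine ⟨(C c0 - X 0 + C c * X 1) * X 2 - q, ?_, ?_, ?_⟩
  · intro h0
    have := congrArg (fun p => pderiv 0 (pderiv 2 p)) h0
    simp [hq2] at this
  · refine (totalDegree_sub _ _).trans (max_le ?_ hq)
    refine (totalDegree_mul _ _).trans ?_
    have h1 : (C c * X 1 : MvPolynomial (Fin 3) k).totalDegree ≤ 1 :=
      (totalDegree_mul _ _).trans (by simp)
    have h2 : (C c0 - X 0 + C c * X 1 : MvPolynomial (Fin 3) k).totalDegree ≤ 1 :=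
      (totalDegree_add _ _).trans (max_le ((totalDegree_sub _ _).trans (by simp)) h1)
    rw [totalDegree_X]
    omega
  · rw [map_sub, hqu]
    simp only [map_sub, map_add, map_mul, aeval_C, aeval_X, Matrix.cons_val]
    rw [hc0, map_neg, map_one]
    ring

lemma Frame.quadric_of_mu [CharZero k] (h : Frame D₁ D₂ x y) {u α β μ : K}
    (hc : Cubic D₁ D₂ u α β) (h11 : D₁ α = α ^ 2 + μ * D₁ (D₁ u))
    (h22 : D₂ β = β ^ 2 + μ * D₂ (D₂ u))
    (h21 : D₁ β = α * β + μ * D₁ (D₂ u)) (hμ1 : D₁ μ = μ * α) (hμ2 : D₂ μ = μ * β) (hμ : μ ≠ 0) :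
    ∃ Q : MvPolynomial (Fin 3) k, Q ≠ 0 ∧ Q.totalDegree ≤ 2 ∧ aeval ![x, y, u] Q = 0 := by
  obtain ⟨ψ, hψ⟩ : ∃ ψ : K, ψ = μ⁻¹ := ⟨_, rfl⟩
  have hψμ : ψ * μ = 1 := by rw [hψ, inv_mul_cancel₀ hμ]
  have e1 : D₁ ψ = -(α * ψ) := by
    rw [hψ, Derivation.leibniz_inv, hμ1, smul_eq_mul]
    field_simp
  have e2 : D₂ ψ = -(β * ψ) := by
    rw [hψ, Derivation.leibniz_inv, hμ2, smul_eq_mul]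
    field_simp
  have e11 : D₁ (D₁ ψ) = -D₁ (D₁ u) := by
    rw [e1, map_neg, Derivation.leibniz, h11, e1, smul_eq_mul, smul_eq_mul]
    linear_combination -D₁ (D₁ u) * hψμ
  have e12 : D₁ (D₂ ψ) = -D₁ (D₂ u) := by
    rw [e2, map_neg, Derivation.leibniz, h21, e1, smul_eq_mul, smul_eq_mul]
    linear_combination -D₁ (D₂ u) * hψμ
  have e22 : D₂ (D₂ ψ) = -D₂ (D₂ u) := by
    rw [e2, map_neg, Derivation.leibniz, h22, e2, smul_eq_mul, smul_eq_mul]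
    linear_combination -D₂ (D₂ u) * hψμ
  have hcm : D₂ (D₁ u) = D₁ (D₂ u) := (h.comm u).symm
  have hcψ : D₂ (D₁ ψ) = D₁ (D₂ ψ) := (h.comm ψ).symm
  have c112 : D₁ (D₁ (D₂ u)) = 2 * α * D₁ (D₂ u) + β * D₁ (D₁ u) := by
    rw [h.comm u, h.comm, hc.c112, hcm]
  have c122 : D₂ (D₁ (D₂ u)) = 2 * β * D₁ (D₂ u) + α * D₂ (D₂ u) := by
    rw [← h.comm, hc.c122]
  obtain ⟨b1, hb1⟩ := h.const (D₁ (ψ + u)) (by rw [map_add, map_add, e11]; ring)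
    (by rw [map_add, map_add, hcψ, e12, hcm]; ring)
  obtain ⟨b2, hb2⟩ := h.const (D₂ (ψ + u)) (by rw [map_add, map_add, e12]; ring)
    (by rw [map_add, map_add, e22]; ring)
  obtain ⟨b0, hb0⟩ := h.affine hb1.symm hb2.symm
  have g11 : D₁ (D₁ (ψ ^ 2)) = 2 * (D₁ ψ * D₁ ψ - ψ * D₁ (D₁ u)) := by
    simp only [pow_two, Derivation.leibniz, smul_eq_mul, map_add, e11]
    ring
  have g12 : D₁ (D₂ (ψ ^ 2)) = 2 * (D₁ ψ * D₂ ψ - ψ * D₁ (D₂ u)) := by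
    simp only [pow_two, Derivation.leibniz, smul_eq_mul, map_add, e12]
    ring
  have g22 : D₂ (D₂ (ψ ^ 2)) = 2 * (D₂ ψ * D₂ ψ - ψ * D₂ (D₂ u)) := by
    simp only [pow_two, Derivation.leibniz, smul_eq_mul, map_add, e22]
    ring
  obtain ⟨a11, h11'⟩ := h.const (D₁ (D₁ (ψ ^ 2)))
    (by
      rw [g11]
      simp only [map_sub, Derivation.leibniz, e11, hc.c111, smul_eq_mul, deriv_two]
      rw [e1]
      ring)
    (by
      rw [g11]
      simp only [map_sub, Derivation.leibniz, hcψ, e12, hc.c112, smul_eq_mul, deriv_two]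
      rw [e1, e2]
      ring)
  obtain ⟨a12, h12'⟩ := h.const (D₁ (D₂ (ψ ^ 2)))
    (by
      rw [g12]
      simp only [map_sub, Derivation.leibniz, e11, e12, c112, smul_eq_mul, deriv_two]
      rw [e1, e2]
      ring)
    (by
      rw [g12]
      simp only [map_sub, Derivation.leibniz, hcψ, e12, e22, c122, smul_eq_mul, deriv_two]
      rw [e1, e2]
      ring)
  obtain ⟨a22, h22'⟩ := h.const (D₂ (D₂ (ψ ^ 2)))
    (by
      rw [g22]
      simp only [map_sub, Derivation.leibniz, e12, hc.c122, smul_eq_mul, deriv_two]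
      rw [e1, e2]
      ring)
    (by
      rw [g22]
      simp only [map_sub, Derivation.leibniz, e22, hc.c222, smul_eq_mul, deriv_two]
      rw [e2]
      ring)
  obtain ⟨q, hq, hq2, hqu⟩ := h.quadratic h11'.symm h12'.symm h22'.symm u
  refine ⟨(C b0 + C b1 * X 0 + C b2 * X 1 - X 2) ^ 2 - q, ?_, ?_, ?_⟩
  · intro h0
    have := congrArg (fun p => pderiv 2 (pderiv 2 p)) h0
    simp [hq2, pow_two] at this
  · refine (totalDegree_sub _ _).trans (max_le ?_ hq)
    refine (totalDegree_pow _ _).trans ?_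
    have h1 : ∀ (b : k) (i : Fin 3), (C b * X i : MvPolynomial (Fin 3) k).totalDegree ≤ 1 :=
      fun b i => (totalDegree_mul _ _).trans (by simp)
    have h2 : (C b0 + C b1 * X 0 + C b2 * X 1 - X 2 : MvPolynomial (Fin 3) k).totalDegree ≤ 1 := by
      refine (totalDegree_sub _ _).trans (max_le ?_ (by simp))
      refine (totalDegree_add _ _).trans (max_le ?_ (h1 _ _))
      exact (totalDegree_add _ _).trans (max_le (by simp) (h1 _ _))
    omega
  · rw [map_sub, hqu]
    simp only [map_sub, map_add, map_mul, map_pow, aeval_C, aeval_X, Matrix.cons_val]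
    rw [← hb0]
    ring

lemma aeval_swap
 (x y z : K) (Q : MvPolynomial (Fin 3) k) :
    aeval ![x, y, z] (rename (Equiv.swap (0 : Fin 3) 1) Q) = aeval ![y, x, z] Q := by
  rw [aeval_rename]
  congr 2
  funext i
  fin_cases i <;> rfl

/-- If the Hessian of `u` is nondegenerate and divides the third derivatives, then `u` satisfies a
quadratic equation. -/
theorem Frame.quadric_of_cubic [CharZero k] (h : Frame D₁ D₂ x y) {u α β : K}
    (hc : Cubic D₁ D₂ u α β)
    (hdet : D₁ (D₁ u) * D₂ (D₂ u) - D₁ (D₂ u) ^ 2 ≠ 0) :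
    ∃ Q : MvPolynomial (Fin 3) k, Q ≠ 0 ∧ Q.totalDegree ≤ 2 ∧ aeval ![x, y, u] Q = 0 := by
  have : CharZero K := charZero_of_injective_algebraMap (algebraMap k K).injective
  have hcm : D₂ (D₁ u) = D₁ (D₂ u) := (h.comm u).symm
  have c112 : D₁ (D₁ (D₂ u)) = 2 * α * D₁ (D₂ u) + β * D₁ (D₁ u) := by
    rw [h.comm u, h.comm, hc.c112, hcm]
  have c122 : D₂ (D₁ (D₂ u)) = 2 * β * D₁ (D₂ u) + α * D₂ (D₂ u) := by
    rw [← h.comm, hc.c122]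
  have c111 := hc.c111
  have c222 := hc.c222
  have c112' := hc.c112
  have c122' := hc.c122
  have i1 := h.comm (D₁ (D₁ u))
  have i2 := h.comm (D₂ (D₂ u))
  have i3 := h.comm (D₁ (D₂ u))
  rw [c111, c112'] at i1
  rw [c222, c122'] at i2
  rw [c112, c122] at i3
  simp only [map_add, Derivation.leibniz, smul_eq_mul, deriv_two, deriv_three] at i1 i2 i3
  rw [c111, c112', c112] at i1
  rw [c222, c122', c122] at i2
  rw [c112', c122', c112, c122] at i3
  generalize hr : D₁ (D₁ u) = r at *
  generalize hs : D₁ (D₂ u) = s at *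
  generalize ht : D₂ (D₂ u) = t at *
  obtain ⟨b11, hb11⟩ : ∃ b, b = D₁ α - α ^ 2 := ⟨_, rfl⟩
  obtain ⟨b12, hb12⟩ : ∃ b, b = D₂ α - α * β := ⟨_, rfl⟩
  obtain ⟨b21, hb21⟩ : ∃ b, b = D₁ β - α * β := ⟨_, rfl⟩
  obtain ⟨b22, hb22⟩ : ∃ b, b = D₂ β - β ^ 2 := ⟨_, rfl⟩
  have a11 : D₁ α = b11 + α ^ 2 := by rw [hb11]; ring
  have a12 : D₂ α = b12 + α * β := by rw [hb12]; ring
  have a21 : D₁ β = b21 + α * β := by rw [hb21]; ring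
  have a22 : D₂ β = b22 + β ^ 2 := by rw [hb22]; ring
  rw [a11, a12, a21] at i1
  rw [a22, a12, a21] at i2
  rw [a11, a12, a21, a22] at i3
  have j1 : (3 * b12 - b21) * r = 2 * s * b11 := by linear_combination -i1
  have j2 : (3 * b21 - b12) * t = 2 * s * b22 := by linear_combination i2
  have j3 : 2 * (b12 - b21) * s + b22 * r - b11 * t = 0 := by linear_combination -i3
  have hω : b12 = b21 := by
    have : (b12 - b21) * (r * t - s ^ 2) = 0 := by
      have h2 : (2 : K) ≠ 0 := two_ne_zero
      apply mul_left_cancel₀ h2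
      linear_combination (-s) * j3 + (t / 2) * j1 - (r / 2) * j2
    rcases mul_eq_zero.1 this with h0 | h0
    · exact sub_eq_zero.1 h0
    · exact absurd h0 hdet
  subst hω
  obtain ⟨μ, hμ⟩ : ∃ μ, μ = (b11 * t + b22 * r - 2 * b12 * s) / (2 * (r * t - s ^ 2)) := ⟨_, rfl⟩
  have hΔ : 2 * (r * t - s ^ 2) ≠ 0 := mul_ne_zero two_ne_zero hdet
  have hμΔ : μ * (2 * (r * t - s ^ 2)) = b11 * t + b22 * r - 2 * b12 * s := by
    rw [hμ, div_mul_cancel₀ _ hΔ]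
  have k11 : b11 = μ * r := by
    apply mul_right_cancel₀ hΔ
    linear_combination (-r) * hμΔ + s * j1 - r * j3
  have k12 : b12 = μ * s := by
    apply mul_right_cancel₀ hΔ
    linear_combination (-s) * hμΔ + (t / 2) * j1 + (r / 2) * j2
  have k22 : b22 = μ * t := by
    apply mul_right_cancel₀ hΔ
    linear_combination (-t) * hμΔ + s * j2 + t * j3
  rw [k11] at a11
  rw [k12] at a12 a21
  rw [k22] at a22
  have l1 := h.comm α
  have l2 := h.comm β
  rw [a11, a12] at l1
  rw [a21, a22] at l2
  simp only [map_add, Derivation.leibniz, Derivation.leibniz_pow, smul_eq_mul, nsmul_eq_mul,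
    Nat.cast_ofNat] at l1 l2
  rw [c112', c112, a11, a12, a21] at l1
  rw [c122', c122, a22, a12, a21] at l2
  have m1 : s * (D₁ μ - μ * α) = r * (D₂ μ - μ * β) := by linear_combination l1
  have m2 : t * (D₁ μ - μ * α) = s * (D₂ μ - μ * β) := by linear_combination l2
  have hμ1 : D₁ μ = μ * α := by
    have : (D₁ μ - μ * α) * (r * t - s ^ 2) = 0 := by linear_combination r * m2 - s * m1
    rcases mul_eq_zero.1 this with h0 | h0
    · exact sub_eq_zero.1 h0
    · exact absurd h0 hdet
  have hμ2 : D₂ μ = μ * β := by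
    have : (D₂ μ - μ * β) * (r * t - s ^ 2) = 0 := by linear_combination s * m2 - t * m1
    rcases mul_eq_zero.1 this with h0 | h0
    · exact sub_eq_zero.1 h0
    · exact absurd h0 hdet
  by_cases hμ0 : μ = 0
  · subst hμ0
    simp only [zero_mul, zero_add] at a11 a12 a21 a22
    by_cases hα : α = 0
    · by_cases hβ : β = 0
      · subst hα hβ
        exact h.quadric_of_const (by rw [hr, c111]; ring) (by rw [hr, c112']; ring)
          (by rw [ht, c122']; ring) (by rw [ht, c222]; ring)
      · obtain ⟨Q, hQ0, hQ, hQe⟩ := h.swap.quadric_of_alpha (u := u) (α := β) (β := α)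
          ⟨hc.c222, by rw [hcm, ht, c122'], by rw [hcm, hr, c112'], hc.c111⟩
          a22 (by rw [a21, mul_comm]) (by rw [a12, mul_comm]) a11 hβ
        refine ⟨rename (Equiv.swap (0 : Fin 3) 1) Q, ?_, ?_, ?_⟩
        · rwa [Ne, map_eq_zero_iff _ (rename_injective _ (Equiv.injective _))]
        · exact (totalDegree_rename_le _ _).trans hQ
        · rwa [aeval_swap]
    · exact h.quadric_of_alpha hc a11 a12 a21 a22 hα
  · subst hr hs ht
    exact h.quadric_of_mu hc (by rw [a11]; ring) (by rw [a22]; ring)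
      (by rw [a21]; ring) hμ1 hμ2 hμ0

end Monge

/-! ### The function field of a surface -/

section FunctionField

open MvPolynomial

universe u v

variable {k : Type u} {K : Type v} [Field k] [Field K] [Algebra k K]

/-- `K` is the function field of the surface defined by `f`. -/
structure IsFunctionField (f : MvPolynomial (Fin 3) k) (ev : MvPolynomial (Fin 3) k →ₐ[k] K) :
    Prop where
  zero_iff : ∀ g, ev g = 0 ↔ f ∣ g
  frac : ∀ u, ∃ a b, ev b ≠ 0 ∧ u * ev b = ev a
  lift : ∀ c : Fin 3 → K, ∑ j, c j * ev (pderiv j f) = 0 →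
    ∃ D : Derivation k K K, ∀ g, D (ev g) = ∑ j, c j * ev (pderiv j g)

lemma exists_dual_hom (ev : MvPolynomial (Fin 3) k →ₐ[k] K) (c : Fin 3 → K) :
    ∃ Φ : MvPolynomial (Fin 3) k →ₐ[k] TrivSqZeroExt K K,
      ∀ g, (Φ g).fst = ev g ∧ (Φ g).snd = ∑ j, c j * ev (pderiv j g) := by
  let Φ : MvPolynomial (Fin 3) k →ₐ[k] TrivSqZeroExt K K :=
    aeval fun j => TrivSqZeroExt.inl (ev (X j)) + TrivSqZeroExt.inr (c j)
  refine ⟨Φ, ?_⟩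
  intro g
  induction g using MvPolynomial.induction_on with
  | C a =>
    have : Φ (C a) = algebraMap k _ a := aeval_C _ _
    rw [this]
    constructor
    · rw [show (C a : MvPolynomial (Fin 3) k) = algebraMap k _ a from rfl, AlgHom.commutes]
      rfl
    · simp only [pderiv_C, map_zero, mul_zero, Finset.sum_const_zero]
      rfl
  | add p q hp hq =>
    constructor
    · rw [map_add, TrivSqZeroExt.fst_add, hp.1, hq.1, map_add]
    · rw [map_add, TrivSqZeroExt.snd_add, hp.2, hq.2, ← Finset.sum_add_distrib]
      refine Finset.sum_congr rfl fun j _ => ?_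
      rw [map_add, map_add, mul_add]
  | mul_X p i hp =>
    have : Φ (X i) = TrivSqZeroExt.inl (ev (X i)) + TrivSqZeroExt.inr (c i) := aeval_X _ _
    constructor
    · rw [map_mul, TrivSqZeroExt.fst_mul, hp.1, map_mul, this]
      simp
    · rw [map_mul, TrivSqZeroExt.snd_mul, hp.1, hp.2, this]
      have hi : c i = ∑ j, c j * ev (pderiv j (X i)) := by
        rw [Finset.sum_eq_single i]
        · simp
        · intro j _ hj
          rw [pderiv_X_of_ne (Ne.symm hj)]
          simp
        · simp
      simp only [TrivSqZeroExt.snd_add, TrivSqZeroExt.snd_inl, TrivSqZeroExt.snd_inr, zero_add,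
        TrivSqZeroExt.fst_add, TrivSqZeroExt.fst_inl, TrivSqZeroExt.fst_inr, add_zero,
        smul_eq_mul, MulOpposite.smul_eq_mul_unop, MulOpposite.unop_op]
      rw [hi, Finset.mul_sum, Finset.sum_mul, ← Finset.sum_add_distrib]
      refine Finset.sum_congr rfl fun j _ => ?_
      rw [Derivation.leibniz, map_add, smul_eq_mul, smul_eq_mul, map_mul, map_mul]
      ring

lemma derivation_of_dual (Θ : K →+* TrivSqZeroExt K K) (hfst : ∀ u, (Θ u).fst = u)
    (hk : ∀ a : k, Θ (algebraMap k K a) = algebraMap k _ a) :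
    ∃ D : Derivation k K K, ∀ u, D u = (Θ u).snd := by
  refine ⟨Derivation.mk' ⟨⟨fun u => (Θ u).snd, ?_⟩, ?_⟩ ?_, fun u => rfl⟩
  · intro u v
    rw [map_add, TrivSqZeroExt.snd_add]
  · intro a u
    change (Θ (a • u)).snd = a • (Θ u).snd
    rw [Algebra.smul_def, map_mul, hk, TrivSqZeroExt.snd_mul, TrivSqZeroExt.algebraMap_eq_inl']
    simp [Algebra.smul_def]
  · intro u v
    change (Θ (u * v)).snd = u • (Θ v).snd + v • (Θ u).snd
    rw [map_mul, TrivSqZeroExt.snd_mul, hfst, hfst]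
    simp [mul_comm]

lemma exists_derivation {A : Type*} [CommRing A] [IsDomain A] [Algebra A K]
    [IsFractionRing A K] {f : MvPolynomial (Fin 3) k} (ev : MvPolynomial (Fin 3) k →ₐ[k] K)
    (π : MvPolynomial (Fin 3) k →+* A) (hπ : Function.Surjective π)
    (hker : ∀ g, π g = 0 ↔ f ∣ g) (hev : ∀ g, ev g = algebraMap A K (π g)) (c : Fin 3 → K)
    (hc : ∑ j, c j * ev (pderiv j f) = 0) :
    ∃ D : Derivation k K K, ∀ g, D (ev g) = ∑ j, c j * ev (pderiv j g) := by
  obtain ⟨Φ, hΦ⟩ := exists_dual_hom ev c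
  have hf0 : Φ f = 0 := by
    refine TrivSqZeroExt.ext ?_ ?_
    · rw [(hΦ f).1, hev, (hker f).2 dvd_rfl, map_zero, TrivSqZeroExt.fst_zero]
    · rw [(hΦ f).2, hc, TrivSqZeroExt.snd_zero]
  have hfz : RingHom.ker π ≤ RingHom.ker (Φ : MvPolynomial (Fin 3) k →+* TrivSqZeroExt K K) := by
    intro g hg
    obtain ⟨q, rfl⟩ := (hker g).1 hg
    rw [RingHom.mem_ker, RingHom.coe_coe, map_mul, hf0, zero_mul]
  obtain ⟨Ψ, hΨ⟩ : ∃ Ψ : A →+* TrivSqZeroExt K K, ∀ g, Ψ (π g) = Φ g :=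
    ⟨RingHom.liftOfSurjective π hπ ⟨_, hfz⟩, RingHom.liftOfSurjective_comp_apply π hπ ⟨_, hfz⟩⟩
  have hu : ∀ b : nonZeroDivisors A, IsUnit (Ψ b) := by
    rintro ⟨b, hb⟩
    obtain ⟨b, rfl⟩ := hπ b
    rw [hΨ, TrivSqZeroExt.isUnit_iff_isUnit_fst, (hΦ b).1, isUnit_iff_ne_zero, hev, Ne,
      FaithfulSMul.algebraMap_eq_zero_iff]
    exact nonZeroDivisors.ne_zero hb
  obtain ⟨Θ, hΘ⟩ : ∃ Θ : K →+* TrivSqZeroExt K K, ∀ g, Θ (ev g) = Φ g := by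
    refine ⟨IsLocalization.lift hu, fun g => ?_⟩
    rw [hev, IsLocalization.lift_eq, hΨ]
  have hfst : ∀ u, (Θ u).fst = u := by
    intro u
    obtain ⟨a, b, hb, rfl⟩ := IsFractionRing.div_surjective (A := A) u
    obtain ⟨a, rfl⟩ := hπ a
    obtain ⟨b, rfl⟩ := hπ b
    have hb0 : ev b ≠ 0 := by
      rw [hev, Ne, FaithfulSMul.algebraMap_eq_zero_iff]
      exact nonZeroDivisors.ne_zero hb
    rw [← hev, ← hev]
    apply mul_right_cancel₀ hb0
    have h := congrArg (fun v => (Θ v).fst) (div_mul_cancel₀ (ev a) hb0)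
    simp only [map_mul, TrivSqZeroExt.fst_mul] at h
    rw [hΘ a, hΘ b, (hΦ a).1, (hΦ b).1] at h
    rw [h, div_mul_cancel₀ _ hb0]
  obtain ⟨D, hD⟩ := derivation_of_dual Θ hfst fun a => by
    rw [← AlgHom.commutes ev, hΘ, AlgHom.commutes]
  exact ⟨D, fun g => by rw [hD, hΘ, (hΦ g).2]⟩

lemma exists_isFunctionField {f : MvPolynomial (Fin 3) k} (hf : Irreducible f) :
    ∃ (K : Type u) (_ : Field K) (_ : Algebra k K) (ev : MvPolynomial (Fin 3) k →ₐ[k] K),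
      IsFunctionField f ev := by
  have hp : (Ideal.span {f}).IsPrime :=
    (Ideal.span_singleton_prime hf.ne_zero).2 hf.prime
  let A := MvPolynomial (Fin 3) k ⧸ Ideal.span {f}
  let K := FractionRing A
  let ev : MvPolynomial (Fin 3) k →ₐ[k] K :=
    (IsScalarTower.toAlgHom k A K).comp (Ideal.Quotient.mkₐ k (Ideal.span {f}))
  have hev : ∀ g, ev g = algebraMap A K (Ideal.Quotient.mk _ g) := fun g => rfl
  refine ⟨K, inferInstance, inferInstance, ev, ?_, ?_, ?_⟩
  · intro g
    rw [hev, FaithfulSMul.algebraMap_eq_zero_iff, Ideal.Quotient.eq_zero_iff_mem,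
      Ideal.mem_span_singleton]
  · intro u
    obtain ⟨a, b, hb, rfl⟩ := IsFractionRing.div_surjective (A := A) u
    obtain ⟨a, rfl⟩ := Ideal.Quotient.mk_surjective a
    obtain ⟨b, rfl⟩ := Ideal.Quotient.mk_surjective b
    have hb0 : ev b ≠ 0 := by
      rw [hev, Ne, FaithfulSMul.algebraMap_eq_zero_iff]
      exact nonZeroDivisors.ne_zero hb
    exact ⟨a, b, hb0, div_mul_cancel₀ _ hb0⟩
  · exact exists_derivation ev (Ideal.Quotient.mk (Ideal.span {f})) Ideal.Quotient.mk_surjective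
      (fun g => by rw [Ideal.Quotient.eq_zero_iff_mem, Ideal.mem_span_singleton]) hev

end FunctionField

/-! ### Derivations of the function field -/

section FunctionFieldFrame

open MvPolynomial

universe u v

variable {k : Type u} {K : Type v} [Field k] [Field K] [Algebra k K]
  {f : MvPolynomial (Fin 3) k} {ev : MvPolynomial (Fin 3) k →ₐ[k] K}

lemma IsFunctionField.not_algebraicIndependent (h : IsFunctionField f ev) (hf : f ≠ 0)
    (c : Fin 3 → K) : ¬ AlgebraicIndependent k c := by
  intro hc
  have hmem : ∀ g, ev g ∈ Algebra.adjoin k (Set.range fun j => ev (X j)) := by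
    intro g
    have : ev g = aeval (fun j => ev (X j)) g := by
      have : ev = aeval fun j => ev (X j) := by
        ext j
        simp
      rw [← this]
    rw [this, Algebra.adjoin_range_eq_range_aeval]
    exact ⟨g, rfl⟩
  have halg : Algebra.IsAlgebraic (Algebra.adjoin k (Set.range fun j => ev (X j))) K := by
    refine ⟨fun u => ?_⟩
    obtain ⟨a, b, hb, hu⟩ := h.frac u
    refine ⟨Polynomial.C ⟨ev b, hmem b⟩ * Polynomial.X - Polynomial.C ⟨ev a, hmem a⟩, ?_, ?_⟩
    · intro h0
      have := congrArg (fun p => Polynomial.coeff p 1) h0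
      simp only [Polynomial.coeff_sub, Polynomial.coeff_C_mul, Polynomial.coeff_X_one, mul_one,
        Polynomial.coeff_C_succ, sub_zero, Polynomial.coeff_zero] at this
      exact hb (congrArg Subtype.val this)
    · simp only [map_sub, map_mul, Polynomial.aeval_C, Polynomial.aeval_X]
      change ev b * u - ev a = 0
      rw [mul_comm, hu, sub_self]
  have hle := hc.lift_cardinalMk_le_trdeg
  have hb := Algebra.IsAlgebraic.isTranscendenceBasis_of_lift_le_trdeg_of_finite k
    (fun j => ev (X j)) hle
  have hfa : aeval (fun j => ev (X j)) f = 0 := by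
    have : ev = aeval fun j => ev (X j) := by
      ext j
      simp
    rw [← this, h.zero_iff]
  exact hf ((injective_iff_map_eq_zero _).1 hb.1 f hfa)

/-- Constants are algebraic over the base field. -/
lemma const_of_not_algebraicIndependent [IsAlgClosed k] [CharZero k] {D₁ D₂ : Derivation k K K}
    {x y c : K} (hxx : D₁ x = 1) (hxy : D₂ x = 0) (hyx : D₁ y = 0) (hyy : D₂ y = 1)
    (h1 : D₁ c = 0) (h2 : D₂ c = 0) (hc : ¬ AlgebraicIndependent k ![c, x, y]) :
    ∃ a : k, algebraMap k K a = c := by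
  have hD : ∀ (D : Derivation k K K) (G : MvPolynomial (Fin 3) k),
      D (aeval ![c, x, y] G) = D c * aeval ![c, x, y] (pderiv 0 G) +
        D x * aeval ![c, x, y] (pderiv 1 G) + D y * aeval ![c, x, y] (pderiv 2 G) := by
    intro D G
    induction G using MvPolynomial.induction_on with
    | C a => simp
    | add p q hp hq =>
      simp only [map_add, hp, hq]
      ring
    | mul_X p i hp =>
      rw [map_mul, Derivation.leibniz, hp]
      simp only [Derivation.leibniz, map_add, smul_eq_mul, map_mul]
      fin_cases i
      all_goals
        simp [pderiv_X]
        ring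
  have hex : ∃ n, ∃ G : MvPolynomial (Fin 3) k, G ≠ 0 ∧ aeval ![c, x, y] G = 0 ∧
      G.totalDegree = n := by
    rw [AlgebraicIndependent, injective_iff_map_eq_zero] at hc
    push Not at hc
    obtain ⟨G, hG, hG0⟩ := hc
    exact ⟨_, G, hG0, hG, rfl⟩
  classical
  obtain ⟨G, hG0, hG, hdeg⟩ := Nat.find_spec hex
  have hmin : ∀ i, aeval ![c, x, y] (pderiv i G) = 0 → pderiv i G = 0 := by
    intro i hi
    by_contra hne
    have := totalDegree_pderiv_add_one_le hne
    exact Nat.find_min hex (m := (pderiv i G).totalDegree) (by omega) ⟨_, hne, hi, rfl⟩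
  have e1 := notMem_vars_of_pderiv_eq_zero (hmin 1 (by
    have := hD D₁ G
    rwa [hG, map_zero, h1, hxx, hyx, zero_mul, zero_mul, one_mul, zero_add, add_zero, eq_comm]
      at this))
  have e2 := notMem_vars_of_pderiv_eq_zero (hmin 2 (by
    have := hD D₂ G
    rwa [hG, map_zero, h2, hxy, hyy, zero_mul, zero_mul, one_mul, zero_add, zero_add, eq_comm]
      at this))
  obtain ⟨g, hg⟩ : ∃ g : Polynomial k, g = aeval (![Polynomial.X, 0, 0] : Fin 3 → Polynomial k) G := ⟨_, rfl⟩
  have hgG : Polynomial.aeval (X 0 : MvPolynomial (Fin 3) k) g = G := by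
    have hA : Polynomial.aeval (X 0 : MvPolynomial (Fin 3) k) (aeval (![Polynomial.X, 0, 0] : Fin 3 → Polynomial k) G) =
        (AlgHom.id k _) G := by
      rw [← AlgHom.comp_apply]
      refine hom_congr_vars (f₁ := ((Polynomial.aeval (X 0 : MvPolynomial (Fin 3) k)).comp
        (aeval (![Polynomial.X, 0, 0] : Fin 3 → Polynomial k))).toRingHom) (f₂ := (AlgHom.id k _).toRingHom) ?_ ?_ rfl
      · ext a
        simp
      · intro i hi _
        fin_cases i
        · simp
        · exact absurd hi e1
        · exact absurd hi e2
    rw [hg, hA]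
    rfl
  have hgc : Polynomial.aeval c g = 0 := by
    rw [← hG, ← hgG, ← Polynomial.aeval_algHom_apply]
    simp
  have halg : IsAlgebraic k c := by
    refine ⟨g, ?_, hgc⟩
    rintro rfl
    exact hG0 (by rw [← hgG, map_zero])
  exact minpoly.mem_range_of_degree_eq_one k c
    (IsAlgClosed.degree_eq_one_of_irreducible k (minpoly.irreducible halg.isIntegral))

/-- The function field of a surface on which `∂f/∂z ≠ 0` carries the partial derivatives with
respect to the first two coordinates. -/
lemma IsFunctionField.exists_frame [IsAlgClosed k] [CharZero k] (h : IsFunctionField f ev)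
    (hf : f ≠ 0) (hz : ev (pderiv 2 f) ≠ 0) :
    ∃ D₁ D₂ : Derivation k K K, Frame D₁ D₂ (ev (X 0)) (ev (X 1)) ∧
      (∀ g, D₁ (ev g) = ev (pderiv 0 g) + D₁ (ev (X 2)) * ev (pderiv 2 g)) ∧
      (∀ g, D₂ (ev g) = ev (pderiv 1 g) + D₂ (ev (X 2)) * ev (pderiv 2 g)) := by
  obtain ⟨D₁, hD₁⟩ := h.lift ![1, 0, - ev (pderiv 0 f) / ev (pderiv 2 f)] (by
    simp [Fin.sum_univ_three]
    field_simp
    ring)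
  obtain ⟨D₂, hD₂⟩ := h.lift ![0, 1, - ev (pderiv 1 f) / ev (pderiv 2 f)] (by
    simp [Fin.sum_univ_three]
    field_simp
    ring)
  have e1 : ∀ g, D₁ (ev g) = ev (pderiv 0 g) + D₁ (ev (X 2)) * ev (pderiv 2 g) := by
    intro g
    rw [hD₁, hD₁]
    simp [Fin.sum_univ_three, pderiv_X]
  have e2 : ∀ g, D₂ (ev g) = ev (pderiv 1 g) + D₂ (ev (X 2)) * ev (pderiv 2 g) := by
    intro g
    rw [hD₂, hD₂]
    simp [Fin.sum_univ_three, pderiv_X]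
  have hff : ev f = 0 := (h.zero_iff f).2 dvd_rfl
  have f1 : ev (pderiv 0 f) + D₁ (ev (X 2)) * ev (pderiv 2 f) = 0 := by
    rw [← e1, hff, map_zero]
  have f2 : ev (pderiv 1 f) + D₂ (ev (X 2)) * ev (pderiv 2 f) = 0 := by
    rw [← e2, hff, map_zero]
  have g1 := congrArg D₂ f1
  have g2 := congrArg D₁ f2
  simp only [map_add, Derivation.leibniz, smul_eq_mul, map_zero, e1 (pderiv _ f),
    e2 (pderiv _ f)] at g1 g2
  have hcommX : D₁ (D₂ (ev (X 2))) = D₂ (D₁ (ev (X 2))) := by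
    refine mul_right_cancel₀ hz ?_
    rw [pderiv_comm 0 1, pderiv_comm 0 2] at g2
    rw [pderiv_comm 1 2] at g1
    linear_combination g2 - g1
  have hcomm : ∀ g, D₁ (D₂ (ev g)) = D₂ (D₁ (ev g)) := by
    intro g
    simp only [e1 g, e2 g, map_add, Derivation.leibniz, smul_eq_mul, hcommX]
    simp only [e1 (pderiv _ g), e2 (pderiv _ g)]
    rw [pderiv_comm 0 1 g, pderiv_comm 0 2 g, pderiv_comm 1 2 g]
    ring
  have hx : D₁ (ev (X 0)) = 1 := by rw [e1]; simp [pderiv_X]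
  have hx2 : D₂ (ev (X 0)) = 0 := by rw [e2]; simp [pderiv_X]
  have hy : D₁ (ev (X 1)) = 0 := by rw [e1]; simp [pderiv_X]
  have hy2 : D₂ (ev (X 1)) = 1 := by rw [e2]; simp [pderiv_X]
  refine ⟨D₁, D₂, ⟨?_, ?_, hx, hx2, hy, hy2⟩, e1, e2⟩
  · intro u
    obtain ⟨a, b, hb, hu⟩ := h.frac u
    have k1 := congrArg (fun w => D₁ (D₂ w)) hu
    have k2 := congrArg (fun w => D₂ (D₁ w)) hu
    simp only [map_add, Derivation.leibniz, smul_eq_mul, hcomm] at k1 k2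
    refine mul_right_cancel₀ hb ?_
    linear_combination k1 - k2
  · intro u h1 h2
    exact const_of_not_algebraicIndependent hx hx2 hy hy2 h1 h2
      (h.not_algebraicIndependent hf _)

end FunctionFieldFrame

/-! ### Irreducible surfaces of degree at least three have few bad lines -/

section BadLines

open MvPolynomial

universe u

variable {K : Type u} [Field K]

/-- The numerator of the second derivatives of the function `z(x, y)` given by `f(x, y, z) = 0`. -/
noncomputable def hes (f : MvPolynomial (Fin 3) K) (i j : Fin 3) : MvPolynomial (Fin 3) K :=
  pderiv 2 f * pderiv 2 f * pderiv i (pderiv j f) -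
    pderiv 2 f * (pderiv i f * pderiv 2 (pderiv j f) + pderiv j f * pderiv 2 (pderiv i f)) +
    pderiv i f * pderiv j f * pderiv 2 (pderiv 2 f)

/-- The numerator of the leading part of the third derivatives of the function `z(x, y)` given by
`f(x, y, z) = 0`. -/
noncomputable def cub (f : MvPolynomial (Fin 3) K) (i j k : Fin 3) : MvPolynomial (Fin 3) K :=
  pderiv 2 f * pderiv 2 f * pderiv 2 f * pderiv i (pderiv j (pderiv k f)) -
    pderiv 2 f * pderiv 2 f * (pderiv k f * pderiv i (pderiv j (pderiv 2 f)) +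
      pderiv i f * pderiv j (pderiv k (pderiv 2 f)) +
      pderiv j f * pderiv i (pderiv k (pderiv 2 f))) +
    pderiv 2 f * (pderiv i f * pderiv j f * pderiv k (pderiv 2 (pderiv 2 f)) +
      pderiv j f * pderiv k f * pderiv i (pderiv 2 (pderiv 2 f)) +
      pderiv i f * pderiv k f * pderiv j (pderiv 2 (pderiv 2 f))) -
    pderiv i f * pderiv j f * pderiv k f * pderiv 2 (pderiv 2 (pderiv 2 f))

/-- The maximal minors of the matrix with rows `(c₀, c₁, c₂, c₃)`, `(h₀, h₁, h₂, 0)`,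
`(0, h₀, h₁, h₂)`. -/
def minors {R : Type*} [CommRing R] (c₀ c₁ c₂ c₃ h₀ h₁ h₂ : R) : Fin 4 → R :=
  ![c₀ * (h₁ * h₁ - h₀ * h₂) - c₁ * (h₀ * h₁) + c₂ * (h₀ * h₀),
    c₀ * (h₁ * h₂) - c₁ * (h₀ * h₂) + c₃ * (h₀ * h₀),
    c₀ * (h₂ * h₂) - c₂ * (h₀ * h₂) + c₃ * (h₀ * h₁),
    c₁ * (h₂ * h₂) - c₂ * (h₁ * h₂) + c₃ * (h₁ * h₁ - h₀ * h₂)]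

/-- The cubic and the quadratic form have a common factor at all points of the surface where these
polynomials vanish. -/
noncomputable def mino (f : MvPolynomial (Fin 3) K) : Fin 4 → MvPolynomial (Fin 3) K :=
  minors (cub f 0 0 0) (3 * cub f 0 0 1) (3 * cub f 0 1 1) (cub f 1 1 1)
    (hes f 0 0) (2 * hes f 0 1) (hes f 1 1)

/-- The determinant of the second fundamental form. -/
noncomputable def disc (f : MvPolynomial (Fin 3) K) : MvPolynomial (Fin 3) K :=
  hes f 0 0 * hes f 1 1 - hes f 0 1 * hes f 0 1

lemma two_roots {a b h₀ h₁ h₂ : K} (hab : a ≠ b) (ha : h₀ + h₁ * a + h₂ * a ^ 2 = 0)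
    (hb : h₀ + h₁ * b + h₂ * b ^ 2 = 0) : h₁ = -(h₂ * (a + b)) ∧ h₀ = h₂ * (a * b) := by
  have h1 : h₁ = -(h₂ * (a + b)) := by
    refine mul_left_cancel₀ (sub_ne_zero.2 hab) ?_
    linear_combination ha - hb
  refine ⟨h1, ?_⟩
  linear_combination ha - a * h1

lemma minors_eq_zero {a b c₀ c₁ c₂ c₃ h₀ h₁ h₂ : K} (hab : a ≠ b)
    (ha : h₀ + h₁ * a + h₂ * a ^ 2 = 0) (hb : h₀ + h₁ * b + h₂ * b ^ 2 = 0)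
    (ca : c₀ + c₁ * a + c₂ * a ^ 2 + c₃ * a ^ 3 = 0)
    (cb : c₀ + c₁ * b + c₂ * b ^ 2 + c₃ * b ^ 3 = 0) : minors c₀ c₁ c₂ c₃ h₀ h₁ h₂ = 0 := by
  obtain ⟨rfl, rfl⟩ := two_roots hab ha hb
  have hc1 : c₁ = -(c₂ * (a + b) + c₃ * (a ^ 2 + a * b + b ^ 2)) := by
    refine mul_left_cancel₀ (sub_ne_zero.2 hab) ?_
    linear_combination ca - cb
  have hc0 : c₀ = -(c₁ * a + c₂ * a ^ 2 + c₃ * a ^ 3) := by linear_combination ca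
  subst hc0
  subst hc1
  funext i
  fin_cases i <;> simp only [minors, Pi.zero_apply] <;> simp <;> ring

lemma hes_eq_zero_of_disc {a b h₀ h₁ h₂ : K} [CharZero K] (hab : a ≠ b)
    (ha : h₀ + 2 * h₁ * a + h₂ * a ^ 2 = 0) (hb : h₀ + 2 * h₁ * b + h₂ * b ^ 2 = 0)
    (hd : h₀ * h₂ - h₁ * h₁ = 0) : h₀ = 0 ∧ h₁ = 0 ∧ h₂ = 0 := by
  obtain ⟨e1, rfl⟩ := two_roots hab ha hb
  have h2 : h₂ = 0 := by
    have : (h₂ * (a - b)) ^ 2 = 0 := by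
      linear_combination (-4) * hd - (2 * h₁ - h₂ * (a + b)) * e1
    simpa [sub_eq_zero, hab] using this
  subst h2
  simpa using e1

lemma exists_factor {c₀ c₁ c₂ c₃ h₀ h₁ h₂ : K} (hm : minors c₀ c₁ c₂ c₃ h₀ h₁ h₂ = 0)
    (hh : ¬ (h₀ = 0 ∧ h₁ = 0 ∧ h₂ = 0)) :
    ∃ e g, c₀ = e * h₀ ∧ c₁ = e * h₁ + g * h₀ ∧ c₂ = e * h₂ + g * h₁ ∧ c₃ = g * h₂ := by
  have m0 := congrFun hm 0
  have m1 := congrFun hm 1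
  have m2 := congrFun hm 2
  have m3 := congrFun hm 3
  simp only [minors, Pi.zero_apply, Matrix.cons_val_zero, Matrix.cons_val_one,
    Matrix.cons_val] at m0 m1 m2 m3
  by_cases h0 : h₀ = 0
  · by_cases h2 : h₂ = 0
    · subst h0
      subst h2
      have h1 : h₁ ≠ 0 := fun h => hh ⟨rfl, h, rfl⟩
      have e0 : c₀ = 0 := by simpa [h1] using m0
      have e3 : c₃ = 0 := by simpa [h1] using m3
      refine ⟨c₁ / h₁, c₂ / h₁, by simp [e0], ?_, ?_, by simp [e3]⟩ <;> field_simp <;> ring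
    · refine ⟨(c₂ - c₃ / h₂ * h₁) / h₂, c₃ / h₂, ?_, ?_, ?_, ?_⟩
      · field_simp
        linear_combination m2
      · field_simp
        linear_combination m3
      · field_simp
        ring
      · field_simp
  · refine ⟨c₀ / h₀, (c₁ - c₀ / h₀ * h₁) / h₀, ?_, ?_, ?_, ?_⟩
    · field_simp
    · field_simp
      ring
    · field_simp
      linear_combination m0
    · field_simp
      linear_combination m1

lemma res_tangent (ℓ : Ln K) (g : MvPolynomial (Fin 3) K) :
    res ℓ (pderiv 0 g - C ℓ.1.1 * pderiv 1 g + C ℓ.2.2 * pderiv 2 g) =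
      Polynomial.derivative (res ℓ g) := by
  induction g using MvPolynomial.induction_on with
  | C a => simp
  | add p q hp hq =>
    simp only [map_add, map_sub, map_mul] at hp hq ⊢
    linear_combination hp + hq
  | mul_X p i hp =>
    simp only [map_add, map_sub, map_mul, Derivation.leibniz, smul_eq_mul,
      Polynomial.derivative_mul] at hp ⊢
    rw [← hp]
    fin_cases i
    all_goals
      simp [pderiv_X]
      ring

/-- The relations between the derivatives of a polynomial along a line in its zero set. -/
lemma hes_cub_line {f : MvPolynomial (Fin 3) K} {ℓ : Ln K} (h : res ℓ f = 0) {x : Fin 3 → K}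
    (hx : OnL ℓ x) :
    eval x (pderiv 0 f) - ℓ.1.1 * eval x (pderiv 1 f) + ℓ.2.2 * eval x (pderiv 2 f) = 0 ∧
    eval x (hes f 0 0) + 2 * eval x (hes f 0 1) * (-ℓ.1.1) +
      eval x (hes f 1 1) * (-ℓ.1.1) ^ 2 = 0 ∧
    eval x (cub f 0 0 0) + 3 * eval x (cub f 0 0 1) * (-ℓ.1.1) +
      3 * eval x (cub f 0 1 1) * (-ℓ.1.1) ^ 2 + eval x (cub f 1 1 1) * (-ℓ.1.1) ^ 3 = 0 := by
  have step : ∀ g, res ℓ g = 0 →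
      res ℓ (pderiv 0 g - C ℓ.1.1 * pderiv 1 g + C ℓ.2.2 * pderiv 2 g) = 0 := by
    intro g hg
    rw [res_tangent, hg, Polynomial.derivative_zero]
  have r1 := step f h
  have r2 := step _ r1
  have r3 := step _ r2
  have e1 := hx.eval_eq_zero r1
  have e2 := hx.eval_eq_zero r2
  have e3 := hx.eval_eq_zero r3
  have c10 := pderiv_comm 1 0 f
  have c20 := pderiv_comm 2 0 f
  have c21 := pderiv_comm 2 1 f
  simp only [map_add, map_sub, Derivation.leibniz, smul_eq_mul, map_mul, pderiv_C, eval_C,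
    mul_zero, add_zero, c10, c20, c21, pderiv_comm 1 0 (pderiv _ f),
    pderiv_comm 2 0 (pderiv _ f), pderiv_comm 2 1 (pderiv _ f)] at e1 e2 e3
  refine ⟨e1, ?_, ?_⟩
  · simp only [hes, map_add, map_sub, map_mul, c20, c21]
    linear_combination eval x (pderiv 2 f) ^ 2 * e2 - e1 * (2 * eval x (pderiv 2 f) *
      (eval x (pderiv 0 (pderiv 2 f)) - ℓ.1.1 * eval x (pderiv 1 (pderiv 2 f))) +
      (ℓ.2.2 * eval x (pderiv 2 f) - eval x (pderiv 0 f) + ℓ.1.1 * eval x (pderiv 1 f)) *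
        eval x (pderiv 2 (pderiv 2 f)))
  · simp only [cub, map_add, map_sub, map_mul]
    linear_combination eval x (pderiv 2 f) ^ 3 * e3 - e1 * (3 * eval x (pderiv 2 f) ^ 2 *
      (eval x (pderiv 0 (pderiv 0 (pderiv 2 f))) -
        2 * ℓ.1.1 * eval x (pderiv 0 (pderiv 1 (pderiv 2 f))) +
        ℓ.1.1 ^ 2 * eval x (pderiv 1 (pderiv 1 (pderiv 2 f)))) +
      3 * eval x (pderiv 2 f) *
      (ℓ.2.2 * eval x (pderiv 2 f) - eval x (pderiv 0 f) + ℓ.1.1 * eval x (pderiv 1 f)) *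
      (eval x (pderiv 0 (pderiv 2 (pderiv 2 f))) -
        ℓ.1.1 * eval x (pderiv 1 (pderiv 2 (pderiv 2 f)))) +
      ((ℓ.2.2 * eval x (pderiv 2 f)) ^ 2 - ℓ.2.2 * eval x (pderiv 2 f) *
        (eval x (pderiv 0 f) - ℓ.1.1 * eval x (pderiv 1 f)) +
        (eval x (pderiv 0 f) - ℓ.1.1 * eval x (pderiv 1 f)) ^ 2) *
        eval x (pderiv 2 (pderiv 2 (pderiv 2 f))))

end BadLines

section BadLines

open MvPolynomial

universe u

variable {K : Type u} [Field K]

lemma map_minors {R S : Type*} [CommRing R] [CommRing S] {G : Type*} [FunLike G R S]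
    [RingHomClass G R S] (φ : G) (c₀ c₁ c₂ c₃ h₀ h₁ h₂ : R) (i : Fin 4) :
    φ (minors c₀ c₁ c₂ c₃ h₀ h₁ h₂ i) =
      minors (φ c₀) (φ c₁) (φ c₂) (φ c₃) (φ h₀) (φ h₁) (φ h₂) i := by
  fin_cases i <;> simp [minors]

section Degrees

variable {p q : MvPolynomial (Fin 3) K} {m n d : ℕ}

lemma totalDegree_mul_le_add_mul (hp : p.totalDegree ≤ m * d) (hq : q.totalDegree ≤ n * d) :
    (p * q).totalDegree ≤ (n + m) * d :=
  (totalDegree_mul _ _).trans (by nlinarith)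

lemma totalDegree_mul_le_succ (hp : p.totalDegree ≤ d) (hq : q.totalDegree ≤ n * d) :
    (p * q).totalDegree ≤ (n + 1) * d :=
  (totalDegree_mul _ _).trans (by nlinarith)

lemma totalDegree_add_le_of_le (hp : p.totalDegree ≤ n) (hq : q.totalDegree ≤ n) :
    (p + q).totalDegree ≤ n := (totalDegree_add _ _).trans (max_le hp hq)

lemma totalDegree_sub_le_of_le (hp : p.totalDegree ≤ n) (hq : q.totalDegree ≤ n) :
    (p - q).totalDegree ≤ n := (totalDegree_sub _ _).trans (max_le hp hq)

lemma totalDegree_ofNat_mul_le (c : ℕ) [c.AtLeastTwo] (hp : p.totalDegree ≤ n) :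
    ((ofNat(c) : MvPolynomial (Fin 3) K) * p).totalDegree ≤ n := by
  refine (totalDegree_mul _ _).trans ?_
  rw [← map_ofNat C c, totalDegree_C]
  omega

lemma totalDegree_pderiv_le_of_le (i : Fin 3) (hp : p.totalDegree ≤ d) :
    (pderiv i p).totalDegree ≤ d := (totalDegree_pderiv_le i p).trans (by omega)

end Degrees

lemma totalDegree_hes_le (f : MvPolynomial (Fin 3) K) (i j : Fin 3) :
    (hes f i j).totalDegree ≤ 3 * f.totalDegree := by
  have h0 : f.totalDegree ≤ 1 * f.totalDegree := by omega
  simp only [hes, mul_assoc]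
  repeat' first
    | with_reducible apply totalDegree_add_le_of_le
    | with_reducible apply totalDegree_sub_le_of_le
    | with_reducible apply totalDegree_mul_le_succ
    | with_reducible apply totalDegree_pderiv_le_of_le
    | with_reducible exact le_rfl
    | with_reducible exact h0

lemma totalDegree_cub_le (f : MvPolynomial (Fin 3) K) (i j k : Fin 3) :
    (cub f i j k).totalDegree ≤ 4 * f.totalDegree := by
  have h0 : f.totalDegree ≤ 1 * f.totalDegree := by omega
  simp only [cub, mul_assoc]
  repeat' first
    | with_reducible apply totalDegree_add_le_of_le
    | with_reducible apply totalDegree_sub_le_of_le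
    | with_reducible apply totalDegree_mul_le_succ
    | with_reducible apply totalDegree_pderiv_le_of_le
    | with_reducible exact le_rfl
    | with_reducible exact h0

lemma totalDegree_minors_le {c₀ c₁ c₂ c₃ h₀ h₁ h₂ : MvPolynomial (Fin 3) K} {d : ℕ}
    (hc0 : c₀.totalDegree ≤ 4 * d) (hc1 : c₁.totalDegree ≤ 4 * d) (hc2 : c₂.totalDegree ≤ 4 * d)
    (hc3 : c₃.totalDegree ≤ 4 * d) (hh0 : h₀.totalDegree ≤ 3 * d) (hh1 : h₁.totalDegree ≤ 3 * d)
    (hh2 : h₂.totalDegree ≤ 3 * d) (i : Fin 4) :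
    (minors c₀ c₁ c₂ c₃ h₀ h₁ h₂ i).totalDegree ≤ 10 * d := by
  have hm : ∀ {c h h' : MvPolynomial (Fin 3) K}, c.totalDegree ≤ 4 * d → h.totalDegree ≤ 3 * d →
      h'.totalDegree ≤ 3 * d → (c * (h * h')).totalDegree ≤ 10 * d := fun hc h h' =>
    totalDegree_mul_le_add_mul hc (totalDegree_mul_le_add_mul h h')
  fin_cases i <;> simp only [minors, mul_sub] <;> simp
  all_goals
    repeat' first
      | with_reducible apply totalDegree_add_le_of_le
      | with_reducible apply totalDegree_sub_le_of_le
      | with_reducible apply hm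
      | assumption

lemma totalDegree_mino_le (f : MvPolynomial (Fin 3) K) (i : Fin 4) :
    (mino f i).totalDegree ≤ 10 * f.totalDegree := by
  have hh := fun i j => totalDegree_hes_le f i j
  have hc := fun i j k => totalDegree_cub_le f i j k
  exact totalDegree_minors_le (hc _ _ _) (totalDegree_ofNat_mul_le 3 (hc _ _ _))
    (totalDegree_ofNat_mul_le 3 (hc _ _ _)) (hc _ _ _) (hh _ _)
    (totalDegree_ofNat_mul_le 2 (hh _ _)) (hh _ _) i

/-- A surface along which the cubic form is divisible by the quadratic form is a quadric. -/
lemma totalDegree_le_two [IsAlgClosed K] [CharZero K] {f : MvPolynomial (Fin 3) K}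
    (hf : Irreducible f) (hz : pderiv 2 f ≠ 0)
    (h : ((∀ i, f ∣ mino f i) ∧ ¬ f ∣ disc f) ∨
      (f ∣ hes f 0 0 ∧ f ∣ hes f 0 1 ∧ f ∣ hes f 1 1)) : f.totalDegree ≤ 2 := by
  obtain ⟨F, _, _, ev, hF⟩ := exists_isFunctionField hf
  have hzF : ev (pderiv 2 f) ≠ 0 := fun h0 => not_dvd_pderiv hz ((hF.zero_iff _).1 h0)
  obtain ⟨D₁, D₂, hD, e1, e2⟩ := hF.exists_frame hf.ne_zero hzF
  suffices hQ : ∃ Q : MvPolynomial (Fin 3) K, Q ≠ 0 ∧ Q.totalDegree ≤ 2 ∧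
      aeval ![ev (X 0), ev (X 1), ev (X 2)] Q = 0 by
    obtain ⟨Q, hQ0, hQ2, hQ⟩ := hQ
    have hev : ev = aeval ![ev (X 0), ev (X 1), ev (X 2)] := by
      ext j
      fin_cases j <;> simp
    rw [← hev, hF.zero_iff] at hQ
    by_contra hlt
    exact hQ0 (eq_zero_of_dvd_of_totalDegree_lt hQ (by omega))
  have hff : ev f = 0 := (hF.zero_iff f).2 dvd_rfl
  have f1 : ev (pderiv 0 f) + D₁ (ev (X 2)) * ev (pderiv 2 f) = 0 := by
    rw [← e1, hff, map_zero]
  have f2 : ev (pderiv 1 f) + D₂ (ev (X 2)) * ev (pderiv 2 f) = 0 := by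
    rw [← e2, hff, map_zero]
  have f11 := congrArg D₁ f1
  have f12 := congrArg D₁ f2
  have f22 := congrArg D₂ f2
  have c10 := pderiv_comm 1 0 f
  have c20 := pderiv_comm 2 0 f
  have c21 := pderiv_comm 2 1 f
  simp only [map_add, Derivation.leibniz, smul_eq_mul, map_zero, e1 (pderiv _ f),
    e2 (pderiv _ f), c20, c21] at f11 f12 f22
  have f111 := congrArg D₁ f11
  have f112 := congrArg D₂ f11
  have f122 := congrArg D₁ f22
  have f222 := congrArg D₂ f22
  have c10' := fun i => pderiv_comm 1 0 (pderiv i f)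
  have c20' := fun i => pderiv_comm 2 0 (pderiv i f)
  have c21' := fun i => pderiv_comm 2 1 (pderiv i f)
  simp only [map_add, Derivation.leibniz, smul_eq_mul, map_zero, e1 (pderiv _ f),
    e2 (pderiv _ f), e1 (pderiv _ (pderiv _ f)), e2 (pderiv _ (pderiv _ f)), c10, c20, c21,
    c10', c20', c21', ← hD.comm] at f111 f112 f122 f222
  set z := ev (pderiv 2 f) with hzdef
  set u := ev (X 2)
  have hA : ev (pderiv 0 f) = -(D₁ u * z) := by linear_combination f1
  have hB : ev (pderiv 1 f) = -(D₂ u * z) := by linear_combination f2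
  have H11 : ev (hes f 0 0) = -z ^ 3 * D₁ (D₁ u) := by
    simp only [hes, map_add, map_sub, map_mul, c20, hA, ← hzdef]
    linear_combination z ^ 2 * f11
  have H12 : ev (hes f 0 1) = -z ^ 3 * D₁ (D₂ u) := by
    simp only [hes, map_add, map_sub, map_mul, c20, c21, hA, hB, ← hzdef]
    linear_combination z ^ 2 * f12
  have H22 : ev (hes f 1 1) = -z ^ 3 * D₂ (D₂ u) := by
    simp only [hes, map_add, map_sub, map_mul, c21, hB, ← hzdef]
    linear_combination z ^ 2 * f22
  set g₁ := ev (pderiv 0 (pderiv 2 f)) + D₁ u * ev (pderiv 2 (pderiv 2 f)) with hg1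
  set g₂ := ev (pderiv 1 (pderiv 2 f)) + D₂ u * ev (pderiv 2 (pderiv 2 f)) with hg2
  have C111 : ev (cub f 0 0 0) = -z ^ 3 * (z * D₁ (D₁ (D₁ u)) + 3 * g₁ * D₁ (D₁ u)) := by
    simp only [cub, map_add, map_sub, map_mul, hA, ← hzdef, hg1]
    linear_combination z ^ 3 * f111
  have C112 : ev (cub f 0 0 1) =
      -z ^ 3 * (z * D₂ (D₁ (D₁ u)) + 2 * g₁ * D₁ (D₂ u) + g₂ * D₁ (D₁ u)) := by
    simp only [cub, map_add, map_sub, map_mul, hA, hB, ← hzdef, hg1, hg2, ← hD.comm]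
    linear_combination z ^ 3 * f112
  have C122 : ev (cub f 0 1 1) =
      -z ^ 3 * (z * D₁ (D₂ (D₂ u)) + 2 * g₂ * D₁ (D₂ u) + g₁ * D₂ (D₂ u)) := by
    simp only [cub, map_add, map_sub, map_mul, hA, hB, ← hzdef, hg1, hg2]
    linear_combination z ^ 3 * f122
  have C222 : ev (cub f 1 1 1) = -z ^ 3 * (z * D₂ (D₂ (D₂ u)) + 3 * g₂ * D₂ (D₂ u)) := by
    simp only [cub, map_add, map_sub, map_mul, hB, ← hzdef, hg2]
    linear_combination z ^ 3 * f222
  have hz3 : -z ^ 3 ≠ 0 := neg_ne_zero.2 (pow_ne_zero 3 hzF)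
  rcases h with ⟨hmin, hdisc⟩ | ⟨h1, h2, h3⟩
  · have : CharZero F := charZero_of_injective_algebraMap (algebraMap K F).injective
    have hd : D₁ (D₁ u) * D₂ (D₂ u) - D₁ (D₂ u) ^ 2 ≠ 0 := by
      intro h0
      refine hdisc ((hF.zero_iff _).1 ?_)
      rw [disc, map_sub, map_mul, map_mul, H11, H12, H22]
      linear_combination z ^ 6 * h0
    have hm : minors (ev (cub f 0 0 0)) (3 * ev (cub f 0 0 1)) (3 * ev (cub f 0 1 1))
        (ev (cub f 1 1 1)) (ev (hes f 0 0)) (2 * ev (hes f 0 1)) (ev (hes f 1 1)) = 0 := by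
      funext i
      have := (hF.zero_iff _).2 (hmin i)
      rw [Pi.zero_apply, ← this, mino, map_minors]
      simp only [map_mul, map_ofNat]
    obtain ⟨e, g, k0, k1, k2, k3⟩ := exists_factor hm (by
      rw [H11, H12, H22]
      rintro ⟨h1, h2, -⟩
      have a1 : D₁ (D₁ u) = 0 := (mul_eq_zero.1 h1).resolve_left hz3
      have a2 : D₁ (D₂ u) = 0 :=
        (mul_eq_zero.1 ((mul_eq_zero.1 h2).resolve_left two_ne_zero)).resolve_left hz3
      exact hd (by rw [a1, a2]; ring))
    rw [H11, C111] at k0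
    rw [H11, H12, C112] at k1
    rw [H22, H12, C122] at k2
    rw [H22, C222] at k3
    refine hD.quadric_of_cubic (α := (e / 3 - g₁) / z) (β := (g / 3 - g₂) / z) ⟨?_, ?_, ?_, ?_⟩ hd
    · field_simp
      refine mul_left_cancel₀ hz3 ?_
      linear_combination k0
    · field_simp
      refine mul_left_cancel₀ hz3 ?_
      linear_combination k1
    · field_simp
      refine mul_left_cancel₀ hz3 ?_
      linear_combination k2
    · field_simp
      refine mul_left_cancel₀ hz3 ?_
      linear_combination k3
  · have a1 : D₁ (D₁ u) = 0 := by
      rw [← hF.zero_iff, H11] at h1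
      exact (mul_eq_zero.1 h1).resolve_left hz3
    have a3 : D₂ (D₂ u) = 0 := by
      rw [← hF.zero_iff, H22] at h3
      exact (mul_eq_zero.1 h3).resolve_left hz3
    exact hD.quadric_of_const (by rw [a1, map_zero]) (by rw [a1, map_zero])
      (by rw [a3, map_zero]) (by rw [a3, map_zero])

end BadLines

section BadLines

open MvPolynomial

universe u

variable {K : Type u} [Field K]

lemma slope_ne {f : MvPolynomial (Fin 3) K} {ℓ m : Ln K} (hℓ : res ℓ f = 0) (hm : res m f = 0)
    (hne : m ≠ ℓ) {x : Fin 3 → K} (h1 : OnL ℓ x) (h2 : OnL m x)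
    (hz : eval x (pderiv 2 f) ≠ 0) : -ℓ.1.1 ≠ -m.1.1 := by
  intro h
  have e1 := (hes_cub_line hℓ h1).1
  have e2 := (hes_cub_line hm h2).1
  have hs : ℓ.2.2 = m.2.2 := by
    refine mul_right_cancel₀ hz ?_
    linear_combination e1 - e2 - eval x (pderiv 1 f) * h
  have hp : ℓ.1.1 = m.1.1 := neg_injective h
  apply hne
  have a1 : m.2.1 = ℓ.2.1 := by linear_combination h1.1 - h2.1 - x 0 * hp
  have a2 : m.1.2 = ℓ.1.2 := by linear_combination h2.2 - h1.2 - x 0 * hs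
  exact Prod.ext (Prod.ext hp.symm a2) (Prod.ext a1 hs.symm)

/-- An irreducible surface of degree `d ≥ 3` contains at most `11 * d ^ 2` lines with more than
`11 * d` points on further lines of the surface. -/
theorem card_bad_le [IsAlgClosed K] [CharZero K] {f : MvPolynomial (Fin 3) K}
    (hf : Irreducible f) (hz : pderiv 2 f ≠ 0) (hd : 3 ≤ f.totalDegree) (B : Finset (Ln K))
    (hB : ∀ ℓ ∈ B, res ℓ f = 0 ∧ ∃ s : Finset (Fin 3 → K), 11 * f.totalDegree < s.card ∧
      ∀ x ∈ s, OnL ℓ x ∧ ∃ m, m ≠ ℓ ∧ res m f = 0 ∧ OnL m x) :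
    B.card ≤ 11 * f.totalDegree ^ 2 := by
  by_contra hcard
  have hstep : ∀ G : MvPolynomial (Fin 3) K, G.totalDegree ≤ 10 * f.totalDegree →
      (∀ ℓ m x, OnL ℓ x → OnL m x → m ≠ ℓ → res ℓ f = 0 → res m f = 0 →
        eval x (pderiv 2 f) ≠ 0 → eval x G = 0) → f ∣ G := by
    intro G hG hvan
    have hdeg : (pderiv 2 f * G).totalDegree ≤ 11 * f.totalDegree := by
      have h1 := totalDegree_mul (pderiv 2 f) G
      have h2 := totalDegree_pderiv_le 2 f
      omega
    have hprod : f ∣ pderiv 2 f * G := by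
      by_contra hnd
      have hbz := bezout_lines hf hnd B (by
        intro ℓ hℓ
        obtain ⟨h0, s, hs, hx⟩ := hB ℓ hℓ
        refine ⟨h0, res_eq_zero_of_card s ?_ (hdeg.trans_lt hs)⟩
        intro x hxs
        obtain ⟨h1, m, hne, hm, h2⟩ := hx x hxs
        refine ⟨h1, ?_⟩
        rw [map_mul]
        by_cases hzx : eval x (pderiv 2 f) = 0
        · rw [hzx, zero_mul]
        · rw [hvan ℓ m x h1 h2 hne h0 hm hzx, mul_zero])
      apply hcard
      calc B.card ≤ f.totalDegree * (pderiv 2 f * G).totalDegree := hbz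
        _ ≤ f.totalDegree * (11 * f.totalDegree) := Nat.mul_le_mul_left _ hdeg
        _ = 11 * f.totalDegree ^ 2 := by ring
    exact (hf.prime.dvd_or_dvd hprod).resolve_left (not_dvd_pderiv hz)
  have hmino : ∀ i, f ∣ mino f i := by
    intro i
    refine hstep _ (totalDegree_mino_le f i) ?_
    intro ℓ m x h1 h2 hne hℓ hm hzx
    obtain ⟨-, a1, a2⟩ := hes_cub_line hℓ h1
    obtain ⟨-, b1, b2⟩ := hes_cub_line hm h2
    rw [mino, map_minors]
    simp only [map_mul, map_ofNat]
    rw [minors_eq_zero (slope_ne hℓ hm hne h1 h2 hzx) a1 b1 a2 b2]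
    rfl
  have h2 : f.totalDegree ≤ 2 := by
    refine totalDegree_le_two hf hz ?_
    by_cases hdisc : f ∣ disc f
    · right
      have hkey : ∀ ℓ m x, OnL ℓ x → OnL m x → m ≠ ℓ → res ℓ f = 0 → res m f = 0 →
          eval x (pderiv 2 f) ≠ 0 →
          eval x (hes f 0 0) = 0 ∧ eval x (hes f 0 1) = 0 ∧ eval x (hes f 1 1) = 0 := by
        intro ℓ m x h1 h2 hne hℓ hm hzx
        refine hes_eq_zero_of_disc (slope_ne hℓ hm hne h1 h2 hzx) (hes_cub_line hℓ h1).2.1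
          (hes_cub_line hm h2).2.1 ?_
        obtain ⟨q, hq⟩ := hdisc
        have := congrArg (eval x) hq
        rwa [map_mul, h1.eval_eq_zero hℓ, zero_mul, disc, map_sub, map_mul, map_mul] at this
      have hdg := fun i j => (totalDegree_hes_le f i j).trans
        (Nat.mul_le_mul_right f.totalDegree (show 3 ≤ 10 by norm_num))
      exact ⟨hstep _ (hdg _ _) fun ℓ m x h1 h2 hne hℓ hm hzx =>
          (hkey ℓ m x h1 h2 hne hℓ hm hzx).1,
        hstep _ (hdg _ _) fun ℓ m x h1 h2 hne hℓ hm hzx => (hkey ℓ m x h1 h2 hne hℓ hm hzx).2.1,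
        hstep _ (hdg _ _) fun ℓ m x h1 h2 hne hℓ hm hzx => (hkey ℓ m x h1 h2 hne hℓ hm hzx).2.2⟩
    · exact Or.inl ⟨hmino, hdisc⟩
  omega

end BadLines

/-! ### Random orders and interpolation -/

section RandomOrder

variable {α : Type*} [LinearOrder α]

lemma sum_rank (T : Finset α) (π : Equiv.Perm α) (w : ℕ → ℕ) :
    ∑ c ∈ T, w (T.filter fun b => π b < π c).card = ∑ r ∈ Finset.range T.card, w r := by
  have hlt : ∀ c ∈ T, ∀ c', π c < π c' → (T.filter fun b => π b < π c).card <
      (T.filter fun b => π b < π c').card := by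
    intro c hc c' h
    refine Finset.card_lt_card ((Finset.ssubset_iff_of_subset ?_).2 ⟨c, ?_, ?_⟩)
    · exact Finset.monotone_filter_right _ fun b _ hb => hb.trans h
    · simp [hc, h]
    · simp
  have hinj : Set.InjOn (fun c => (T.filter fun b => π b < π c).card) T := by
    intro c hc c' hc' h
    by_contra hne
    rcases lt_or_gt_of_ne (π.injective.ne hne) with h1 | h1
    · exact (hlt c hc c' h1).ne h
    · exact (hlt c' hc' c h1).ne h.symm
  have himg : T.image (fun c => (T.filter fun b => π b < π c).card) = Finset.range T.card := by
    refine Finset.eq_of_subset_of_card_le ?_ ?_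
    · intro r hr
      obtain ⟨c, hc, rfl⟩ := Finset.mem_image.1 hr
      rw [Finset.mem_range]
      exact Finset.card_lt_card (Finset.filter_ssubset.2 ⟨c, hc, lt_irrefl _⟩)
    · rw [Finset.card_image_of_injOn hinj, Finset.card_range]
  rw [← himg, Finset.sum_image hinj]

variable [Fintype α]

lemma sum_perm_rank {T : Finset α} {a c : α} (ha : a ∈ T) (hc : c ∈ T) (w : ℕ → ℕ) :
    ∑ π : Equiv.Perm α, w (T.filter fun b => π b < π c).card =
      ∑ π : Equiv.Perm α, w (T.filter fun b => π b < π a).card := by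
  rw [← Equiv.sum_comp (Equiv.mulRight (Equiv.swap a c))
    (fun π : Equiv.Perm α => w (T.filter fun b => π b < π a).card)]
  refine Finset.sum_congr rfl fun π _ => ?_
  congr 1
  refine Finset.card_equiv (Equiv.swap a c) fun b => ?_
  have hT : Equiv.swap a c b ∈ T ↔ b ∈ T := by
    by_cases h1 : b = a
    · subst h1
      simp [ha, hc]
    · by_cases h2 : b = c
      · subst h2
        simp [ha, hc]
      · rw [Equiv.swap_apply_of_ne_of_ne h1 h2]
  simp [hT]

/-- In a suitable order, every element has few predecessors in its set not too often. -/
lemma exists_perm (S : α → Finset α) (M : ℕ) (hS : ∀ a, a ∉ S a ∧ (S a).card = M) (w : ℕ → ℕ) :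
    ∃ π : Equiv.Perm α, (M + 1) * ∑ a, w ((S a).filter fun b => π b < π a).card ≤
      Fintype.card α * ∑ r ∈ Finset.range (M + 1), w r := by
  have key : ∀ a, (M + 1) * ∑ π : Equiv.Perm α, w ((S a).filter fun b => π b < π a).card =
      ∑ _π : Equiv.Perm α, ∑ r ∈ Finset.range (M + 1), w r := by
    intro a
    have hc : (insert a (S a)).card = M + 1 := by
      rw [Finset.card_insert_of_notMem (hS a).1, (hS a).2]
    have h1 : ∀ π : Equiv.Perm α, ((S a).filter fun b => π b < π a) =
        (insert a (S a)).filter fun b => π b < π a := by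
      intro π
      rw [Finset.filter_insert, if_neg (lt_irrefl _)]
    simp only [h1]
    calc (M + 1) * ∑ π : Equiv.Perm α, w ((insert a (S a)).filter fun b => π b < π a).card
        = ∑ c ∈ insert a (S a), ∑ π : Equiv.Perm α,
            w ((insert a (S a)).filter fun b => π b < π c).card := by
          rw [Finset.sum_congr rfl fun c hc =>
            sum_perm_rank (Finset.mem_insert_self a (S a)) hc w, Finset.sum_const, hc,
            smul_eq_mul]
      _ = _ := by
          rw [Finset.sum_comm]
          refine Finset.sum_congr rfl fun π _ => ?_
          rw [sum_rank, hc]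
  have htot : ∑ π : Equiv.Perm α, (M + 1) * ∑ a, w ((S a).filter fun b => π b < π a).card ≤
      ∑ _π : Equiv.Perm α, Fintype.card α * ∑ r ∈ Finset.range (M + 1), w r := by
    rw [← Finset.mul_sum, Finset.sum_comm, Finset.mul_sum, Finset.sum_congr rfl fun a _ => key a,
      Finset.sum_const, ← Finset.mul_sum, smul_eq_mul, Finset.card_univ]
  obtain ⟨π, -, hπ⟩ := Finset.exists_le_of_sum_le Finset.univ_nonempty htot
  exact ⟨π, hπ⟩

end RandomOrder

section Interpolation

open MvPolynomial

variable {K : Type*} [Field K]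

lemma exists_vanishing (T : Finset (Fin 3 → K)) (D : ℕ)
    (hT : 6 * T.card < (D + 1) * (D + 2) * (D + 3)) :
    ∃ F : MvPolynomial (Fin 3) K, F ≠ 0 ∧ F.totalDegree ≤ D ∧ ∀ x ∈ T, eval x F = 0 := by
  let Φ : V K D →ₗ[K] (T → K) :=
    (LinearMap.pi fun x : T => (aeval (x : Fin 3 → K)).toLinearMap) ∘ₗ (V K D).subtype
  have hfin : FiniteDimensional K (V K D) := by
    apply FiniteDimensional.of_finrank_pos
    have := finrank_V (K := K) D
    by_contra h0
    have : 0 < (D + 1) * (D + 2) * (D + 3) := by positivity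
    omega
  have hker : LinearMap.ker Φ ≠ ⊥ := by
    apply LinearMap.ker_ne_bot_of_finrank_lt
    have := finrank_V (K := K) D
    rw [Module.finrank_fintype_fun_eq_card, Fintype.card_coe]
    omega
  obtain ⟨F, hF, hF0⟩ := (Submodule.ne_bot_iff _).1 hker
  refine ⟨F, fun h => hF0 (Subtype.ext h), (mem_restrictTotalDegree _ _ _).1 F.2, ?_⟩
  intro x hx
  have := congrFun (LinearMap.mem_ker.1 hF) ⟨x, hx⟩
  change aeval x (F : MvPolynomial (Fin 3) K) = 0 at this
  rwa [aeval_def, Algebra.algebraMap_self, eval₂_id] at this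

lemma sum_range_sub_le (D M : ℕ) :
    2 * ∑ r ∈ Finset.range (M + 1), (D + 1 - r) ≤ (D + 1) * (D + 2) := by
  have h : ∀ n, 2 * ∑ r ∈ Finset.range n, (D + 1 - r) + (D + 1 - n) * (D + 2 - n) ≤
      (D + 1) * (D + 2) := by
    intro n
    induction n with
    | zero => simp
    | succ n ih =>
      rw [Finset.sum_range_succ]
      rcases Nat.lt_or_ge D n with h1 | h1
      · have e1 : D + 1 - n = 0 := by omega
        have e2 : D + 1 - (n + 1) = 0 := by omega
        rw [e1] at ih ⊢
        rw [e2]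
        omega
      · obtain ⟨t, rfl⟩ := Nat.exists_eq_add_of_le h1
        have e1 : n + t + 1 - n = t + 1 := by omega
        have e2 : n + t + 2 - n = t + 2 := by omega
        have e3 : n + t + 1 - (n + 1) = t := by omega
        have e4 : n + t + 2 - (n + 1) = t + 1 := by omega
        rw [e1, e2] at ih
        rw [e1, e3, e4]
        nlinarith
  have := h (M + 1)
  omega

/-- Lines with many intersections lie on a surface of low degree. -/
lemma exists_surface [Infinite K] [DecidableEq K] {L : ℕ} (ℓ : Fin L → Ln K)
    (S : Fin L → Finset (Fin L)) (y : Fin L → Fin L → Fin 3 → K) (M D : ℕ)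
    (hS : ∀ a, a ∉ S a ∧ (S a).card = M) (hy : ∀ a, Set.InjOn (y a) (S a))
    (hon : ∀ a, ∀ b ∈ S a, OnL (ℓ a) (y a b) ∧ OnL (ℓ b) (y a b))
    (hD : 3 * L < (D + 3) * (M + 1)) :
    ∃ F : MvPolynomial (Fin 3) K, F ≠ 0 ∧ F.totalDegree ≤ D ∧ ∀ a, res (ℓ a) F = 0 := by
  classical
  obtain ⟨π, hπ⟩ := exists_perm S M hS fun r => D + 1 - r
  have hex : ∀ a, ∃ T : Finset (Fin 3 → K),
      T.card = D + 1 - ((S a).filter fun b => π b < π a).card ∧ (∀ x ∈ T, OnL (ℓ a) x) ∧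
      Disjoint T ((S a).image (y a)) := by
    intro a
    have hinf : (Set.range (pt (ℓ a)) \
        (((S a).image (y a) : Finset _) : Set (Fin 3 → K))).Infinite := by
      refine Set.Infinite.sdiff (Set.infinite_range_of_injective ?_) (Finset.finite_toSet _)
      intro s t h
      simpa [pt] using congrFun h 0
    obtain ⟨T, hT, hc⟩ := hinf.exists_subset_card_eq
      (D + 1 - ((S a).filter fun b => π b < π a).card)
    refine ⟨T, hc, ?_, ?_⟩
    · intro x hx
      obtain ⟨t, rfl⟩ := (hT hx).1
      exact pt_onL _ _
    · rw [Finset.disjoint_left]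
      intro x hx hx'
      exact (hT hx).2 hx'
  choose T hTc hTon hTd using hex
  have hcard : 6 * (Finset.univ.biUnion T).card < (D + 1) * (D + 2) * (D + 3) := by
    have h1 : (Finset.univ.biUnion T).card ≤
        ∑ a, (D + 1 - ((S a).filter fun b => π b < π a).card) :=
      Finset.card_biUnion_le.trans (Finset.sum_le_sum fun a _ => (hTc a).le)
    have h2 := sum_range_sub_le D M
    rw [Fintype.card_fin] at hπ
    have h3 : 0 < M + 1 := by omega
    have h4 : 0 < (D + 1) * (D + 2) := by positivity
    refine lt_of_mul_lt_mul_left ?_ h3.le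
    calc (M + 1) * (6 * (Finset.univ.biUnion T).card)
        ≤ 6 * ((M + 1) * ∑ a, (D + 1 - ((S a).filter fun b => π b < π a).card)) := by
          nlinarith
      _ ≤ 6 * (L * ∑ r ∈ Finset.range (M + 1), (D + 1 - r)) := by omega
      _ ≤ 3 * L * ((D + 1) * (D + 2)) := by nlinarith
      _ < (D + 3) * (M + 1) * ((D + 1) * (D + 2)) := Nat.mul_lt_mul_of_pos_right hD h4
      _ = (M + 1) * ((D + 1) * (D + 2) * (D + 3)) := by ring
  obtain ⟨F, hF0, hFd, hF⟩ := exists_vanishing _ D hcard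
  refine ⟨F, hF0, hFd, ?_⟩
  have hmain : ∀ n : ℕ, ∀ a, (π a : ℕ) = n → res (ℓ a) F = 0 := by
    intro n
    induction n using Nat.strong_induction_on with
    | _ n ih =>
      intro a ha
      refine res_eq_zero_of_card (T a ∪ ((S a).filter fun b => π b < π a).image (y a)) ?_ ?_
      · intro x hx
        rcases Finset.mem_union.1 hx with h | h
        · exact ⟨hTon a x h, hF x (Finset.mem_biUnion.2 ⟨a, Finset.mem_univ _, h⟩)⟩
        · obtain ⟨b, hb, rfl⟩ := Finset.mem_image.1 h
          obtain ⟨hb1, hb2⟩ := Finset.mem_filter.1 hb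
          refine ⟨(hon a b hb1).1, (hon a b hb1).2.eval_eq_zero (ih (π b) ?_ b rfl)⟩
          rw [← ha]
          exact hb2
      · rw [Finset.card_union_of_disjoint, hTc, Finset.card_image_of_injOn]
        · omega
        · exact (hy a).mono fun b hb => (Finset.mem_filter.1 hb).1
        · exact (hTd a).mono_right (Finset.image_subset_image (Finset.filter_subset _ _))
  exact fun a => hmain _ a rfl

end Interpolation

/-! ### Crossing points -/

section Crossings

open MvPolynomial
open scoped Classical

variable {K : Type*} [Field K]

/-- The common point of two lines in good position, if there is one. -/
noncomputable def ip (ℓ m : Ln K) : Fin 3 → K := pt ℓ ((ℓ.2.1 - m.2.1) / (ℓ.1.1 - m.1.1))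

lemma Good.ip_eq {ℓ m : Ln K} (h : Good ℓ m) {x : Fin 3 → K} (h1 : OnL ℓ x) (h2 : OnL m x) :
    ip ℓ m = x := by
  rw [h1.eq_pt, ip]
  congr 1
  rw [div_eq_iff (sub_ne_zero.2 h.1)]
  linear_combination h2.1 - h1.1

/-- The points where two lines of a family in good position meet. -/
noncomputable def cross (𝓛 : Finset (Ln K)) : Finset (Fin 3 → K) :=
  ((𝓛 ×ˢ 𝓛).image fun p => ip p.1 p.2).filter fun x =>
    ∃ ℓ ∈ 𝓛, ∃ m ∈ 𝓛, Good ℓ m ∧ OnL ℓ x ∧ OnL m x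

lemma mem_cross {𝓛 : Finset (Ln K)} {x : Fin 3 → K} :
    x ∈ cross 𝓛 ↔ ∃ ℓ ∈ 𝓛, ∃ m ∈ 𝓛, Good ℓ m ∧ OnL ℓ x ∧ OnL m x := by
  rw [cross, Finset.mem_filter, and_iff_right_iff_imp]
  rintro ⟨ℓ, hℓ, m, hm, hg, h1, h2⟩
  exact Finset.mem_image.2 ⟨(ℓ, m), Finset.mk_mem_product hℓ hm, hg.ip_eq h1 h2⟩

/-- The crossing points on a line. -/
noncomputable def crossOn (𝓛 : Finset (Ln K)) (ℓ : Ln K) : Finset (Fin 3 → K) :=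
  (cross 𝓛).filter fun x => OnL ℓ x ∧ ∃ m ∈ 𝓛, Good ℓ m ∧ OnL m x

lemma cross_subset (𝓛 : Finset (Ln K)) (ℓ : Ln K) :
    cross 𝓛 ⊆ cross (𝓛.erase ℓ) ∪ crossOn 𝓛 ℓ := by
  intro x hx
  obtain ⟨m, hm, n, hn, hg, h1, h2⟩ := mem_cross.1 hx
  rw [Finset.mem_union]
  by_cases e1 : m = ℓ
  · subst e1
    exact Or.inr (Finset.mem_filter.2 ⟨hx, h1, n, hn, hg, h2⟩)
  · by_cases e2 : n = ℓ
    · subst e2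
      exact Or.inr (Finset.mem_filter.2 ⟨hx, h2, m, hm, hg.symm, h1⟩)
    · exact Or.inl (mem_cross.2 ⟨m, Finset.mem_erase.2 ⟨e1, hm⟩, n, Finset.mem_erase.2 ⟨e2, hn⟩,
        hg, h1, h2⟩)

lemma exists_surface_of_crossOn [Infinite K] (𝓛 : Finset (Ln K)) (M D : ℕ)
    (hM : ∀ ℓ ∈ 𝓛, M ≤ (crossOn 𝓛 ℓ).card) (hD : 3 * 𝓛.card < (D + 3) * (M + 1)) :
    ∃ F : MvPolynomial (Fin 3) K, F ≠ 0 ∧ F.totalDegree ≤ D ∧ ∀ ℓ ∈ 𝓛, res ℓ F = 0 := by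
  let e := 𝓛.equivFin
  have hex : ∀ a, ∃ S : Finset (Fin 𝓛.card), S.card = M ∧
      Set.InjOn (fun b => ip (e.symm a : Ln K) (e.symm b)) S ∧ ∀ b ∈ S, a ≠ b ∧
      OnL (e.symm a : Ln K) (ip (e.symm a : Ln K) (e.symm b)) ∧
      OnL (e.symm b : Ln K) (ip (e.symm a : Ln K) (e.symm b)) := by
    intro a
    set ℓ : Ln K := (e.symm a).1 with hℓ
    obtain ⟨Y, hY, hYc⟩ := Finset.exists_subset_card_eq (hM ℓ (e.symm a).2)
    have hm : ∀ x : Fin 3 → K, ∃ b, x ∈ Y →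
        Good ℓ (e.symm b) ∧ OnL ℓ x ∧ OnL (e.symm b : Ln K) x := by
      intro x
      by_cases hx : x ∈ Y
      · obtain ⟨-, h1, m, hm, hg, h2⟩ := Finset.mem_filter.1 (hY hx)
        exact ⟨e ⟨m, hm⟩, fun _ => by simpa using ⟨hg, h1, h2⟩⟩
      · exact ⟨a, fun h => absurd h hx⟩
    choose b hb using hm
    have hip : ∀ x ∈ Y, ip ℓ (e.symm (b x)) = x := fun x hx =>
      (hb x hx).1.ip_eq (hb x hx).2.1 (hb x hx).2.2
    refine ⟨Y.image b, ?_, ?_, ?_⟩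
    · rw [Finset.card_image_of_injOn, hYc]
      intro x hx y hy hxy
      rw [← hip x hx, ← hip y hy]
      exact congrArg (fun c => ip ℓ (e.symm c)) hxy
    · intro c hc c' hc' hcc
      obtain ⟨x, hx, rfl⟩ := Finset.mem_image.1 hc
      obtain ⟨y, hy, rfl⟩ := Finset.mem_image.1 hc'
      simp only [hip x hx, hip y hy] at hcc
      rw [hcc]
    · intro c hc
      obtain ⟨x, hx, rfl⟩ := Finset.mem_image.1 hc
      rw [hip x hx]
      refine ⟨fun h => (hb x hx).1.ne ?_, (hb x hx).2⟩
      rw [hℓ, ← h]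
  choose S hSc hSinj hS using hex
  obtain ⟨F, hF0, hFd, hF⟩ := exists_surface (fun a => (e.symm a : Ln K)) S
    (fun a b => ip (e.symm a : Ln K) (e.symm b)) M D
    (fun a => ⟨fun h => (hS a a h).1 rfl, hSc a⟩) hSinj (fun a b hb => (hS a b hb).2) hD
  refine ⟨F, hF0, hFd, fun ℓ hℓ => ?_⟩
  have := hF (e ⟨ℓ, hℓ⟩)
  rwa [Equiv.symm_apply_apply] at this

end Crossings

/-! ### Irreducible factors and exceptional incidences -/

section Factors

open MvPolynomial
open scoped Classical

universe u

variable {K : Type u} [Field K]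

lemma exists_factors {F : MvPolynomial (Fin 3) K} (hF : F ≠ 0) :
    ∃ 𝓕 : Finset (MvPolynomial (Fin 3) K), (∀ f ∈ 𝓕, Irreducible f) ∧
      ∑ f ∈ 𝓕, f.totalDegree ≤ F.totalDegree ∧
      ∀ x, eval x F = 0 → ∃ f ∈ 𝓕, eval x f = 0 := by
  induction F using UniqueFactorizationMonoid.induction_on_prime with
  | h₁ => exact absurd rfl hF
  | h₂ F hu =>
    refine ⟨∅, by simp, by simp, fun x hx => ?_⟩
    exact absurd hx (hu.map (eval x)).ne_zero
  | h₃ F p hF0 hp ih =>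
    obtain ⟨𝓕, h1, h2, h3⟩ := ih hF0
    refine ⟨insert p 𝓕, ?_, ?_, ?_⟩
    · intro f hf
      rcases Finset.mem_insert.1 hf with rfl | hf
      · exact hp.irreducible
      · exact h1 f hf
    · rw [totalDegree_mul_of_isDomain hp.ne_zero hF0]
      by_cases h : p ∈ 𝓕
      · rw [Finset.insert_eq_of_mem h]
        omega
      · rw [Finset.sum_insert h]
        omega
    · intro x hx
      rw [map_mul, mul_eq_zero] at hx
      rcases hx with hx | hx
      · exact ⟨p, Finset.mem_insert_self _ _, hx⟩
      · obtain ⟨f, hf, hfx⟩ := h3 x hx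
        exact ⟨f, Finset.mem_insert_of_mem hf, hfx⟩

lemma totalDegree_pos_of_irreducible {f : MvPolynomial (Fin 3) K} (hf : Irreducible f) :
    0 < f.totalDegree := by
  by_contra h
  have h0 : f.totalDegree = 0 := by omega
  rw [totalDegree_eq_zero_iff_eq_C] at h0
  refine hf.not_isUnit ?_
  rw [h0]
  refine (IsUnit.mk0 _ fun hc => ?_).map C
  rw [hc, map_zero] at h0
  exact hf.ne_zero h0

lemma sum_sq_le {𝓕 : Finset (MvPolynomial (Fin 3) K)} {D : ℕ}
    (h : ∑ f ∈ 𝓕, f.totalDegree ≤ D) : ∑ f ∈ 𝓕, f.totalDegree ^ 2 ≤ D ^ 2 := by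
  calc ∑ f ∈ 𝓕, f.totalDegree ^ 2 ≤ ∑ f ∈ 𝓕, D * f.totalDegree := by
        refine Finset.sum_le_sum fun f hf => ?_
        have := (Finset.single_le_sum (f := fun f : MvPolynomial (Fin 3) K => f.totalDegree)
          (fun _ _ => Nat.zero_le _) hf).trans h
        nlinarith
    _ = D * ∑ f ∈ 𝓕, f.totalDegree := (Finset.mul_sum _ _ _).symm
    _ ≤ D ^ 2 := by nlinarith

/-- The lines of a family in the surface `f = 0` with many points of `X` on further lines of the
family in this surface. All lines count if the degree is at most two. -/
noncomputable def badSet (𝓛 : Finset (Ln K)) (X : Finset (Fin 3 → K))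
    (f : MvPolynomial (Fin 3) K) : Finset (Ln K) :=
  𝓛.filter fun ℓ => res ℓ f = 0 ∧ (f.totalDegree ≤ 2 ∨ 11 * f.totalDegree <
    (X.filter fun x => OnL ℓ x ∧ ∃ m ∈ 𝓛, m ≠ ℓ ∧ res m f = 0 ∧ OnL m x).card)

/-- The points of `X` on a line and on `f = 0` which are accounted for by degree considerations. -/
noncomputable def exc (𝓛 : Finset (Ln K)) (X : Finset (Fin 3 → K)) (f : MvPolynomial (Fin 3) K)
    (ℓ : Ln K) : Finset (Fin 3 → K) :=
  if ℓ ∈ badSet 𝓛 X f then ∅ else X.filter fun x => OnL ℓ x ∧ eval x f = 0 ∧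
    (res ℓ f ≠ 0 ∨ ∃ m ∈ 𝓛, m ≠ ℓ ∧ res m f = 0 ∧ OnL m x)

variable {𝓛 : Finset (Ln K)} {X : Finset (Fin 3 → K)} {f : MvPolynomial (Fin 3) K}

lemma card_exc_le {ℓ : Ln K} (hℓ : ℓ ∈ 𝓛) : (exc 𝓛 X f ℓ).card ≤ 11 * f.totalDegree := by
  rw [exc]
  split_ifs with h
  · simp
  · by_cases h0 : res ℓ f = 0
    · rw [badSet, Finset.mem_filter] at h
      push Not at h
      refine le_trans (Finset.card_le_card ?_) (h hℓ h0).2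
      intro x hx
      simp only [Finset.mem_filter, h0, ne_eq, not_true, false_or] at hx ⊢
      exact ⟨hx.1, hx.2.1, hx.2.2.2⟩
    · have := card_zeros_le h0 (X.filter fun x => OnL ℓ x ∧ eval x f = 0)
        fun x hx => (Finset.mem_filter.1 hx).2
      refine le_trans (Finset.card_le_card ?_) (this.trans (by omega))
      exact Finset.monotone_filter_right _ fun x _ hx => ⟨hx.1, hx.2.1⟩

lemma sum_card_exc_le {𝓕 : Finset (MvPolynomial (Fin 3) K)} {D : ℕ}
    (h : ∑ f ∈ 𝓕, f.totalDegree ≤ D) :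
    ∑ ℓ ∈ 𝓛, ∑ f ∈ 𝓕, (exc 𝓛 X f ℓ).card ≤ 𝓛.card * (11 * D) := by
  rw [← smul_eq_mul, ← Finset.sum_const]
  refine Finset.sum_le_sum fun ℓ hℓ => ?_
  calc ∑ f ∈ 𝓕, (exc 𝓛 X f ℓ).card ≤ ∑ f ∈ 𝓕, 11 * f.totalDegree :=
        Finset.sum_le_sum fun f _ => card_exc_le hℓ
    _ ≤ 11 * D := by
        rw [← Finset.mul_sum]
        omega

lemma badSet_subset : badSet 𝓛 X f ⊆ 𝓛 := Finset.filter_subset _ _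

lemma res_eq_zero_of_mem_badSet {ℓ : Ln K} (h : ℓ ∈ badSet 𝓛 X f) : res ℓ f = 0 :=
  (Finset.mem_filter.1 h).2.1

lemma mem_exc_of_res_ne_zero {ℓ : Ln K} {x : Fin 3 → K} (hx : x ∈ X) (h1 : OnL ℓ x)
    (h2 : eval x f = 0) (h3 : res ℓ f ≠ 0) : x ∈ exc 𝓛 X f ℓ := by
  rw [exc, if_neg fun h => h3 (res_eq_zero_of_mem_badSet h)]
  exact Finset.mem_filter.2 ⟨hx, h1, h2, Or.inl h3⟩

lemma mem_exc_of_other {ℓ m : Ln K} {x : Fin 3 → K} (hx : x ∈ X) (h1 : OnL ℓ x)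
    (h2 : eval x f = 0) (h3 : ℓ ∉ badSet 𝓛 X f) (hm : m ∈ 𝓛) (hne : m ≠ ℓ) (h4 : res m f = 0)
    (h5 : OnL m x) : x ∈ exc 𝓛 X f ℓ := by
  rw [exc, if_neg h3]
  exact Finset.mem_filter.2 ⟨hx, h1, h2, Or.inr ⟨m, hm, hne, h4, h5⟩⟩

variable [IsAlgClosed K] [CharZero K]

lemma card_badSet_le_of_three_le (hf : Irreducible f) (hs : ¬ Special f)
    (hd : 3 ≤ f.totalDegree) : (badSet 𝓛 X f).card ≤ 11 * f.totalDegree ^ 2 := by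
  refine card_bad_le hf (fun h => hs (Or.inr h)) hd _ fun ℓ hℓ => ?_
  obtain ⟨-, h0, h | h⟩ := Finset.mem_filter.1 hℓ
  · omega
  · refine ⟨h0, _, h, fun x hx => ?_⟩
    obtain ⟨-, h1, m, -, h2⟩ := Finset.mem_filter.1 hx
    exact ⟨h1, m, h2⟩

lemma card_badSet_le (hf : Irreducible f) (hs : ¬ Special f) {P : Finset (K × K)}
    (hP : 𝓛 ⊆ P ×ˢ P) :
    (badSet 𝓛 X f).card ≤ 5 * P.card * f.totalDegree + 11 * f.totalDegree ^ 2 := by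
  by_cases hd : 3 ≤ f.totalDegree
  · exact (card_badSet_le_of_three_le hf hs hd).trans (by omega)
  · refine (card_lines_le hf hs P _ (badSet_subset.trans hP)
      fun ℓ hℓ => res_eq_zero_of_mem_badSet hℓ).trans ?_
    have hpos := totalDegree_pos_of_irreducible hf
    obtain h | h : f.totalDegree = 1 ∨ f.totalDegree = 2 := by omega
    · rw [h]
      omega
    · rw [h]
      omega

end Factors

/-! ### Counting all crossing points -/

section AllCrossings

open MvPolynomial
open scoped Classical

universe u

variable {K : Type u} [Field K]

/-- The lines of a family which are bad for one of the non-special factors. -/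
noncomputable def badUnion (𝓛 : Finset (Ln K)) (X : Finset (Fin 3 → K))
    (𝓕 : Finset (MvPolynomial (Fin 3) K)) : Finset (Ln K) :=
  (𝓕.filter fun f => ¬ Special f).biUnion (badSet 𝓛 X)

lemma badUnion_subset (𝓛 : Finset (Ln K)) (X : Finset (Fin 3 → K))
    (𝓕 : Finset (MvPolynomial (Fin 3) K)) : badUnion 𝓛 X 𝓕 ⊆ 𝓛 :=
  Finset.biUnion_subset.2 fun _ _ => badSet_subset

variable [CharZero K]

lemma cross_subset_exc_union {𝓛 : Finset (Ln K)} {𝓕 : Finset (MvPolynomial (Fin 3) K)}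
    (hirr : ∀ f ∈ 𝓕, Irreducible f) (h : ∀ x ∈ cross 𝓛, ∃ f ∈ 𝓕, eval x f = 0) :
    cross 𝓛 ⊆ (𝓛.biUnion fun ℓ => 𝓕.biUnion fun f => exc 𝓛 (cross 𝓛) f ℓ) ∪
      cross (badUnion 𝓛 (cross 𝓛) 𝓕) := by
  intro x hx
  obtain ⟨f, hf, hfx⟩ := h x hx
  obtain ⟨ℓ, hℓ, m, hm, hg, h1, h2⟩ := mem_cross.1 hx
  rw [Finset.mem_union]
  have key : ∀ n ∈ 𝓛, x ∈ exc 𝓛 (cross 𝓛) f n →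
      x ∈ 𝓛.biUnion fun ℓ => 𝓕.biUnion fun f => exc 𝓛 (cross 𝓛) f ℓ := fun n hn hxn =>
    Finset.mem_biUnion.2 ⟨n, hn, Finset.mem_biUnion.2 ⟨f, hf, hxn⟩⟩
  by_cases r1 : res ℓ f = 0
  swap
  · exact Or.inl (key ℓ hℓ (mem_exc_of_res_ne_zero hx h1 hfx r1))
  by_cases r2 : res m f = 0
  swap
  · exact Or.inl (key m hm (mem_exc_of_res_ne_zero hx h2 hfx r2))
  by_cases hs : Special f
  · obtain ⟨κ, -, hκ⟩ := hs.exists_key (hirr f hf) r1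
    exact absurd hg (not_good_of_hasKey (hκ ℓ r1) (hκ m r2))
  by_cases b1 : ℓ ∈ badSet 𝓛 (cross 𝓛) f
  swap
  · exact Or.inl (key ℓ hℓ (mem_exc_of_other hx h1 hfx b1 hm hg.ne.symm r2 h2))
  by_cases b2 : m ∈ badSet 𝓛 (cross 𝓛) f
  swap
  · exact Or.inl (key m hm (mem_exc_of_other hx h2 hfx b2 hℓ hg.ne r1 h1))
  have hf' : f ∈ 𝓕.filter fun f => ¬ Special f := Finset.mem_filter.2 ⟨hf, hs⟩
  exact Or.inr (mem_cross.2 ⟨ℓ, Finset.mem_biUnion.2 ⟨f, hf', b1⟩, m,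
    Finset.mem_biUnion.2 ⟨f, hf', b2⟩, hg, h1, h2⟩)

variable [IsAlgClosed K]

lemma card_badUnion_le {𝓛 : Finset (Ln K)} {X : Finset (Fin 3 → K)}
    {𝓕 : Finset (MvPolynomial (Fin 3) K)} (hirr : ∀ f ∈ 𝓕, Irreducible f) {D : ℕ}
    (hD : ∑ f ∈ 𝓕, f.totalDegree ≤ D) {P : Finset (K × K)} (hP : 𝓛 ⊆ P ×ˢ P) :
    (badUnion 𝓛 X 𝓕).card ≤ 5 * P.card * D + 11 * D ^ 2 := by
  calc (badUnion 𝓛 X 𝓕).card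
      ≤ ∑ f ∈ 𝓕.filter fun f => ¬ Special f, (badSet 𝓛 X f).card := Finset.card_biUnion_le
    _ ≤ ∑ f ∈ 𝓕.filter fun f => ¬ Special f,
          (5 * P.card * f.totalDegree + 11 * f.totalDegree ^ 2) :=
        Finset.sum_le_sum fun f hf => by
          rw [Finset.mem_filter] at hf
          exact card_badSet_le (hirr f hf.1) hf.2 hP
    _ ≤ ∑ f ∈ 𝓕, (5 * P.card * f.totalDegree + 11 * f.totalDegree ^ 2) :=
        Finset.sum_le_sum_of_subset (Finset.filter_subset _ _)
    _ ≤ 5 * P.card * D + 11 * D ^ 2 := by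
        rw [Finset.sum_add_distrib, ← Finset.mul_sum, ← Finset.mul_sum]
        exact add_le_add (Nat.mul_le_mul_left _ hD) (Nat.mul_le_mul_left _ (sum_sq_le hD))

/-- A family of `L` lines of pairs from `N` points has at most `25 N L` crossing points. -/
lemma card_cross_le (P : Finset (K × K)) (𝓛 : Finset (Ln K)) (hP : 𝓛 ⊆ P ×ˢ P) :
    (cross 𝓛).card ≤ 25 * P.card * 𝓛.card := by
  induction 𝓛 using Finset.strongInduction with
  | H 𝓛 ih =>
  obtain rfl | ⟨ℓ₀, hℓ₀⟩ := 𝓛.eq_empty_or_nonempty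
  · simp [cross]
  by_cases hex : ∃ ℓ ∈ 𝓛, (crossOn 𝓛 ℓ).card ≤ 25 * P.card
  · obtain ⟨ℓ, hℓ, hc⟩ := hex
    have h1 := ih _ (Finset.erase_ssubset hℓ) ((Finset.erase_subset _ _).trans hP)
    have h2 := (Finset.card_le_card (cross_subset 𝓛 ℓ)).trans (Finset.card_union_le _ _)
    rw [← Finset.card_erase_add_one hℓ]
    linarith
  push Not at hex
  set N := P.card with hN
  set L := 𝓛.card with hL
  set D := 3 * L / (25 * N + 1) with hD
  have hLN : L ≤ N ^ 2 := by
    simpa [pow_two] using Finset.card_le_card hP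
  have hLpos : 0 < L := Finset.card_pos.2 ⟨ℓ₀, hℓ₀⟩
  have hNpos : 0 < N := by
    rcases Nat.eq_zero_or_pos N with h | h
    · simp [h] at hLN
      omega
    · exact h
  have hDL : D * (25 * N + 1) ≤ 3 * L := Nat.div_mul_le_self _ _
  have hDL' : 3 * L < (D + 1) * (25 * N + 1) := by
    rw [mul_comm (D + 1)]
    exact Nat.lt_mul_div_succ _ (by omega)
  obtain ⟨F, hF0, hFd, hF⟩ := exists_surface_of_crossOn 𝓛 (25 * N) D
    (fun ℓ hℓ => (hex ℓ hℓ).le) (hDL'.trans_le (Nat.mul_le_mul_right _ (by omega)))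
  obtain ⟨𝓕, hirr, hdeg, hzero⟩ := exists_factors hF0
  have hdeg' := hdeg.trans hFd
  have hsub := cross_subset_exc_union hirr fun x hx => by
    obtain ⟨ℓ, hℓ, m, hm, hg, h1, h2⟩ := mem_cross.1 hx
    exact hzero x (h1.eval_eq_zero (hF ℓ hℓ))
  have hbad := card_badUnion_le (X := cross 𝓛) hirr hdeg' hP
  have hDN : 25 * D ≤ 3 * N := by
    refine Nat.le_of_mul_le_mul_right (c := N) ?_ hNpos
    nlinarith
  have hlt : (badUnion 𝓛 (cross 𝓛) 𝓕).card < 𝓛.card := by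
    rw [← hL]
    nlinarith [Nat.mul_le_mul_left D hDN]
  have hih := ih _ (Finset.ssubset_iff_subset_ne.2 ⟨badUnion_subset _ _ _, fun h => by
    rw [h] at hlt
    exact lt_irrefl _ hlt⟩) ((badUnion_subset _ _ _).trans hP)
  have hexc : (𝓛.biUnion fun ℓ => 𝓕.biUnion fun f => exc 𝓛 (cross 𝓛) f ℓ).card ≤
      L * (11 * D) :=
    (Finset.card_biUnion_le.trans (Finset.sum_le_sum fun _ _ => Finset.card_biUnion_le)).trans
      (sum_card_exc_le hdeg')
  have htot := (Finset.card_le_card hsub).trans (Finset.card_union_le _ _)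
  have hb : 25 * (25 * (badUnion 𝓛 (cross 𝓛) 𝓕).card) ≤ 474 * L := by
    nlinarith [Nat.mul_le_mul_left D hDN]
  nlinarith [Nat.mul_le_mul_left L hDN, Nat.mul_le_mul_left N hb]

end AllCrossings

/-! ### Rich points on a surface -/

section RichOnSurface

open MvPolynomial
open scoped Classical

universe u

variable {K : Type u} [Field K]

/-- The lines of a family through a point. -/
noncomputable def thru (𝓛 : Finset (Ln K)) (x : Fin 3 → K) : Finset (Ln K) :=
  𝓛.filter fun ℓ => OnL ℓ x

lemma mem_thru {𝓛 : Finset (Ln K)} {x : Fin 3 → K} {ℓ : Ln K} :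
    ℓ ∈ thru 𝓛 x ↔ ℓ ∈ 𝓛 ∧ OnL ℓ x := Finset.mem_filter

lemma sum_card_offDiag_thru_le (T : Finset (Fin 3 → K)) (B : Finset (Ln K)) :
    ∑ x ∈ T, (thru B x).offDiag.card ≤ B.card ^ 2 := by
  rw [← Finset.card_biUnion, pow_two, ← Finset.card_product]
  · refine Finset.card_le_card (Finset.biUnion_subset.2 fun x _ p hp => ?_)
    obtain ⟨h1, h2, -⟩ := Finset.mem_offDiag.1 hp
    exact Finset.mem_product.2 ⟨(mem_thru.1 h1).1, (mem_thru.1 h2).1⟩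
  · intro x _ y _ hxy
    rw [Function.onFun, Finset.disjoint_left]
    intro p hp hp'
    obtain ⟨h1, h2, h⟩ := Finset.mem_offDiag.1 hp
    obtain ⟨h3, h4, -⟩ := Finset.mem_offDiag.1 hp'
    exact h (eq_of_two_points hxy (mem_thru.1 h1).2 (mem_thru.1 h3).2 (mem_thru.1 h2).2
      (mem_thru.1 h4).2)

lemma exists_hasKey_of_not_good {ℓ m : Ln K} {x : Fin 3 → K} (h0 : x 0 ≠ 0) (h1 : OnL ℓ x)
    (h2 : OnL m x) (h : ¬ Good ℓ m) :
    HasKey m (.inl (ℓ.1.1, ℓ.2.1)) ∨ HasKey m (.inr (ℓ.1.2, ℓ.2.2)) := by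
  rw [Good, not_and_or, not_not, not_not] at h
  rcases h with h | h
  · refine Or.inl (Prod.ext h.symm ?_)
    change m.2.1 = ℓ.2.1
    linear_combination h1.1 - h2.1 - x 0 * h
  · refine Or.inr (Prod.ext h.symm ?_)
    change m.2.2 = ℓ.2.2
    exact mul_left_cancel₀ h0 (by linear_combination h1.2 - h2.2 - h)

lemma exists_not_hasKey (κ : (K × K) ⊕ (K × K)) : ∃ ℓ : Ln K, ¬ HasKey ℓ κ := by
  rcases κ with ⟨a, b⟩ | ⟨a, b⟩
  · exact ⟨((a + 1, 0), (0, 0)), fun h => by simp [HasKey] at h⟩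
  · exact ⟨((0, a + 1), (0, 0)), fun h => by simp [HasKey] at h⟩

lemma keyPoly_ne_zero (κ : (K × K) ⊕ (K × K)) : keyPoly κ ≠ 0 := by
  intro h
  obtain ⟨ℓ, hℓ⟩ := exists_not_hasKey κ
  exact hℓ ((res_keyPoly_eq_zero_iff ℓ κ).1 (by rw [h, map_zero]))

variable {f : MvPolynomial (Fin 3) K}

lemma card_hasKey_le (hf : Irreducible f) (hd : 2 ≤ f.totalDegree) {B : Finset (Ln K)}
    (hB : ∀ ℓ ∈ B, res ℓ f = 0) (κ : (K × K) ⊕ (K × K)) :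
    (B.filter fun ℓ => HasKey ℓ κ).card ≤ f.totalDegree := by
  have hκ := totalDegree_keyPoly_le (K := K) κ
  refine (bezout_lines hf (G := keyPoly κ) (fun h => ?_) _ fun ℓ hℓ => ?_).trans
    ((Nat.mul_le_mul_left _ hκ).trans (mul_one _).le)
  · exact keyPoly_ne_zero κ (eq_zero_of_dvd_of_totalDegree_lt h (by omega))
  · rw [Finset.mem_filter] at hℓ
    exact ⟨hB ℓ hℓ.1, (res_keyPoly_eq_zero_iff ℓ κ).2 hℓ.2⟩

lemma card_le_of_not_good (hf : Irreducible f) (hd : 2 ≤ f.totalDegree) {B : Finset (Ln K)}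
    (hB : ∀ ℓ ∈ B, res ℓ f = 0) (T : Finset (Fin 3 → K)) (h0 : ∀ x ∈ T, x 0 ≠ 0)
    (hT : ∀ x ∈ T, ∃ ℓ ∈ B, ∃ m ∈ B, m ≠ ℓ ∧ OnL ℓ x ∧ OnL m x ∧ ¬ Good ℓ m) :
    T.card ≤ B.card * (2 * f.totalDegree) := by
  let R : Ln K → Finset (Ln K) := fun ℓ =>
    (B.filter fun m => HasKey m (.inl (ℓ.1.1, ℓ.2.1))) ∪
      B.filter fun m => HasKey m (.inr (ℓ.1.2, ℓ.2.2))
  have hR : ∀ ℓ, (R ℓ).card ≤ 2 * f.totalDegree := fun ℓ =>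
    (Finset.card_union_le _ _).trans (by
      have h1 := card_hasKey_le hf hd hB (.inl (ℓ.1.1, ℓ.2.1))
      have h2 := card_hasKey_le hf hd hB (.inr (ℓ.1.2, ℓ.2.2))
      omega)
  have hex : ∀ x, ∃ ℓ m, x ∈ T → ℓ ∈ B ∧ m ∈ R ℓ ∧ m ≠ ℓ ∧ OnL ℓ x ∧ OnL m x := by
    intro x
    by_cases hx : x ∈ T
    · obtain ⟨ℓ, hℓ, m, hm, hne, h1, h2, hg⟩ := hT x hx
      refine ⟨ℓ, m, fun _ => ⟨hℓ, Finset.mem_union.2 ?_, hne, h1, h2⟩⟩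
      exact (exists_hasKey_of_not_good (h0 x hx) h1 h2 hg).imp
        (fun h => Finset.mem_filter.2 ⟨hm, h⟩) (fun h => Finset.mem_filter.2 ⟨hm, h⟩)
    · exact ⟨((0, 0), (0, 0)), ((0, 0), (0, 0)), fun h => absurd h hx⟩
  choose φ ψ h using hex
  calc T.card ≤ (B.sigma R).card := by
        refine Finset.card_le_card_of_injOn (fun x => ⟨φ x, ψ x⟩) ?_ ?_
        · intro x hx
          exact Finset.mem_sigma.2 ⟨(h x hx).1, (h x hx).2.1⟩
        · intro x hx y hy hxy
          simp only [Sigma.mk.injEq, heq_eq_eq] at hxy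
          by_contra hne
          obtain ⟨-, -, e, h1, h2⟩ := h x hx
          obtain ⟨-, -, -, h3, h4⟩ := h y hy
          rw [← hxy.1] at h3
          rw [← hxy.2] at h4
          exact e (eq_of_two_points hne h2 h4 h1 h3)
    _ = ∑ ℓ ∈ B, (R ℓ).card := Finset.card_sigma _ _
    _ ≤ B.card * (2 * f.totalDegree) := by
        rw [← smul_eq_mul, ← Finset.sum_const]
        exact Finset.sum_le_sum fun ℓ _ => hR ℓ

variable {𝓛 : Finset (Ln K)} {T : Finset (Fin 3 → K)}

lemma sum_card_exc_thru_le {𝓕 : Finset (MvPolynomial (Fin 3) K)} {D : ℕ}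
    (h : ∑ f ∈ 𝓕, f.totalDegree ≤ D) (k : ℕ) (hk : ∀ x ∈ T, k ≤ (thru 𝓛 x).card) :
    k * (T.filter fun x => ∃ f ∈ 𝓕, (thru 𝓛 x).card ≤
      8 * (𝓛.filter fun ℓ => x ∈ exc 𝓛 T f ℓ).card).card ≤ 88 * 𝓛.card * D := by
  set T' := T.filter fun x => ∃ f ∈ 𝓕, (thru 𝓛 x).card ≤
      8 * (𝓛.filter fun ℓ => x ∈ exc 𝓛 T f ℓ).card with hT'
  have h1 : ∀ x ∈ T', k ≤ 8 * ∑ f ∈ 𝓕, (𝓛.filter fun ℓ => x ∈ exc 𝓛 T f ℓ).card := by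
    intro x hx
    obtain ⟨hxT, f, hf, hle⟩ := Finset.mem_filter.1 hx
    refine (hk x hxT).trans (hle.trans (Nat.mul_le_mul_left _ ?_))
    exact Finset.single_le_sum (f := fun f => (𝓛.filter fun ℓ => x ∈ exc 𝓛 T f ℓ).card)
      (fun _ _ => Nat.zero_le _) hf
  have h2 := Finset.card_nsmul_le_sum _ _ _ h1
  rw [smul_eq_mul, mul_comm, ← Finset.mul_sum, Finset.sum_comm] at h2
  have h3 : ∀ f ∈ 𝓕, ∑ x ∈ T', (𝓛.filter fun ℓ => x ∈ exc 𝓛 T f ℓ).card ≤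
      ∑ ℓ ∈ 𝓛, (exc 𝓛 T f ℓ).card := by
    intro f _
    simp_rw [Finset.card_filter]
    rw [Finset.sum_comm]
    simp_rw [← Finset.card_filter]
    refine Finset.sum_le_sum fun ℓ _ => Finset.card_le_card fun x hx => ?_
    exact (Finset.mem_filter.1 hx).2
  have h4 := (Finset.sum_le_sum h3).trans_eq Finset.sum_comm
  have h5 := h4.trans (sum_card_exc_le h)
  linarith

lemma exists_factor_of_eval_eq_zero {𝓕 : Finset (MvPolynomial (Fin 3) K)} {x : Fin 3 → K}
    (hx : x ∈ T) (hr : 2 ≤ (thru 𝓛 x).card) (hz : ∃ f ∈ 𝓕, eval x f = 0)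
    (hexc : ¬ ∃ f ∈ 𝓕, (thru 𝓛 x).card ≤ 8 * (𝓛.filter fun ℓ => x ∈ exc 𝓛 T f ℓ).card) :
    ∃ f ∈ 𝓕, 7 * (thru 𝓛 x).card < 8 * (thru (badSet 𝓛 T f) x).card := by
  obtain ⟨f, hf, hfx⟩ := hz
  push Not at hexc
  have hlt := hexc f hf
  refine ⟨f, hf, ?_⟩
  set G := (thru 𝓛 x).filter fun ℓ => x ∉ exc 𝓛 T f ℓ with hG
  have hsplit : ((thru 𝓛 x).filter fun ℓ => x ∈ exc 𝓛 T f ℓ).card + G.card = (thru 𝓛 x).card :=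
    Finset.card_filter_add_card_filter_not _
  have hE : ((thru 𝓛 x).filter fun ℓ => x ∈ exc 𝓛 T f ℓ).card ≤
      (𝓛.filter fun ℓ => x ∈ exc 𝓛 T f ℓ).card :=
    Finset.card_le_card (Finset.filter_subset_filter _ (Finset.filter_subset _ _))
  have hG2 : 1 < G.card := by omega
  have hres : ∀ ℓ ∈ G, res ℓ f = 0 := by
    intro ℓ hℓ
    obtain ⟨h1, h2⟩ := Finset.mem_filter.1 hℓ
    by_contra h
    exact h2 (mem_exc_of_res_ne_zero hx (mem_thru.1 h1).2 hfx h)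
  have hsub : G ⊆ thru (badSet 𝓛 T f) x := by
    intro ℓ hℓ
    obtain ⟨h1, h2⟩ := Finset.mem_filter.1 hℓ
    obtain ⟨h3, h4⟩ := mem_thru.1 h1
    refine mem_thru.2 ⟨?_, h4⟩
    by_contra hb
    obtain ⟨m, hm, hne⟩ := Finset.exists_mem_ne hG2 ℓ
    obtain ⟨h5, h6⟩ := mem_thru.1 (Finset.mem_filter.1 hm).1
    exact h2 (mem_exc_of_other hx h4 hfx hb h5 hne (hres m hm) h6)
  have := Finset.card_le_card hsub
  omega

/-- More than seven eighths of the lines through `x` have the key `κ`. -/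
def Dominates (𝓛 : Finset (Ln K)) (κ : (K × K) ⊕ (K × K)) (x : Fin 3 → K) : Prop :=
  7 * (thru 𝓛 x).card < 8 * ((thru 𝓛 x).filter fun ℓ => HasKey ℓ κ).card

variable [CharZero K] [IsAlgClosed K]

/-- The number of points which are rich because of a given factor. -/
lemma card_rich_of_factor_le {P : Finset (K × K)} (hP : 𝓛 ⊆ P ×ˢ P) (hf : Irreducible f)
    (h0 : ∀ x ∈ T, x 0 ≠ 0) {k τ : ℕ} (hk8 : 8 ≤ k) (hk : ∀ x ∈ T, k ≤ (thru 𝓛 x).card)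
    (hτ : ∀ κ, (T.filter (Dominates 𝓛 κ)).card ≤ τ) :
    k ^ 2 * (T.filter fun x => 7 * (thru 𝓛 x).card < 8 * (thru (badSet 𝓛 T f) x).card).card ≤
      k ^ 2 * τ + 50 * P.card ^ 2 +
        k ^ 2 * (275 * P.card * f.totalDegree ^ 2 + 22 * f.totalDegree ^ 3) := by
  set Tf := T.filter fun x => 7 * (thru 𝓛 x).card < 8 * (thru (badSet 𝓛 T f) x).card with hTf
  have hn : ∀ x ∈ Tf, 7 * k < 8 * (thru (badSet 𝓛 T f) x).card := fun x hx =>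
    (Nat.mul_le_mul_left 7 (hk x (Finset.mem_filter.1 hx).1)).trans_lt (Finset.mem_filter.1 hx).2
  by_cases hs : Special f
  · refine le_trans (Nat.mul_le_mul_left _ ?_) (le_add_right (Nat.le_add_right _ _))
    obtain he | ⟨x₀, hx₀⟩ := Tf.eq_empty_or_nonempty
    · simp [he]
    have : (thru (badSet 𝓛 T f) x₀).Nonempty := by
      rw [← Finset.card_pos]
      have := hn x₀ hx₀
      omega
    obtain ⟨ℓ, hℓ⟩ := this
    obtain ⟨κ, -, hκ⟩ := hs.exists_key hf (res_eq_zero_of_mem_badSet (mem_thru.1 hℓ).1)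
    refine le_trans (Finset.card_le_card fun x hx => ?_) (hτ κ)
    obtain ⟨hxT, hx⟩ := Finset.mem_filter.1 hx
    refine Finset.mem_filter.2 ⟨hxT, hx.trans_le (Nat.mul_le_mul_left _ ?_)⟩
    refine Finset.card_le_card fun m hm => ?_
    obtain ⟨h1, h2⟩ := mem_thru.1 hm
    exact Finset.mem_filter.2 ⟨mem_thru.2 ⟨badSet_subset h1, h2⟩,
      hκ m (res_eq_zero_of_mem_badSet h1)⟩
  by_cases hd : 3 ≤ f.totalDegree
  · refine le_trans (Nat.mul_le_mul_left _ ?_) (Nat.le_add_left _ _)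
    have hB := card_badSet_le_of_three_le (𝓛 := 𝓛) (X := T) hf hs hd
    have hsub : Tf ⊆ cross (badSet 𝓛 T f) ∪
        Tf.filter fun x => x ∉ cross (badSet 𝓛 T f) := by
      intro x hx
      rw [Finset.mem_union, Finset.mem_filter]
      tauto
    refine ((Finset.card_le_card hsub).trans (Finset.card_union_le _ _)).trans
      (add_le_add ?_ ?_)
    · refine (card_cross_le P _ (badSet_subset.trans hP)).trans ?_
      refine (Nat.mul_le_mul_left _ hB).trans_eq (by ring)
    · refine (card_le_of_not_good hf (by omega) (fun ℓ hℓ => res_eq_zero_of_mem_badSet hℓ) _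
        (fun x hx => h0 x (Finset.mem_filter.1 (Finset.mem_filter.1 hx).1).1)
        fun x hx => ?_).trans ((Nat.mul_le_mul_right _ hB).trans_eq (by ring))
      obtain ⟨hx, hxc⟩ := Finset.mem_filter.1 hx
      have h2 : 1 < (thru (badSet 𝓛 T f) x).card := by
        have := hn x hx
        omega
      obtain ⟨ℓ, hℓ, m, hm, hne⟩ := Finset.one_lt_card.1 h2
      rw [mem_thru] at hℓ hm
      exact ⟨ℓ, hℓ.1, m, hm.1, hne.symm, hℓ.2, hm.2, fun hg =>
        hxc (mem_cross.2 ⟨ℓ, hℓ.1, m, hm.1, hg, hℓ.2, hm.2⟩)⟩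
  · refine le_trans ?_ (le_add_right (Nat.le_add_left _ _))
    have hB : (badSet 𝓛 T f).card ≤ 5 * P.card := by
      refine (card_lines_le hf hs P _ (badSet_subset.trans hP)
        fun ℓ hℓ => res_eq_zero_of_mem_badSet hℓ).trans (Nat.mul_le_mul_right _ ?_)
      nlinarith
    have h1 : ∀ x ∈ Tf, k ^ 2 ≤ 2 * (thru (badSet 𝓛 T f) x).offDiag.card := by
      intro x hx
      have := hn x hx
      rw [Finset.offDiag_card]
      generalize (thru (badSet 𝓛 T f) x).card = n at this ⊢
      rw [← Nat.mul_sub_one]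
      obtain ⟨n, rfl⟩ : ∃ n', n = n' + 1 := ⟨n - 1, by omega⟩
      rw [Nat.add_sub_cancel]
      nlinarith
    have h2 := Finset.card_nsmul_le_sum _ _ _ h1
    rw [smul_eq_mul, ← Finset.mul_sum] at h2
    have h3 := sum_card_offDiag_thru_le Tf (badSet 𝓛 T f)
    nlinarith

end RichOnSurface

/-! ### The number of rich points -/

section RichPoints

open MvPolynomial
open scoped Classical

universe u

variable {K : Type u} [Field K]

/-- The conclusion of polynomial partitioning for a set of points with respect to a family of
lines. -/
def Partitions (𝓛 : Finset (Ln K)) (S : Finset (Fin 3 → K)) : Prop :=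
  ∀ J : ℕ, ∃ F : MvPolynomial (Fin 3) K, F ≠ 0 ∧ F.totalDegree ≤ 42 * 2 ^ J ∧
    8 ^ J * ∑ ℓ ∈ 𝓛, (S.filter fun x => OnL ℓ x ∧ eval x F ≠ 0).card ≤
      8 ^ J * (𝓛.card * (42 * 2 ^ J + 1)) + 2 * S.card ^ 2

lemma mul_card_filter_eval_ne_zero_le {𝓛 : Finset (Ln K)} {T : Finset (Fin 3 → K)}
    (F : MvPolynomial (Fin 3) K) {k : ℕ} (hk : ∀ x ∈ T, k ≤ (thru 𝓛 x).card) :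
    k * (T.filter fun x => eval x F ≠ 0).card ≤
      ∑ ℓ ∈ 𝓛, (T.filter fun x => OnL ℓ x ∧ eval x F ≠ 0).card := by
  have h1 := Finset.card_nsmul_le_sum (T.filter fun x => eval x F ≠ 0) (fun x => (thru 𝓛 x).card)
    k fun x hx => hk x (Finset.mem_filter.1 hx).1
  rw [smul_eq_mul, mul_comm] at h1
  refine h1.trans_eq ?_
  simp_rw [thru, Finset.card_filter]
  rw [Finset.sum_comm]
  refine Finset.sum_congr rfl fun ℓ _ => ?_
  rw [Finset.sum_filter]
  refine Finset.sum_congr rfl fun x _ => ?_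
  by_cases h1 : OnL ℓ x <;> by_cases h2 : eval x F ≠ 0 <;> simp [h1, h2]

variable [CharZero K] [IsAlgClosed K]

lemma card_rich_aux {P : Finset (K × K)} {T : Finset (Fin 3 → K)}
    (hpart : Partitions (P ×ˢ P) T) (h0 : ∀ x ∈ T, x 0 ≠ 0) {k τ : ℕ} (hk8 : 8 ≤ k)
    (hk : ∀ x ∈ T, k ≤ (thru (P ×ˢ P) x).card)
    (hτ : ∀ κ, (T.filter (Dominates (P ×ˢ P) κ)).card ≤ τ) (J : ℕ) {D : ℕ}
    (hD : D = 42 * 2 ^ J) :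
    8 ^ J * (k ^ 2 * T.card) ≤ k * (8 ^ J * (P.card ^ 2 * (D + 1)) + 2 * T.card ^ 2) +
      8 ^ J * (88 * k * P.card ^ 2 * D + D * k ^ 2 * τ + 50 * D * P.card ^ 2 +
        k ^ 2 * (275 * P.card * D ^ 2 + 22 * D ^ 3)) := by
  obtain ⟨F, hF0, hFd, hcell⟩ := hpart J
  obtain ⟨𝓕, hirr, hdeg, hzero⟩ := exists_factors hF0
  rw [← hD] at hFd hcell
  have hdegD := hdeg.trans hFd
  set 𝓛 := P ×ˢ P with h𝓛
  have hL : 𝓛.card = P.card ^ 2 := by rw [h𝓛, Finset.card_product, pow_two]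
  set T0 := T.filter fun x => eval x F ≠ 0 with hT0
  set T1 := T.filter fun x => ∃ f ∈ 𝓕, (thru 𝓛 x).card ≤
      8 * (𝓛.filter fun ℓ => x ∈ exc 𝓛 T f ℓ).card with hT1
  let Tf : MvPolynomial (Fin 3) K → Finset (Fin 3 → K) := fun f =>
    T.filter fun x => 7 * (thru 𝓛 x).card < 8 * (thru (badSet 𝓛 T f) x).card
  have hsub : T ⊆ T0 ∪ (T1 ∪ 𝓕.biUnion Tf) := by
    intro x hx
    by_cases c0 : eval x F = 0
    swap
    · exact Finset.mem_union_left _ (Finset.mem_filter.2 ⟨hx, c0⟩)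
    refine Finset.mem_union_right _ ?_
    by_cases c1 : ∃ f ∈ 𝓕, (thru 𝓛 x).card ≤ 8 * (𝓛.filter fun ℓ => x ∈ exc 𝓛 T f ℓ).card
    · exact Finset.mem_union_left _ (Finset.mem_filter.2 ⟨hx, c1⟩)
    refine Finset.mem_union_right _ ?_
    have := hk x hx
    obtain ⟨f, hf, hlt⟩ := exists_factor_of_eval_eq_zero hx (by omega) (hzero x c0) c1
    exact Finset.mem_biUnion.2 ⟨f, hf, Finset.mem_filter.2 ⟨hx, hlt⟩⟩
  have hcard : T.card ≤ T0.card + (T1.card + ∑ f ∈ 𝓕, (Tf f).card) :=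
    (Finset.card_le_card hsub).trans ((Finset.card_union_le _ _).trans
      (Nat.add_le_add_left ((Finset.card_union_le _ _).trans
        (Nat.add_le_add_left Finset.card_biUnion_le _)) _))
  have b0 : 8 ^ J * (k * T0.card) ≤ 8 ^ J * (P.card ^ 2 * (D + 1)) + 2 * T.card ^ 2 := by
    rw [← hL]
    exact (Nat.mul_le_mul_left _ (mul_card_filter_eval_ne_zero_le F hk)).trans hcell
  have b1 : k * T1.card ≤ 88 * P.card ^ 2 * D := by
    rw [← hL]
    exact sum_card_exc_thru_le hdegD k hk
  have hcardF : 𝓕.card ≤ D := by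
    refine le_trans ?_ hdegD
    rw [Finset.card_eq_sum_ones]
    exact Finset.sum_le_sum fun f hf => totalDegree_pos_of_irreducible (hirr f hf)
  have hcube : ∑ f ∈ 𝓕, f.totalDegree ^ 3 ≤ D ^ 3 := by
    calc ∑ f ∈ 𝓕, f.totalDegree ^ 3 ≤ ∑ f ∈ 𝓕, D * f.totalDegree ^ 2 := by
          refine Finset.sum_le_sum fun f hf => ?_
          have := (Finset.single_le_sum (f := fun f : MvPolynomial (Fin 3) K => f.totalDegree)
            (fun _ _ => Nat.zero_le _) hf).trans hdegD
          nlinarith [sq_nonneg f.totalDegree]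
      _ ≤ D * D ^ 2 := by
          rw [← Finset.mul_sum]
          exact Nat.mul_le_mul_left _ (sum_sq_le hdegD)
      _ = D ^ 3 := by ring
  have b2 : k ^ 2 * ∑ f ∈ 𝓕, (Tf f).card ≤ D * k ^ 2 * τ + 50 * D * P.card ^ 2 +
      k ^ 2 * (275 * P.card * D ^ 2 + 22 * D ^ 3) := by
    rw [Finset.mul_sum]
    refine (Finset.sum_le_sum fun f hf =>
      card_rich_of_factor_le (subset_refl _) (hirr f hf) h0 hk8 hk hτ).trans ?_
    rw [Finset.sum_add_distrib, Finset.sum_const, ← Finset.mul_sum, Finset.sum_add_distrib,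
      ← Finset.mul_sum, ← Finset.mul_sum, smul_eq_mul]
    refine add_le_add ?_ (Nat.mul_le_mul_left _ (add_le_add
      (Nat.mul_le_mul_left _ (sum_sq_le hdegD)) (Nat.mul_le_mul_left _ hcube)))
    refine (Nat.mul_le_mul_right _ hcardF).trans_eq (by ring)
  calc 8 ^ J * (k ^ 2 * T.card)
      ≤ 8 ^ J * (k ^ 2 * (T0.card + (T1.card + ∑ f ∈ 𝓕, (Tf f).card))) :=
        Nat.mul_le_mul_left _ (Nat.mul_le_mul_left _ hcard)
    _ = k * (8 ^ J * (k * T0.card)) + 8 ^ J * (k * (k * T1.card) +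
          k ^ 2 * ∑ f ∈ 𝓕, (Tf f).card) := by ring
    _ ≤ _ := by
        refine add_le_add (Nat.mul_le_mul_left _ b0) (Nat.mul_le_mul_left _ ?_)
        refine (add_le_add (Nat.mul_le_mul_left k b1) b2).trans_eq (by ring)

lemma rich_numerics {a n k s τ B D : ℝ} (ha : 1 ≤ a) (ha' : 418 * (336 * a) ^ 2 < 3 * a ^ 3)
    (hs0 : 0 ≤ s) (hB0 : 0 < B) (hk : 22 * (336 * a) ≤ k) (hkn : k ≤ n)
    (hB1 : 4 * a * n ≤ k * B) (hB2 : k * B ≤ 8 * a * n) (hD : D = 42 * B)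
    (hτ : k * τ ≤ 2 * n ^ 2) (hs1 : 4 * a ^ 3 * n ^ 3 ≤ k ^ 2 * s)
    (hs2 : k ^ 2 * s ≤ 8 * a ^ 3 * n ^ 3) :
    k * (B ^ 3 * (n ^ 2 * (D + 1)) + 2 * s ^ 2) +
      B ^ 3 * (88 * k * n ^ 2 * D + D * k ^ 2 * τ + 50 * D * n ^ 2 +
        k ^ 2 * (275 * n * D ^ 2 + 22 * D ^ 3)) < B ^ 3 * (k ^ 2 * s) := by
  set δ := 336 * a with hδ
  have hδ1 : 1 ≤ δ := by linarith
  have hk1 : 1 ≤ k := by linarith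
  have hn1 : 1 ≤ n := by linarith
  have hD0 : 0 < D := by rw [hD]; positivity
  have hkD : k * D ≤ δ * n := by rw [hD, hδ]; linarith
  have hδ2 : δ ≤ δ ^ 2 := by nlinarith
  have t1 : k * n ^ 2 * (D + 1) ≤ (δ + 1) * n ^ 3 := by
    have := mul_le_mul_of_nonneg_right hkD (sq_nonneg n)
    have := mul_le_mul_of_nonneg_right hkn (sq_nonneg n)
    nlinarith
  have t2 : 88 * k * n ^ 2 * D ≤ 88 * δ * n ^ 3 := by
    have := mul_le_mul_of_nonneg_right hkD (sq_nonneg n)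
    nlinarith
  have t3 : D * k ^ 2 * τ ≤ 2 * δ * n ^ 3 := by
    calc D * k ^ 2 * τ = (k * D) * (k * τ) := by ring
      _ ≤ (k * D) * (2 * n ^ 2) := by gcongr
      _ ≤ (δ * n) * (2 * n ^ 2) := by gcongr
      _ = _ := by ring
  have t4 : 50 * D * n ^ 2 ≤ 50 * δ * n ^ 3 := by
    have : D ≤ δ * n := by nlinarith
    calc 50 * D * n ^ 2 ≤ 50 * (δ * n) * n ^ 2 := by gcongr
      _ = _ := by ring
  have t5 : k ^ 2 * (275 * n * D ^ 2) ≤ 275 * δ ^ 2 * n ^ 3 := by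
    calc k ^ 2 * (275 * n * D ^ 2) = 275 * n * (k * D) ^ 2 := by ring
      _ ≤ 275 * n * (δ * n) ^ 2 := by gcongr
      _ = _ := by ring
  have t6 : k ^ 2 * (22 * D ^ 3) ≤ δ ^ 2 * n ^ 3 := by
    have h : 22 * δ * (k ^ 2 * (22 * D ^ 3)) ≤ 22 * δ * (δ ^ 2 * n ^ 3) := by
      calc 22 * δ * (k ^ 2 * (22 * D ^ 3)) ≤ k * (k ^ 2 * (22 * D ^ 3)) := by gcongr
        _ = 22 * (k * D) ^ 3 := by ring
        _ ≤ 22 * (δ * n) ^ 3 := by gcongr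
        _ = _ := by ring
    exact le_of_mul_le_mul_left h (by positivity)
  have t7 : k * (2 * s ^ 2) ≤ B ^ 3 * (k ^ 2 * s / 4) := by
    have h : k ^ 3 * (k * (2 * s ^ 2)) ≤ k ^ 3 * (B ^ 3 * (k ^ 2 * s / 4)) := by
      calc k ^ 3 * (k * (2 * s ^ 2)) = 2 * (k ^ 2 * s) * (k ^ 2 * s) := by ring
        _ ≤ 2 * (8 * a ^ 3 * n ^ 3) * (k ^ 2 * s) := by gcongr
        _ = (4 * a * n) ^ 3 * (k ^ 2 * s / 4) := by ring
        _ ≤ (k * B) ^ 3 * (k ^ 2 * s / 4) := by gcongr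
        _ = _ := by ring
    exact le_of_mul_le_mul_left h (by positivity)
  have hn3 : 0 < n ^ 3 := by positivity
  have hsum : k * n ^ 2 * (D + 1) + (88 * k * n ^ 2 * D + D * k ^ 2 * τ + 50 * D * n ^ 2 +
      k ^ 2 * (275 * n * D ^ 2 + 22 * D ^ 3)) ≤ 418 * δ ^ 2 * n ^ 3 := by
    have : (1 + 141 * δ) * n ^ 3 ≤ 142 * δ ^ 2 * n ^ 3 := by
      gcongr
      nlinarith
    nlinarith
  have hlt : 418 * δ ^ 2 * n ^ 3 < 3 * (k ^ 2 * s / 4) := by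
    have := mul_lt_mul_of_pos_right ha' hn3
    linarith
  have hB3 : 0 < B ^ 3 := by positivity
  have := mul_lt_mul_of_pos_left (hsum.trans_lt hlt) hB3
  linarith

/-- There are `O(N ^ 3 / k ^ 2)` points on at least `k` of the lines given by pairs from `N`
points, if few of them are dominated by a single key. -/
lemma card_rich_le {P : Finset (K × K)} {T : Finset (Fin 3 → K)}
    (hpart : ∀ S ⊆ T, Partitions (P ×ˢ P) S) (h0 : ∀ x ∈ T, x 0 ≠ 0) {k τ : ℕ}
    (hk37 : 2 ^ 37 ≤ k) (hkN : k ≤ P.card) (hk : ∀ x ∈ T, k ≤ (thru (P ×ˢ P) x).card)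
    (hτ : ∀ κ, (T.filter (Dominates (P ×ˢ P) κ)).card ≤ τ) (hτk : k * τ ≤ 2 * P.card ^ 2) :
    k ^ 2 * T.card ≤ 2 ^ 74 * P.card ^ 3 := by
  by_contra! hcon
  set N := P.card with hN
  have hk0 : 0 < k := by omega
  set s := 2 ^ 74 * N ^ 3 / k ^ 2 + 1 with hs
  have hs1 : 2 ^ 74 * N ^ 3 ≤ k ^ 2 * s := (Nat.lt_mul_div_succ _ (by positivity)).le
  have hs2 : k ^ 2 * s ≤ 2 * (2 ^ 74 * N ^ 3) := by
    have h1 := Nat.mul_div_le (2 ^ 74 * N ^ 3) (k ^ 2)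
    have h2 : k ^ 2 ≤ N ^ 2 := Nat.pow_le_pow_left hkN 2
    have h3 : N ^ 2 ≤ 2 ^ 74 * N ^ 3 := by
      have : 1 ≤ 2 ^ 74 * N := by nlinarith
      nlinarith [Nat.mul_le_mul_right (N ^ 2) this]
    rw [hs, mul_add, mul_one]
    linarith
  have hsT : s ≤ T.card := by
    rw [hs, Nat.succ_le_iff, Nat.div_lt_iff_lt_mul (by positivity), mul_comm T.card]
    exact hcon
  obtain ⟨T', hT', hT's⟩ := Finset.exists_subset_card_eq hsT
  set j := Nat.log 2 (N / k) with hj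
  have hNk : N / k ≠ 0 := (Nat.div_pos hkN hk0).ne'
  have hj1 : k * 2 ^ j ≤ N := by
    rw [mul_comm]
    exact (Nat.le_div_iff_mul_le hk0).1 (Nat.pow_log_le_self 2 hNk)
  have hj2 : N < k * 2 ^ (j + 1) := by
    have := Nat.lt_pow_succ_log_self (b := 2) one_lt_two (N / k)
    rw [mul_comm]
    exact (Nat.div_lt_iff_lt_mul hk0).1 this
  have haux := card_rich_aux (hpart T' hT') (fun x hx => h0 x (hT' hx)) (by omega)
    (fun x hx => hk x (hT' hx))
    (fun κ => (Finset.card_le_card (Finset.filter_subset_filter _ hT')).trans (hτ κ))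
    (j + 27) rfl
  rw [hT's, ← hN] at haux
  have h8 : (8 : ℕ) ^ (j + 27) = (2 ^ (j + 27)) ^ 3 := by
    rw [← pow_mul, mul_comm, pow_mul]
    norm_num
  rw [h8] at haux
  have hauxR := (Nat.cast_le (α := ℝ)).2 haux
  push_cast at hauxR
  have hB : (2 : ℝ) ^ (j + 27) = 2 ^ 26 * 2 ^ (j + 1) := by
    rw [← pow_add, show 26 + (j + 1) = j + 27 by omega]
  have hB0 : (0 : ℝ) < 2 ^ (j + 27) := by positivity
  have hkNR : (k : ℝ) ≤ N := Nat.cast_le.2 hkN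
  have hτR : (k : ℝ) * τ ≤ 2 * N ^ 2 := by exact_mod_cast hτk
  generalize (2 : ℝ) ^ (j + 27) = B at hauxR hB hB0
  refine not_lt.2 hauxR (rich_numerics (a := 2 ^ 24) (by norm_num) (by norm_num)
    (Nat.cast_nonneg _) hB0 ?_ hkNR ?_ ?_ rfl hτR ?_ ?_)
  · have := (Nat.cast_le (α := ℝ)).2 hk37
    push_cast at this
    linarith
  · have : (N : ℝ) ≤ k * 2 ^ (j + 1) := by exact_mod_cast hj2.le
    rw [hB]
    linarith
  · have : (k : ℝ) * 2 ^ j ≤ N := by exact_mod_cast hj1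
    rw [hB, pow_succ 2 j]
    linarith
  · have := (Nat.cast_le (α := ℝ)).2 hs1
    push_cast at this
    linarith
  · have := (Nat.cast_le (α := ℝ)).2 hs2
    push_cast at this
    linarith

end RichPoints

/-! ### Counting good crossing pairs -/

section GoodPairs

open MvPolynomial
open scoped Classical

universe u

variable {K : Type u} [Field K]

/-- The ordered pairs of lines in good position through a point. -/
noncomputable def goodPairs (𝓛 : Finset (Ln K)) (x : Fin 3 → K) : Finset (Ln K × Ln K) :=
  (thru 𝓛 x ×ˢ thru 𝓛 x).filter fun p => Good p.1 p.2

lemma card_goodPairs_le (𝓛 : Finset (Ln K)) (x : Fin 3 → K) :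
    (goodPairs 𝓛 x).card ≤ (thru 𝓛 x).card ^ 2 :=
  (Finset.card_filter_le _ _).trans_eq (by rw [Finset.card_product, pow_two])

/-- The lines through a point without a given key. -/
noncomputable def outer (𝓛 : Finset (Ln K)) (κ : (K × K) ⊕ (K × K)) (x : Fin 3 → K) :
    Finset (Ln K) := (thru 𝓛 x).filter fun ℓ => ¬ HasKey ℓ κ

lemma card_goodPairs_le_outer (𝓛 : Finset (Ln K)) (κ : (K × K) ⊕ (K × K)) (x : Fin 3 → K) :
    (goodPairs 𝓛 x).card ≤ 2 * ((thru 𝓛 x).card * (outer 𝓛 κ x).card) := by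
  have hsub : goodPairs 𝓛 x ⊆ outer 𝓛 κ x ×ˢ thru 𝓛 x ∪ thru 𝓛 x ×ˢ outer 𝓛 κ x := by
    rintro ⟨ℓ, m⟩ h
    obtain ⟨h1, hg⟩ := Finset.mem_filter.1 h
    obtain ⟨hℓ, hm⟩ := Finset.mem_product.1 h1
    by_cases hk : HasKey ℓ κ
    · exact Finset.mem_union_right _ (Finset.mem_product.2
        ⟨hℓ, Finset.mem_filter.2 ⟨hm, fun h' => not_good_of_hasKey hk h' hg⟩⟩)
    · exact Finset.mem_union_left _ (Finset.mem_product.2 ⟨Finset.mem_filter.2 ⟨hℓ, hk⟩, hm⟩)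
  refine ((Finset.card_le_card hsub).trans (Finset.card_union_le _ _)).trans_eq ?_
  rw [Finset.card_product, Finset.card_product]
  ring

lemma Dominates.unique {𝓛 : Finset (Ln K)} {κ κ' : (K × K) ⊕ (K × K)} {x : Fin 3 → K}
    (hr : 2 ≤ (thru 𝓛 x).card) (h : Dominates 𝓛 κ x) (h' : Dominates 𝓛 κ' x) : κ = κ' := by
  unfold Dominates at h h'
  have hu := Finset.card_union_add_card_inter ((thru 𝓛 x).filter fun ℓ => HasKey ℓ κ)
    ((thru 𝓛 x).filter fun ℓ => HasKey ℓ κ')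
  have hle : ((thru 𝓛 x).filter (fun ℓ => HasKey ℓ κ) ∪
      (thru 𝓛 x).filter fun ℓ => HasKey ℓ κ').card ≤ (thru 𝓛 x).card :=
    Finset.card_le_card (Finset.union_subset (Finset.filter_subset _ _) (Finset.filter_subset _ _))
  obtain ⟨ℓ, hℓ, m, hm, hne⟩ := Finset.one_lt_card.1 (show 1 < ((thru 𝓛 x).filter
    (fun ℓ => HasKey ℓ κ) ∩ (thru 𝓛 x).filter fun ℓ => HasKey ℓ κ').card by omega)
  simp only [Finset.mem_inter, Finset.mem_filter] at hℓ hm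
  have hℓ1 := hℓ.1.2
  have hℓ2 := hℓ.2.2
  have hm1 := hm.1.2
  have hm2 := hm.2.2
  rcases κ with a | a <;> rcases κ' with b | b <;> simp only [HasKey] at hℓ1 hℓ2 hm1 hm2
  · rw [← hℓ1, ← hℓ2]
  · refine absurd ?_ hne
    have e1 := Prod.ext_iff.1 (hℓ1.trans hm1.symm)
    have e2 := Prod.ext_iff.1 (hℓ2.trans hm2.symm)
    exact Prod.ext (Prod.ext e1.1 e2.1) (Prod.ext e1.2 e2.2)
  · refine absurd ?_ hne
    have e1 := Prod.ext_iff.1 (hℓ1.trans hm1.symm)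
    have e2 := Prod.ext_iff.1 (hℓ2.trans hm2.symm)
    exact Prod.ext (Prod.ext e2.1 e1.1) (Prod.ext e2.2 e1.2)
  · rw [← hℓ1, ← hℓ2]

lemma Dominates.eval_keyPoly {𝓛 : Finset (Ln K)} {κ : (K × K) ⊕ (K × K)} {x : Fin 3 → K}
    (h : Dominates 𝓛 κ x) : eval x (keyPoly κ) = 0 := by
  have : ((thru 𝓛 x).filter fun ℓ => HasKey ℓ κ).Nonempty := by
    rw [← Finset.card_pos]
    unfold Dominates at h
    omega
  obtain ⟨ℓ, hℓ⟩ := this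
  obtain ⟨h1, h2⟩ := Finset.mem_filter.1 hℓ
  exact (mem_thru.1 h1).2.eval_eq_zero ((res_keyPoly_eq_zero_iff ℓ κ).2 h2)

lemma sum_card_outer_le (𝓛 : Finset (Ln K)) (κ : (K × K) ⊕ (K × K)) (A : Finset (Fin 3 → K))
    (hA : ∀ x ∈ A, eval x (keyPoly κ) = 0) : ∑ x ∈ A, (outer 𝓛 κ x).card ≤ 𝓛.card := by
  simp_rw [outer, thru, Finset.filter_filter, Finset.card_filter]
  rw [Finset.sum_comm]
  simp_rw [← Finset.card_filter]
  rw [Finset.card_eq_sum_ones 𝓛]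
  refine Finset.sum_le_sum fun ℓ _ => ?_
  by_cases hk : HasKey ℓ κ
  · simp [hk]
  · refine (card_zeros_le (ℓ := ℓ) (fun h => hk ((res_keyPoly_eq_zero_iff ℓ κ).1 h)) _
      fun x hx => ?_).trans (totalDegree_keyPoly_le κ)
    rw [Finset.mem_filter] at hx
    exact ⟨hx.2.1, hA x hx.1⟩

lemma card_thru_le {P : Finset (K × K)} {x : Fin 3 → K} (h0 : x 0 ≠ 0) :
    (thru (P ×ˢ P) x).card ≤ P.card := by
  refine Finset.card_le_card_of_injOn Prod.fst (fun ℓ hℓ => ?_) fun ℓ hℓ m hm h => ?_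
  · exact (Finset.mem_product.1 (mem_thru.1 hℓ).1).1
  · exact (mem_thru.1 hℓ).2.snd_eq h0 (mem_thru.1 hm).2 h

variable [CharZero K] [IsAlgClosed K] {P : Finset (K × K)}

lemma sum_card_goodPairs_dominated_le {A : Finset (Fin 3 → K)}
    (hpart : ∀ S ⊆ A, Partitions (P ×ˢ P) S) (h0 : ∀ x ∈ A, x 0 ≠ 0) {k : ℕ}
    (hk37 : 2 ^ 37 ≤ k) (hkN : k ≤ P.card)
    (hk : ∀ x ∈ A, k ≤ (thru (P ×ˢ P) x).card ∧ (thru (P ×ˢ P) x).card ≤ 2 * k)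
    (hdom : ∀ x ∈ A, ∃ κ, Dominates (P ×ˢ P) κ x) :
    ∑ x ∈ A, (goodPairs (P ×ˢ P) x).card ≤ 8 * (2 ^ 74 * P.card ^ 3) := by
  set 𝓛 := P ×ˢ P with h𝓛
  set N := P.card with hN
  have hk0 : 0 < k := by omega
  have hex : ∀ x, ∃ κ, x ∈ A → Dominates 𝓛 κ x := by
    intro x
    by_cases hx : x ∈ A
    · exact (hdom x hx).imp fun κ h _ => h
    · exact ⟨.inl (0, 0), fun h => absurd h hx⟩
  choose key hkey using hex
  set τ := N ^ 2 / k + 1 with hτ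
  have hτ1 : N ^ 2 ≤ k * τ := (Nat.lt_mul_div_succ _ hk0).le
  have hτ2 : k * τ ≤ 2 * N ^ 2 := by
    have h1 := Nat.mul_div_le (N ^ 2) k
    have h2 : k ≤ N ^ 2 := hkN.trans (Nat.le_self_pow (by omega) N)
    rw [hτ, mul_add, mul_one]
    omega
  let A' : (K × K) ⊕ (K × K) → Finset (Fin 3 → K) := fun κ => A.filter fun x => key x = κ
  have htr : ∀ κ, ∃ S ⊆ A' κ, S.card = min (A' κ).card τ := fun κ =>
    Finset.exists_subset_card_eq (min_le_left _ _)
  choose S hSsub hScard using htr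
  set keys := A.image key with hkeys
  set T := keys.biUnion S with hT
  have hTA : T ⊆ A := Finset.biUnion_subset.2 fun κ _ => (hSsub κ).trans (Finset.filter_subset _ _)
  have hSkey : ∀ κ, ∀ x ∈ S κ, x ∈ A ∧ key x = κ := fun κ x hx =>
    Finset.mem_filter.1 (hSsub κ hx)
  have hrich := card_rich_le (P := P) (T := T) (k := k) (τ := τ)
    (fun S' hS' => hpart S' (hS'.trans hTA))
    (fun x hx => h0 x (hTA hx)) hk37 hkN (fun x hx => (hk x (hTA hx)).1) (fun κ => by
      refine le_trans (Finset.card_le_card (t := S κ) fun x hx => ?_)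
        ((hScard κ).trans_le (min_le_right _ _))
      obtain ⟨hxT, hxd⟩ := Finset.mem_filter.1 hx
      obtain ⟨κ', -, hxS⟩ := Finset.mem_biUnion.1 hxT
      obtain ⟨hxA, rfl⟩ := hSkey κ' x hxS
      have hr2 : 2 ≤ (thru 𝓛 x).card := by
        have := (hk x hxA).1
        omega
      rwa [hxd.unique hr2 (hkey x hxA)]) hτ2
  have hTcard : T.card = ∑ κ ∈ keys, (S κ).card := by
    refine Finset.card_biUnion fun κ _ κ' _ hne => Finset.disjoint_left.2 fun x h1 h2 => hne ?_
    rw [← (hSkey κ x h1).2, ← (hSkey κ' x h2).2]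
  have hclass : ∀ κ ∈ keys, ∑ x ∈ A' κ, (goodPairs 𝓛 x).card ≤ 8 * k ^ 2 * (S κ).card := by
    intro κ _
    have hA' : ∀ x ∈ A' κ, x ∈ A ∧ Dominates 𝓛 κ x := fun x hx => by
      obtain ⟨hxA, rfl⟩ := Finset.mem_filter.1 hx
      exact ⟨hxA, hkey x hxA⟩
    have hout : ∑ x ∈ A' κ, (outer 𝓛 κ x).card ≤ 2 * k * (S κ).card := by
      by_cases hc : (A' κ).card ≤ τ
      · rw [hScard, min_eq_left hc, mul_comm, ← smul_eq_mul]
        refine Finset.sum_le_card_nsmul _ _ _ fun x hx => ?_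
        exact (Finset.card_filter_le _ _).trans (hk x (hA' x hx).1).2
      · rw [hScard, min_eq_right (by omega)]
        have := sum_card_outer_le 𝓛 κ (A' κ) fun x hx => (hA' x hx).2.eval_keyPoly
        rw [h𝓛, Finset.card_product, ← pow_two, ← hN] at this
        linarith
    calc ∑ x ∈ A' κ, (goodPairs 𝓛 x).card
        ≤ ∑ x ∈ A' κ, 4 * k * (outer 𝓛 κ x).card := by
          refine Finset.sum_le_sum fun x hx => (card_goodPairs_le_outer 𝓛 κ x).trans ?_
          have := Nat.mul_le_mul_right (outer 𝓛 κ x).card (hk x (hA' x hx).1).2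
          linarith
      _ ≤ 4 * k * (2 * k * (S κ).card) := by
          rw [← Finset.mul_sum]
          exact Nat.mul_le_mul_left _ hout
      _ = _ := by ring
  calc ∑ x ∈ A, (goodPairs 𝓛 x).card
      = ∑ κ ∈ keys, ∑ x ∈ A' κ, (goodPairs 𝓛 x).card :=
        (Finset.sum_fiberwise_of_maps_to (fun x hx => Finset.mem_image_of_mem key hx) _).symm
    _ ≤ ∑ κ ∈ keys, 8 * k ^ 2 * (S κ).card := Finset.sum_le_sum hclass
    _ = 8 * (k ^ 2 * T.card) := by
        rw [← Finset.mul_sum, hTcard]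
        ring
    _ ≤ _ := Nat.mul_le_mul_left _ hrich

lemma sum_card_goodPairs_level_le {A : Finset (Fin 3 → K)}
    (hpart : ∀ S ⊆ A, Partitions (P ×ˢ P) S) (h0 : ∀ x ∈ A, x 0 ≠ 0) {k : ℕ}
    (hk37 : 2 ^ 37 ≤ k)
    (hk : ∀ x ∈ A, k ≤ (thru (P ×ˢ P) x).card ∧ (thru (P ×ˢ P) x).card ≤ 2 * k) :
    ∑ x ∈ A, (goodPairs (P ×ˢ P) x).card ≤ 12 * (2 ^ 74 * P.card ^ 3) := by
  obtain rfl | ⟨x₀, hx₀⟩ := A.eq_empty_or_nonempty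
  · simp
  have hkN : k ≤ P.card := (hk x₀ hx₀).1.trans (card_thru_le (h0 x₀ hx₀))
  rw [← Finset.sum_filter_add_sum_filter_not A fun x => ∃ κ, Dominates (P ×ˢ P) κ x]
  have h1 : A.filter (fun x => ∃ κ, Dominates (P ×ˢ P) κ x) ⊆ A := Finset.filter_subset _ _
  have h2 : A.filter (fun x => ¬ ∃ κ, Dominates (P ×ˢ P) κ x) ⊆ A := Finset.filter_subset _ _
  have b1 := sum_card_goodPairs_dominated_le (fun S hS => hpart S (hS.trans h1))
    (fun x hx => h0 x (h1 hx)) hk37 hkN (fun x hx => hk x (h1 hx))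
    fun x hx => (Finset.mem_filter.1 hx).2
  have b2 := card_rich_le (τ := 0) (fun S hS => hpart S (hS.trans h2))
    (fun x hx => h0 x (h2 hx)) hk37 hkN (fun x hx => (hk x (h2 hx)).1)
    (fun κ => by
      rw [nonpos_iff_eq_zero, Finset.card_eq_zero, Finset.filter_eq_empty_iff]
      exact fun x hx hd => (Finset.mem_filter.1 hx).2 ⟨κ, hd⟩) (by omega)
  have b3 : ∑ x ∈ A.filter (fun x => ¬ ∃ κ, Dominates (P ×ˢ P) κ x),
      (goodPairs (P ×ˢ P) x).card ≤
        (A.filter fun x => ¬ ∃ κ, Dominates (P ×ˢ P) κ x).card • (2 * k) ^ 2 :=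
    Finset.sum_le_card_nsmul _ _ _ fun x hx =>
      (card_goodPairs_le _ _).trans (Nat.pow_le_pow_left (hk x (h2 hx)).2 2)
  rw [smul_eq_mul] at b3
  linarith

lemma sum_card_goodPairs_le (hpart : ∀ S ⊆ cross (P ×ˢ P), Partitions (P ×ˢ P) S) :
    ∑ x ∈ cross (P ×ˢ P), (goodPairs (P ×ˢ P) x).card ≤
      2 ^ 74 * P.card ^ 3 * (12 * Nat.log 2 P.card + 37) := by
  set 𝓛 := P ×ˢ P with h𝓛
  set N := P.card with hN
  have h0 : ∀ x ∈ cross 𝓛, x 0 ≠ 0 := by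
    intro x hx
    obtain ⟨ℓ, -, m, -, hg, h1, h2⟩ := mem_cross.1 hx
    exact hg.x0_ne h1 h2
  rw [← Finset.sum_filter_add_sum_filter_not (cross 𝓛) fun x => (thru 𝓛 x).card < 2 ^ 37]
  have b1 : ∑ x ∈ (cross 𝓛).filter (fun x => (thru 𝓛 x).card < 2 ^ 37),
      (goodPairs 𝓛 x).card ≤ 25 * (2 ^ 74 * N ^ 3) := by
    refine (Finset.sum_le_card_nsmul _ _ (2 ^ 74) fun x hx => ?_).trans ?_
    · refine (card_goodPairs_le 𝓛 x).trans
        ((Nat.pow_le_pow_left (Finset.mem_filter.1 hx).2.le 2).trans_eq (by norm_num))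
    · rw [smul_eq_mul]
      have h1 := (Finset.card_filter_le (cross 𝓛) fun x => (thru 𝓛 x).card < 2 ^ 37).trans
        (card_cross_le P 𝓛 subset_rfl)
      rw [h𝓛, Finset.card_product, ← hN, ← h𝓛] at h1
      nlinarith
  set R := (cross 𝓛).filter fun x => ¬ (thru 𝓛 x).card < 2 ^ 37 with hR
  have hRsub : R ⊆ cross 𝓛 := Finset.filter_subset _ _
  have hlog : ∀ x ∈ R, Nat.log 2 (thru 𝓛 x).card ∈ Finset.range (Nat.log 2 N + 1) := fun x hx =>
    Finset.mem_range.2 (Nat.lt_succ_of_le (Nat.log_mono_right (card_thru_le (h0 x (hRsub hx)))))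
  have b2 : ∑ x ∈ R, (goodPairs 𝓛 x).card ≤ (Nat.log 2 N + 1) * (12 * (2 ^ 74 * N ^ 3)) := by
    rw [← Finset.sum_fiberwise_of_maps_to hlog]
    refine (Finset.sum_le_card_nsmul _ _ (12 * (2 ^ 74 * N ^ 3)) fun j _ => ?_).trans_eq ?_
    · obtain he | ⟨x₀, hx₀⟩ := (R.filter fun x => Nat.log 2 (thru 𝓛 x).card = j).eq_empty_or_nonempty
      · rw [he]
        simp
      have hsub : R.filter (fun x => Nat.log 2 (thru 𝓛 x).card = j) ⊆ cross 𝓛 :=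
        (Finset.filter_subset _ _).trans hRsub
      have hmem : ∀ x ∈ R.filter (fun x => Nat.log 2 (thru 𝓛 x).card = j),
          2 ^ 37 ≤ (thru 𝓛 x).card ∧ Nat.log 2 (thru 𝓛 x).card = j := fun x hx => by
        obtain ⟨h1, h2⟩ := Finset.mem_filter.1 hx
        exact ⟨not_lt.1 (Finset.mem_filter.1 h1).2, h2⟩
      refine sum_card_goodPairs_level_le (k := 2 ^ j) (fun S hS => hpart S (hS.trans hsub))
        (fun x hx => h0 x (hsub hx)) ?_ fun x hx => ?_
      · obtain ⟨h1, rfl⟩ := hmem x₀ hx₀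
        exact Nat.pow_le_pow_right two_pos (Nat.le_log_of_pow_le one_lt_two h1)
      · obtain ⟨h1, rfl⟩ := hmem x hx
        refine ⟨Nat.pow_log_le_self 2 (by omega), ?_⟩
        rw [← pow_succ']
        exact (Nat.lt_pow_succ_log_self one_lt_two _).le
    · rw [Finset.card_range, smul_eq_mul]
  linarith

/-- The number of ordered pairs of lines in good position which meet. -/
lemma card_crossing_pairs_le (hpart : ∀ S ⊆ cross (P ×ˢ P), Partitions (P ×ˢ P) S) :
    (((P ×ˢ P) ×ˢ (P ×ˢ P)).filter fun p : Ln K × Ln K =>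
      Good p.1 p.2 ∧ ∃ x, OnL p.1 x ∧ OnL p.2 x).card ≤
      2 ^ 74 * P.card ^ 3 * (12 * Nat.log 2 P.card + 37) := by
  refine le_trans (le_trans (Finset.card_le_card ?_) Finset.card_biUnion_le)
    (sum_card_goodPairs_le hpart)
  rintro ⟨ℓ, m⟩ hp
  obtain ⟨hm, hg, x, h1, h2⟩ := Finset.mem_filter.1 hp
  obtain ⟨hℓ, hm⟩ := Finset.mem_product.1 hm
  refine Finset.mem_biUnion.2 ⟨x, mem_cross.2 ⟨ℓ, hℓ, m, hm, hg, h1, h2⟩, ?_⟩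
  exact Finset.mem_filter.2 ⟨Finset.mem_product.2 ⟨mem_thru.2 ⟨hℓ, h1⟩, mem_thru.2 ⟨hm, h2⟩⟩, hg⟩

end GoodPairs

/-! ### From real to complex lines -/

section Complexification

open MvPolynomial
open scoped Classical

/-- The complex point of the plane given by a real one. -/
def toComplex (p : ℝ × ℝ) : ℂ × ℂ := (p.1, p.2)

lemma toComplex_injective : Function.Injective toComplex := by
  rintro ⟨a, b⟩ ⟨c, d⟩ h
  simpa [toComplex] using h

/-- The complex line given by a real one. -/
def lineToComplex (ℓ : Ln ℝ) : Ln ℂ := (toComplex ℓ.1, toComplex ℓ.2)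

lemma lineToComplex_injective : Function.Injective lineToComplex := fun _ _ h =>
  Prod.ext (toComplex_injective (Prod.ext_iff.1 h).1) (toComplex_injective (Prod.ext_iff.1 h).2)

/-- The complex point of space given by a real one. -/
def ptToComplex (x : Fin 3 → ℝ) : Fin 3 → ℂ := fun i => x i

lemma ptToComplex_injective : Function.Injective ptToComplex := fun _ _ h =>
  funext fun i => Complex.ofReal_injective (congrFun h i)

lemma onL_complex_iff {ℓ : Ln ℝ} {x : Fin 3 → ℝ} :
    OnL (lineToComplex ℓ) (ptToComplex x) ↔ OnL ℓ x := by
  simp only [OnL, lineToComplex, toComplex, ptToComplex]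
  norm_cast

lemma good_complex_iff {ℓ m : Ln ℝ} : Good (lineToComplex ℓ) (lineToComplex m) ↔ Good ℓ m := by
  simp [Good, lineToComplex, toComplex]

lemma ip_complex (ℓ m : Ln ℝ) :
    ip (lineToComplex ℓ) (lineToComplex m) = ptToComplex (ip ℓ m) := by
  funext i
  fin_cases i <;> simp [ip, pt, lineToComplex, toComplex, ptToComplex]

lemma image_toComplex_product (P : Finset (ℝ × ℝ)) :
    P.image toComplex ×ˢ P.image toComplex = (P ×ˢ P).image lineToComplex :=
  (Finset.prodMap_image_product toComplex toComplex P P).symm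

lemma eval_ptToComplex (x : Fin 3 → ℝ) (F : MvPolynomial (Fin 3) ℝ) :
    eval (ptToComplex x) (map Complex.ofRealHom F) = (eval x F : ℝ) := by
  rw [eval_map]
  exact (eval₂_comp_left Complex.ofRealHom (RingHom.id ℝ) x F).symm

lemma partitions_image (L : Finset (Ln ℝ)) (S : Finset (Fin 3 → ℝ)) :
    Partitions (L.image lineToComplex) (S.image ptToComplex) := by
  intro J
  obtain ⟨F, hF0, hFd, hF⟩ := exists_partition_incidences S J
  refine ⟨map Complex.ofRealHom F, ?_, ?_, ?_⟩
  · rwa [Ne, map_eq_zero_iff _ (map_injective _ Complex.ofRealHom.injective)]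
  · exact (Finset.sup_mono (support_map_subset _ _)).trans hFd
  · rw [Finset.sum_image lineToComplex_injective.injOn,
      Finset.card_image_of_injective _ lineToComplex_injective,
      Finset.card_image_of_injective _ ptToComplex_injective]
    have h := hF L
    have hS : ∀ ℓ, ((S.image ptToComplex).filter fun x => OnL (lineToComplex ℓ) x ∧
        eval x (map Complex.ofRealHom F) ≠ 0).card =
        (S.filter fun x => OnL ℓ x ∧ eval x F ≠ 0).card := by
      intro ℓ
      rw [Finset.filter_image, Finset.card_image_of_injective _ ptToComplex_injective]
      simp_rw [onL_complex_iff, eval_ptToComplex, Ne, Complex.ofReal_eq_zero]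
    simp_rw [hS]
    exact_mod_cast h

lemma partitions_of_subset_cross {P : Finset (ℝ × ℝ)} {S : Finset (Fin 3 → ℂ)}
    (hS : S ⊆ cross (P.image toComplex ×ˢ P.image toComplex)) :
    Partitions (P.image toComplex ×ˢ P.image toComplex) S := by
  rw [image_toComplex_product] at hS ⊢
  have hreal : ∀ x ∈ S, ∃ y, ptToComplex y = x := by
    intro x hx
    obtain ⟨ℓ, hℓ, m, hm, hg, h1, h2⟩ := mem_cross.1 (hS hx)
    obtain ⟨ℓ, -, rfl⟩ := Finset.mem_image.1 hℓ
    obtain ⟨m, -, rfl⟩ := Finset.mem_image.1 hm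
    exact ⟨ip ℓ m, by rw [← ip_complex, hg.ip_eq h1 h2]⟩
  have : S = (S.preimage ptToComplex ptToComplex_injective.injOn).image ptToComplex := by
    rw [Finset.image_preimage, Finset.filter_true_of_mem]
    exact hreal
  rw [this]
  exact partitions_image _ _

lemma exists_meet {p q s t : ℝ × ℝ}
    (h : (q.1 - p.1) * (q.2 - p.2) = (t.1 - s.1) * (t.2 - s.2))
    (h0 : (q.1 - p.1) * (q.2 - p.2) ≠ 0) :
    Good (p, s) (q, t) ∧ ∃ x, OnL (p, s) x ∧ OnL (q, t) x := by
  have h1 : q.1 - p.1 ≠ 0 := left_ne_zero_of_mul h0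
  have h2 : q.2 - p.2 ≠ 0 := right_ne_zero_of_mul h0
  refine ⟨⟨fun e => h1 (sub_eq_zero.2 e.symm), fun e => h2 (sub_eq_zero.2 e.symm)⟩, ?_⟩
  have hl : (t.1 - s.1) / (q.1 - p.1) * (q.1 - p.1) = t.1 - s.1 := div_mul_cancel₀ _ h1
  have hr : (t.1 - s.1) / (q.1 - p.1) * (t.2 - s.2) = q.2 - p.2 := by
    rw [div_mul_eq_mul_div, div_eq_iff h1]
    linear_combination -h
  generalize (t.1 - s.1) / (q.1 - p.1) = c at hl hr
  refine ⟨pt (p, s) c, pt_onL _ _, ?_⟩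
  constructor
  · simp only [pt, Matrix.cons_val_one, Matrix.cons_val_zero]
    linear_combination hl
  · simp only [pt, Matrix.cons_val_two, Matrix.cons_val_zero, Matrix.tail_cons, Matrix.head_cons]
    linear_combination -hr

/-- The combinatorial form of the bound on rectangular quadruples. -/
lemma card_quadruples_le (P : Finset (ℝ × ℝ)) :
    (((P ×ˢ P) ×ˢ (P ×ˢ P)).filter fun q : ((ℝ × ℝ) × (ℝ × ℝ)) × ((ℝ × ℝ) × (ℝ × ℝ)) =>
      (q.1.2.1 - q.1.1.1) * (q.1.2.2 - q.1.1.2) = (q.2.2.1 - q.2.1.1) * (q.2.2.2 - q.2.1.2) ∧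
      (q.1.2.1 - q.1.1.1) * (q.1.2.2 - q.1.1.2) ≠ 0).card ≤
      2 ^ 74 * P.card ^ 3 * (12 * Nat.log 2 P.card + 37) := by
  have hmain := card_crossing_pairs_le (P := P.image toComplex)
    fun S hS => partitions_of_subset_cross hS
  rw [Finset.card_image_of_injective _ toComplex_injective] at hmain
  refine le_trans (Finset.card_le_card_of_injOn (fun q =>
    (lineToComplex (q.1.1, q.2.1), lineToComplex (q.1.2, q.2.2))) ?_ ?_) hmain
  · rintro ⟨⟨p, q⟩, ⟨s, t⟩⟩ hq
    simp only [Finset.coe_filter, Set.mem_ofPred_eq, Finset.mem_product] at hq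
    obtain ⟨⟨⟨hp, hq⟩, hs, ht⟩, h, h0⟩ := hq
    obtain ⟨hg, x, h1, h2⟩ := exists_meet h h0
    refine Finset.mem_filter.2 ⟨?_, good_complex_iff.2 hg, ptToComplex x, onL_complex_iff.2 h1,
      onL_complex_iff.2 h2⟩
    rw [image_toComplex_product]
    exact Finset.mem_product.2
      ⟨Finset.mem_image_of_mem _ (Finset.mk_mem_product hp hs),
        Finset.mem_image_of_mem _ (Finset.mk_mem_product hq ht)⟩
  · rintro ⟨⟨p, q⟩, ⟨s, t⟩⟩ - ⟨⟨p', q'⟩, ⟨s', t'⟩⟩ - h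
    have h1 := lineToComplex_injective (Prod.ext_iff.1 h).1
    have h2 := lineToComplex_injective (Prod.ext_iff.1 h).2
    simp only [Prod.mk.injEq] at h1 h2 ⊢
    tauto

lemma log_two_le {N : ℕ} (hN : 2 ≤ N) :
    (12 * (Nat.log 2 N : ℝ) + 37) ≤ 98 * Real.log N := by
  have h2 : (1 : ℝ) / 2 ≤ Real.log 2 := by
    have := Real.log_two_gt_d9
    linarith
  have h1 : (Nat.log 2 N : ℝ) * Real.log 2 ≤ Real.log N := by
    rw [← Real.log_pow]
    refine Real.log_le_log (by positivity) ?_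
    exact_mod_cast Nat.pow_log_le_self 2 (by omega)
  have h3 : (1 : ℝ) ≤ Nat.log 2 N := by
    exact_mod_cast Nat.log_pos one_lt_two hN
  have h4 : (Nat.log 2 N : ℝ) * (1 / 2) ≤ Nat.log 2 N * Real.log 2 := by gcongr
  linarith

end Complexification

end RectQuad

/-- There is an absolute constant C > 0 such that for every finite
set `P ⊆ ℝ²` with `|P| = N ≥ 2`, the number of quadruples `(p,q,s,t) ∈ P⁴` with
`R(p,q) = R(s,t) ≠ 0` is at most `C·N³·log N`. -/
theorem rect_quadruples_upper_bound :
    ∃ C : ℝ, 0 < C ∧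
      ∀ P : Finset (ℝ × ℝ), 2 ≤ P.card →
        (((((P ×ˢ P) ×ˢ (P ×ˢ P)).filter
            (fun q => rectArea q.1.1 q.1.2 = rectArea q.2.1 q.2.2 ∧
              rectArea q.1.1 q.1.2 ≠ 0)).card : ℝ) ≤
          C * (P.card : ℝ) ^ 3 * Real.log P.card) := by
  refine ⟨2 ^ 74 * 98, by norm_num, fun P hP => ?_⟩
  have h := (Nat.cast_le (α := ℝ)).2 (RectQuad.card_quadruples_le P)
  simp only [Nat.cast_mul, Nat.cast_add, Nat.cast_pow, Nat.cast_ofNat] at h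
  calc _ ≤ (2 : ℝ) ^ 74 * P.card ^ 3 * (12 * Nat.log 2 P.card + 37) := by
        refine le_trans (le_of_eq ?_) h
        simp only [rectArea]
        congr!
    _ ≤ 2 ^ 74 * P.card ^ 3 * (98 * Real.log P.card) := by
        gcongr
        exact RectQuad.log_two_le hP
    _ = _ := by ring
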